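/- arXiv:2112.03967 — 15 statements merged into one kernel-verified Lean document; each statement's English description precedes it below -/
import Mathlib

section
/- Let p be a prime, d ≥ 1, and V = (ℤ/pℤ)^d. Let x be an affine bijection of V, say x(v) = h(v) + t for an invertible linear map h : V → V and t ∈ V, and suppose x has prime order r. Then either (r+1) · |{v ∈ V : x(v) = v}| ≤ p^d, or all of the following hold: r = p, the fixed space ker(h − id) of the linear part h has dimension d − 1 (so h is a transvection), and |{v ∈ V : x(v) = v}| = p^{d−1}. -/
/-- The affine case of the paper's main theorem (Proposition 2.1):
let `p` be a prime, `d ≥ 1`, `V = (ℤ/pℤ)^d`, and let `x` be an affine bijection of `V`,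
`x v = h v + t` with `h` an invertible linear map and `t ∈ V`, of prime order `r`.
Then either `(r+1) · |Fix(x)| ≤ p^d`, or `r = p`, the fixed space of `h` has dimension
`d - 1` (so `h` is a transvection) and `|Fix(x)| = p^(d-1)`. -/
theorem stmt_0 (p d r : ℕ) [Fact p.Prime] (hd : 1 ≤ d)
    (h : (Fin d → ZMod p) ≃ₗ[ZMod p] (Fin d → ZMod p)) (t : Fin d → ZMod p)
    (x : Equiv.Perm (Fin d → ZMod p))
    (hx : ∀ v, x v = h v + t)
    (hr : r.Prime) (hord : orderOf x = r) :
    (r + 1) * Nat.card {v : Fin d → ZMod p // x v = v} ≤ p ^ d ∨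
      (r = p ∧
        Module.finrank (ZMod p)
          (LinearMap.ker (h.toLinearMap - (LinearMap.id : (Fin d → ZMod p) →ₗ[ZMod p] (Fin d → ZMod p)))) = d - 1 ∧
        Nat.card {v : Fin d → ZMod p // x v = v} = p ^ (d - 1)) := by
  classical
  have hp : p.Prime := Fact.out
  rcases isEmpty_or_nonempty {v : Fin d → ZMod p // x v = v} with he | ⟨⟨v0, hv0⟩⟩
  · left
    simp
  set K := LinearMap.ker (h.toLinearMap -
    (LinearMap.id : (Fin d → ZMod p) →ₗ[ZMod p] (Fin d → ZMod p))) with hK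
  have memK : ∀ w, w ∈ K ↔ h w = w := by
    intro w
    simp [hK, LinearMap.mem_ker, sub_eq_zero]
  have hv0' : h v0 + t = v0 := by rw [← hx]; exact hv0
  have key : ∀ v, x v = v ↔ v - v0 ∈ K := by
    intro v
    rw [memK, hx, map_sub]
    constructor
    · intro e
      linear_combination (exp := 1) e - hv0'
    · intro e
      linear_combination (exp := 1) e + hv0'
  have hcard : Nat.card {v : Fin d → ZMod p // x v = v} = Nat.card K :=
    Nat.card_congr ((Equiv.subRight v0).subtypeEquiv key)
  have hcK : Nat.card K = p ^ Module.finrank (ZMod p) K := by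
    rw [Module.natCard_eq_pow_finrank (K := ZMod p), Nat.card_zmod]
  have hle : Module.finrank (ZMod p) K ≤ d := by
    simpa using Submodule.finrank_le K
  have hlt : Module.finrank (ZMod p) K < d := by
    refine lt_of_le_of_ne hle fun e => ?_
    have htop : K = ⊤ := Submodule.eq_top_of_finrank_eq (by simpa using e)
    have : x = 1 := by
      ext1 v
      rw [Equiv.Perm.one_apply, key, htop]
      trivial
    rw [this, orderOf_one] at hord
    exact hr.one_lt.ne hord
  have hmod : p ^ d ≡ Nat.card {v : Fin d → ZMod p // x v = v} [MOD r] := by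
    have : Fact r.Prime := ⟨hr⟩
    have hpow : x ^ r ^ 1 = 1 := by rw [pow_one, ← hord, pow_orderOf_eq_one]
    have hpow2 : (MulAction.toEndHom (α := Fin d → ZMod p) x) ^ r ^ 1 = 1 := by
      rw [← map_pow, hpow, map_one]
    have := Equiv.Perm.card_fixedPoints_modEq (p := r) (n := 1) hpow2
    simp only [Fintype.card_eq_nat_card] at this
    have e : Nat.card (Fin d → ZMod p) = p ^ d := by simp
    rw [e] at this
    exact this
  rw [hcard, hcK] at hmod ⊢
  generalize Module.finrank (ZMod p) K = k at *
  obtain ⟨m, rfl⟩ := Nat.exists_eq_add_of_lt hlt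
  by_cases hm : r = p ∧ m = 0
  · right
    obtain ⟨rfl, rfl⟩ := hm
    simp
  left
  suffices hs : r + 1 ≤ p ^ (m + 1) by
    calc (r + 1) * p ^ k ≤ p ^ (m + 1) * p ^ k := Nat.mul_le_mul_right _ hs
      _ = p ^ (k + m + 1) := by ring
  by_cases hrp : r = p
  · subst hrp
    have hm0 : 1 ≤ m := by
      rcases Nat.eq_zero_or_pos m with h0 | h0
      · exact absurd ⟨rfl, h0⟩ hm
      · exact h0
    calc r + 1 ≤ r ^ 2 := by nlinarith [hr.two_le]
      _ ≤ r ^ (m + 1) := Nat.pow_le_pow_right hr.pos (by omega)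
  · have hcop : Nat.gcd r (p ^ k) = 1 :=
      Nat.Coprime.pow_right _ ((Nat.coprime_primes hr hp).2 hrp)
    have h1 : p ^ k * p ^ (m + 1) ≡ p ^ k * 1 [MOD r] := by
      rw [← pow_add, mul_one]
      exact hmod
    have h2 := (Nat.ModEq.cancel_left_of_coprime hcop h1).symm
    have h3 : 1 < p ^ (m + 1) := Nat.one_lt_pow (by omega) hp.one_lt
    have h4 := Nat.le_of_dvd (by omega) ((Nat.modEq_iff_dvd' h3.le).1 h2)
    omega
end

section
/- Let T be a finite nonabelian simple group and let α be an automorphism of T of prime order r. Then (r+1) · |{t ∈ T : α(t) = t}| ≤ |T|. -/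
/-- (Lemma 2.2(iii) of the paper.) Let `T` be a finite nonabelian simple
group and `α` an automorphism of `T` of prime order `r`. Then
`(r+1) · |{t ∈ T : α t = t}| ≤ |T|`. -/
theorem stmt_1 (T : Type*) [Group T] [Finite T] [IsSimpleGroup T]
    (hnab : ∃ a b : T, a * b ≠ b * a)
    (α : MulAut T) (r : ℕ) (hr : r.Prime) (hord : orderOf α = r) :
    (r + 1) * Nat.card {t : T // α t = t} ≤ Nat.card T := by
  have hα1 : α ≠ 1 := by
    rintro rfl
    rw [orderOf_one] at hord
    exact hr.one_lt.ne hord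
  have hs : ∃ s, α s ≠ s := by
    by_contra! h
    exact hα1 (MulEquiv.ext h)
  let C : Subgroup T :=
    { carrier := {t | α t = t}
      mul_mem' := by
        intro a b ha hb
        simp only [Set.mem_setOf_eq] at *
        rw [map_mul, ha, hb]
      one_mem' := by simp
      inv_mem' := by
        intro a ha
        simp only [Set.mem_setOf_eq] at *
        rw [map_inv, ha] }
  have hC : ∀ t, t ∈ C ↔ α t = t := fun t => Iff.rfl
  have ht : ∃ t, t⁻¹ * α t ∉ C := by
    by_contra! h
    obtain ⟨s, hs⟩ := hs
    have hcore : s⁻¹ * α s ∈ C.normalCore := by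
      intro t
      have h1 := C.mul_mem (h (s * t⁻¹)) (C.inv_mem (h t⁻¹))
      have h2 : (s * t⁻¹)⁻¹ * α (s * t⁻¹) * (t⁻¹⁻¹ * α t⁻¹)⁻¹ = t * (s⁻¹ * α s) * t⁻¹ := by
        rw [map_mul]; group
      rwa [h2] at h1
    rcases (Subgroup.normalCore_normal C).eq_bot_or_eq_top with h0 | h0
    · rw [h0, Subgroup.mem_bot, inv_mul_eq_one] at hcore
      exact hs hcore.symm
    · have : s ∈ C.normalCore := by rw [h0]; trivial
      exact hs (C.normalCore_le this)
  obtain ⟨t, ht⟩ := ht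
  let f : T ⧸ C → T ⧸ C := Quotient.map' α (by
    intro a b hab
    rw [QuotientGroup.leftRel_apply] at *
    rw [← map_inv, ← map_mul, (hC _).1 hab]
    exact hab)
  have hf : ∀ (i : ℕ) (a : T), f^[i] (a : T ⧸ C) = ((α ^ i) a : T) := by
    intro i
    induction i with
    | zero => intro a; rfl
    | succ n ih =>
      intro a
      rw [Function.iterate_succ_apply, pow_succ]
      exact ih (α a)
  haveI : Fact r.Prime := ⟨hr⟩
  have hmin : Function.minimalPeriod f (t : T ⧸ C) = r := by
    apply Function.minimalPeriod_eq_prime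
    · change f^[r] _ = _
      rw [hf, ← hord, pow_orderOf_eq_one]; rfl
    · intro h
      exact ht (QuotientGroup.eq.1 (Eq.symm h))
  have hinj := Function.iterate_injOn_Iio_minimalPeriod (f := f) (x := (t : T ⧸ C))
  rw [hmin] at hinj
  let g : Option (Fin r) → T ⧸ C := fun o => o.elim ((1 : T) : T ⧸ C) (fun i => f^[i] (t : T ⧸ C))
  have hne : ∀ i : ℕ, ((1 : T) : T ⧸ C) ≠ f^[i] (t : T ⧸ C) := by
    intro i h
    rw [hf, QuotientGroup.eq, inv_one, one_mul, hC] at h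
    have h2 : (α ^ i) (α t) = (α ^ i) t := by
      rw [← MulAut.mul_apply, ← pow_succ, pow_succ', MulAut.mul_apply, h]
    apply ht
    rw [(α ^ i).injective h2, inv_mul_cancel]
    exact C.one_mem
  have hg : Function.Injective g := by
    rintro (_ | i) (_ | j) h
    · rfl
    · exact (hne _ h).elim
    · exact (hne _ h.symm).elim
    · exact congrArg some (Fin.ext (hinj i.2 j.2 h))
  have hcard := Nat.card_le_card_of_injective g hg
  rw [Nat.card_eq_fintype_card, Fintype.card_option, Fintype.card_fin] at hcard
  rw [Subgroup.card_eq_card_quotient_mul_card_subgroup C]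
  exact Nat.mul_le_mul_right _ hcard
end

section
/- Let n ≥ 5, let ℓ be an integer with 1 ≤ ℓ and 2ℓ < n, let r be a prime, let x be a permutation of {0,…,n−1} of order r, and let y be an r-cycle in Sym(n). Then the number of ℓ-element subsets S of {0,…,n−1} with x(S) = S is at most the number of ℓ-element subsets S with y(S) = S. -/
/-- For the action of `Sym(n)` on `ℓ`-element subsets of `{0, …, n-1}`
(with `n ≥ 5`, `1 ≤ ℓ`, `2ℓ < n`), an element `x` of prime order `r` fixes at most as many
`ℓ`-element subsets as an `r`-cycle `y` does. -/
theorem stmt_2 (n ℓ r : ℕ) (hn : 5 ≤ n) (hl : 1 ≤ ℓ) (hln : 2 * ℓ < n)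
    (hr : r.Prime) (x y : Equiv.Perm (Fin n)) (hx : orderOf x = r)
    (hy : y.IsCycle ∧ y.support.card = r) :
    Nat.card {S : Finset (Fin n) // S.card = ℓ ∧ S.image x = S} ≤
      Nat.card {S : Finset (Fin n) // S.card = ℓ ∧ S.image y = S} := by
  have hx1 : x ≠ 1 := by
    rintro rfl
    rw [orderOf_one] at hx
    exact hr.ne_one hx.symm
  obtain ⟨a, ha⟩ : ∃ a, x a ≠ a := by
    by_contra! h
    exact hx1 (Equiv.ext h)
  have hc : (x.cycleOf a).IsCycle := x.isCycle_cycleOf ha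
  have hord : orderOf (x.cycleOf a) = r := by
    have hd := x.orderOf_cycleOf_dvd_orderOf a
    rw [hx] at hd
    rcases (Nat.dvd_prime hr).1 hd with h | h
    · exact absurd (orderOf_eq_one_iff.1 h) hc.ne_one
    · exact h
  have hconj : IsConj (x.cycleOf a) y := by
    rw [hc.isConj_iff hy.1, hy.2, ← hc.orderOf, hord]
  obtain ⟨g, hg⟩ := isConj_iff.1 hconj
  have key : ∀ S : Finset (Fin n), S.image x = S → S.image (x.cycleOf a) = S := by
    intro S hS
    apply Finset.eq_of_subset_of_card_le
    · intro b hb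
      obtain ⟨s, hs, rfl⟩ := Finset.mem_image.1 hb
      rw [Equiv.Perm.cycleOf_apply]
      split_ifs
      · rw [← hS]; exact Finset.mem_image_of_mem _ hs
      · exact hs
    · rw [Finset.card_image_of_injective _ (Equiv.injective _)]
  refine Nat.card_le_card_of_injective
    (fun S => ⟨S.1.image g, ?_, ?_⟩) ?_
  · rw [Finset.card_image_of_injective _ (Equiv.injective _)]; exact S.2.1
  · conv_rhs => rw [← key S.1 S.2.2]
    rw [← hg, Finset.image_image, Finset.image_image]
    congr 1
    ext b
    simp
  · intro S T h
    have h' : S.1.image g = T.1.image g := congrArg Subtype.val h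
    exact Subtype.ext (Finset.image_injective g.injective h')
end

section
/- Let n ≥ 5, let ℓ be an integer with 1 ≤ ℓ and 2ℓ < n, let r ≤ n be a prime, and let y be an r-cycle in Sym(n). Then the number of ℓ-element subsets S of {0,…,n−1} with y(S) = S equals C(n−r, ℓ) + C(n−r, ℓ−r) if r ≤ ℓ, and equals C(n−r, ℓ) if r > ℓ. In particular this number is 0 when r > n − ℓ. -/
theorem inv_iff {n : ℕ} (y : Equiv.Perm (Fin n)) (hy : y.IsCycle) (S : Finset (Fin n)) :
    S.image y = S ↔ (S ⊆ y.supportᶜ ∨ y.support ⊆ S) := by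
  constructor
  · intro h
    by_cases hd : S ⊆ y.supportᶜ
    · exact Or.inl hd
    · right
      rw [Finset.not_subset] at hd
      obtain ⟨a, haS, ha⟩ := hd
      have ha' : y a ≠ a := by simpa using ha
      intro b hb
      obtain ⟨i, rfl⟩ := hy.exists_pow_eq ha' (Equiv.Perm.mem_support.1 hb)
      clear hb
      induction i with
      | zero => simpa using haS
      | succ k ih =>
        rw [pow_succ', Equiv.Perm.mul_apply, ← h]
        exact Finset.mem_image_of_mem _ ih
  · intro h
    apply Finset.eq_of_subset_of_card_le
    · intro b hb
      obtain ⟨a, ha, rfl⟩ := Finset.mem_image.1 hb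
      by_cases hya : y a = a
      · rwa [hya]
      · rcases h with h | h
        · have := h ha
          simp at this
          exact absurd this hya
        · apply h
          simpa using hya
    · rw [Finset.card_image_of_injective _ y.injective]

theorem count_aux {n : ℕ} (ℓ : ℕ) (y : Equiv.Perm (Fin n)) (hy : y.IsCycle) :
    Nat.card {S : Finset (Fin n) // S.card = ℓ ∧ S.image y = S} =
      (n - y.support.card).choose ℓ +
        (if y.support.card ≤ ℓ then (n - y.support.card).choose (ℓ - y.support.card) else 0) := by
  classical
  have hc : (y.supportᶜ).card = n - y.support.card := by
    rw [Finset.card_compl, Fintype.card_fin]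
  rw [Nat.card_eq_fintype_card, Fintype.card_subtype]
  have hne : y.support.Nonempty := by
    obtain ⟨x, hx, -⟩ := hy
    exact ⟨x, Equiv.Perm.mem_support.2 hx⟩
  have h1 : (Finset.univ.filter fun S : Finset (Fin n) => S.card = ℓ ∧ S.image y = S) =
      Finset.powersetCard ℓ y.supportᶜ ∪
        Finset.univ.filter (fun S : Finset (Fin n) => S.card = ℓ ∧ y.support ⊆ S) := by
    ext S
    simp only [Finset.mem_filter, Finset.mem_univ, true_and, Finset.mem_union,
      Finset.mem_powersetCard, inv_iff y hy]
    tauto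
  rw [h1, Finset.card_union_of_disjoint, Finset.card_powersetCard, hc]
  · congr 1
    split_ifs with hle
    · rw [← hc, ← Finset.card_powersetCard]
      symm
      apply Finset.card_bij' (fun T _ => T ∪ y.support) (fun S _ => S \ y.support)
      · intro T hT
        rw [Finset.mem_powersetCard] at hT
        have hd : Disjoint T y.support := by
          rw [← Finset.subset_compl_iff_disjoint_right]; exact hT.1
        simp only [Finset.mem_filter, Finset.mem_univ, true_and]
        rw [Finset.card_union_of_disjoint hd]
        exact ⟨by omega, Finset.subset_union_right⟩
      · intro S hS
        simp only [Finset.mem_filter, Finset.mem_univ, true_and] at hS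
        rw [Finset.mem_powersetCard, Finset.card_sdiff_of_subset hS.2, hS.1]
        refine ⟨fun x hx => ?_, rfl⟩
        exact Finset.mem_compl.2 (Finset.mem_sdiff.1 hx).2
      · intro T hT
        rw [Finset.mem_powersetCard] at hT
        have hd : Disjoint T y.support := by
          rw [← Finset.subset_compl_iff_disjoint_right]; exact hT.1
        exact Finset.union_sdiff_cancel_right hd
      · intro S hS
        simp only [Finset.mem_filter, Finset.mem_univ, true_and] at hS
        exact Finset.sdiff_union_of_subset hS.2
    · rw [Finset.card_eq_zero, Finset.filter_eq_empty_iff]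
      rintro S - ⟨h, h'⟩
      have := Finset.card_le_card h'
      omega
  · rw [Finset.disjoint_left]
    intro S hS hS'
    rw [Finset.mem_powersetCard] at hS
    simp only [Finset.mem_filter, Finset.mem_univ, true_and] at hS'
    obtain ⟨x, hx⟩ := hne
    exact Finset.mem_compl.1 (hS.1 (hS'.2 hx)) hx


/-- (Proposition 3.3(ii) of the paper.) For `n ≥ 5`, `1 ≤ ℓ`, `2ℓ < n`,
and a prime `r ≤ n`, an `r`-cycle `y ∈ Sym(n)` fixes exactly `C(n-r, ℓ) + C(n-r, ℓ-r)`
of the `ℓ`-element subsets of `{0, …, n-1}` if `r ≤ ℓ`, and exactly `C(n-r, ℓ)` of them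
if `r > ℓ`. In particular this number is `0` when `r > n - ℓ`. -/
theorem stmt_3 (n ℓ r : ℕ) (hn : 5 ≤ n) (hl : 1 ≤ ℓ) (hln : 2 * ℓ < n)
    (hr : r.Prime) (hrn : r ≤ n) (y : Equiv.Perm (Fin n))
    (hy : y.IsCycle ∧ y.support.card = r) :
    (r ≤ ℓ → Nat.card {S : Finset (Fin n) // S.card = ℓ ∧ S.image y = S} =
        (n - r).choose ℓ + (n - r).choose (ℓ - r)) ∧
    (ℓ < r → Nat.card {S : Finset (Fin n) // S.card = ℓ ∧ S.image y = S} =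
        (n - r).choose ℓ) ∧
    (n - ℓ < r → Nat.card {S : Finset (Fin n) // S.card = ℓ ∧ S.image y = S} = 0) := by
  obtain ⟨hy, hs⟩ := hy
  rw [count_aux ℓ y hy, hs]
  refine ⟨fun h => by rw [if_pos h], fun h => by rw [if_neg (by omega), add_zero], fun h => ?_⟩
  rw [if_neg (by omega), add_zero]
  exact Nat.choose_eq_zero_of_lt (by omega)
end

section
/- Let n ≥ 5, let ℓ be an integer with 1 ≤ ℓ and 2ℓ < n, and let r be a prime with r ≤ n − ℓ. Let y be an r-cycle in Sym(n) and let F be the number of ℓ-element subsets S of {0,…,n−1} with y(S) = S. Then, as rational numbers, F / C(n,ℓ) ≤ 1 − r/n, with equality if and only if ℓ = 1. -/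
theorem aux_up (m k : ℕ) (hk : 1 ≤ k) : 2 * m.choose (k+1) ≤ (m-1) * m.choose k := by
  have h := Nat.choose_succ_right_eq m k
  have h1 : m - k ≤ m - 1 := by omega
  calc 2 * m.choose (k+1) ≤ m.choose (k+1) * (k+1) := by
        rw [mul_comm]; exact Nat.mul_le_mul_left _ (by omega)
    _ = m.choose k * (m-k) := h
    _ ≤ m.choose k * (m-1) := Nat.mul_le_mul_left _ h1
    _ = _ := mul_comm _ _

theorem aux_down (m k : ℕ) (hk : k + 2 ≤ m) : 2 * m.choose k ≤ (m-1) * m.choose (k+1) := by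
  have h := Nat.choose_succ_right_eq m k
  calc 2 * m.choose k ≤ m.choose k * (m-k) := by
        rw [mul_comm]; exact Nat.mul_le_mul_left _ (by omega)
    _ = m.choose (k+1) * (k+1) := h.symm
    _ ≤ m.choose (k+1) * (m-1) := Nat.mul_le_mul_left _ (by omega)
    _ = _ := mul_comm _ _

theorem aux_num (m l r : ℕ) (hl : 2 ≤ l) (hlm : l ≤ m) (hr : 2 ≤ r) :
    (m + r) * (m.choose l + if r ≤ l then m.choose (l - r) else 0) < m * (m+r).choose l := by
  obtain ⟨k, rfl⟩ : ∃ k, l = k + 1 := ⟨l-1, by omega⟩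
  obtain ⟨q, rfl⟩ : ∃ q, m = q + 1 := ⟨m-1, by omega⟩
  have hup := aux_up (q+1) k (by omega)
  have hpos : 0 < (q+1).choose k := Nat.choose_pos (by omega)
  have hv := Nat.add_choose_eq (q+1) r (k+1)
  simp only [Nat.add_sub_cancel] at hup
  split_ifs with h
  · obtain ⟨j, hj⟩ : ∃ j, k + 1 = j + r := ⟨k+1-r, by omega⟩
    have hjr : k + 1 - r = j := by omega
    rw [hjr]
    have hdown := aux_down (q+1) j (by omega)
    have hpos2 : 0 < (q+1).choose (j+1) := Nat.choose_pos (by omega)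
    simp only [Nat.add_sub_cancel] at hdown
    rcases Nat.lt_or_ge 2 r with h3 | h3
    · have hs : ∑ ij ∈ ({(k+1,0),(k,1),(j+1,r-1),(j,r)} : Finset (ℕ × ℕ)), (q+1).choose ij.1 * r.choose ij.2 ≤ (q+1+r).choose (k+1) := by
        rw [hv]
        apply Finset.sum_le_sum_of_subset
        intro x hx
        simp only [Finset.mem_insert, Finset.mem_singleton] at hx
        rw [Finset.HasAntidiagonal.mem_antidiagonal]
        rcases hx with rfl | rfl | rfl | rfl <;> simp <;> omega
      rw [Finset.sum_insert (by simp; omega), Finset.sum_insert (by simp; omega),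
        Finset.sum_insert (by simp), Finset.sum_singleton] at hs
      have e : r.choose (r-1) = r := by
        rw [← Nat.choose_symm (by omega : r - 1 ≤ r)]
        have : r - (r-1) = 1 := by omega
        rw [this, Nat.choose_one_right]
      simp only [Nat.choose_zero_right, Nat.choose_one_right, Nat.choose_self, e] at hs
      have a1 : (q+1).choose (k+1) < (q+1) * (q+1).choose k := by nlinarith
      have a2 : (q+1).choose j ≤ (q+1) * (q+1).choose (j+1) := by nlinarith
      have hs' := Nat.mul_le_mul_left (q+1) hs
      have a3 := Nat.mul_lt_mul_of_pos_left (Nat.add_lt_add_of_lt_of_le a1 a2) (by omega : 0 < r)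
      nlinarith
    · obtain rfl : r = 2 := by omega
      obtain rfl : k = j + 1 := by omega
      have hs : ∑ ij ∈ ({(j+2,0),(j+1,1),(j,2)} : Finset (ℕ × ℕ)), (q+1).choose ij.1 * (2).choose ij.2 ≤ (q+1+2).choose (j+1+1) := by
        rw [hv]
        apply Finset.sum_le_sum_of_subset
        intro x hx
        simp only [Finset.mem_insert, Finset.mem_singleton] at hx
        rw [Finset.HasAntidiagonal.mem_antidiagonal]
        rcases hx with rfl | rfl | rfl <;> simp
      rw [Finset.sum_insert (by simp), Finset.sum_insert (by simp), Finset.sum_singleton] at hs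
      simp only [Nat.choose_zero_right, Nat.choose_one_right, Nat.choose_self] at hs
      have hs' := Nat.mul_le_mul_left (q+1) hs
      simp only [add_assoc, Nat.reduceAdd] at *
      nlinarith
  · have hs : ∑ ij ∈ ({(k+1,0),(k,1)} : Finset (ℕ × ℕ)), (q+1).choose ij.1 * r.choose ij.2 ≤ (q+1+r).choose (k+1) := by
      rw [hv]
      apply Finset.sum_le_sum_of_subset
      intro x hx
      simp only [Finset.mem_insert, Finset.mem_singleton] at hx
      rw [Finset.HasAntidiagonal.mem_antidiagonal]
      rcases hx with rfl | rfl <;> simp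
    rw [Finset.sum_insert (by simp), Finset.sum_singleton] at hs
    simp only [Nat.choose_zero_right, Nat.choose_one_right] at hs
    have a1 : (q+1).choose (k+1) < (q+1) * (q+1).choose k := by nlinarith
    have hs' := Nat.mul_le_mul_left (q+1) hs
    have a3 := Nat.mul_lt_mul_of_pos_left a1 (by omega : 0 < r)
    nlinarith

theorem aux_dich {n : ℕ} (y : Equiv.Perm (Fin n)) (hy : y.IsCycle) (S : Finset (Fin n))
    (hS : S.image y = S) : S ⊆ y.supportᶜ ∨ y.support ⊆ S := by
  by_cases h : S ⊆ y.supportᶜ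
  · exact Or.inl h
  right
  obtain ⟨a, haS, ha⟩ := Finset.not_subset.1 h
  simp only [Finset.mem_compl, not_not, Equiv.Perm.mem_support] at ha
  intro b hb
  obtain ⟨i, rfl⟩ := hy.exists_pow_eq ha (Equiv.Perm.mem_support.1 hb)
  clear hb
  induction i with
  | zero => simpa using haS
  | succ i ih =>
    rw [pow_succ', Equiv.Perm.mul_apply, ← hS]
    exact Finset.mem_image_of_mem _ ih

theorem aux_fix {n : ℕ} (y : Equiv.Perm (Fin n)) (S : Finset (Fin n))
    (hS : S ⊆ y.supportᶜ) : S.image y = S := by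
  have : S.image y = S.image id := Finset.image_congr (fun x hx => by
    have := hS hx
    simpa using this)
  simpa using this

theorem aux_le {n : ℕ} (y : Equiv.Perm (Fin n)) (hy : y.IsCycle) (l : ℕ) :
    Nat.card {S : Finset (Fin n) // S.card = l ∧ S.image y = S} ≤
      (n - y.support.card).choose l +
      if y.support.card ≤ l then (n - y.support.card).choose (l - y.support.card) else 0 := by
  rw [Nat.card_eq_fintype_card, Fintype.card_subtype]
  have hc : (y.supportᶜ).card = n - y.support.card := by
    rw [Finset.card_compl, Fintype.card_fin]
  have hsub : (Finset.univ.filter fun S : Finset (Fin n) => S.card = l ∧ S.image y = S) ⊆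
      Finset.powersetCard l y.supportᶜ ∪
      (if y.support.card ≤ l then
        (Finset.powersetCard (l - y.support.card) y.supportᶜ).image (fun T => T ∪ y.support)
       else ∅) := by
    intro S hS
    simp only [Finset.mem_filter, Finset.mem_univ, true_and] at hS
    rw [Finset.mem_union]
    rcases aux_dich y hy S hS.2 with h | h
    · exact Or.inl (Finset.mem_powersetCard.2 ⟨h, hS.1⟩)
    · right
      rw [if_pos (hS.1 ▸ Finset.card_le_card h)]
      refine Finset.mem_image.2 ⟨S \ y.support, Finset.mem_powersetCard.2 ⟨?_, ?_⟩, ?_⟩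
      · intro x hx
        exact Finset.mem_compl.2 (Finset.mem_sdiff.1 hx).2
      · rw [Finset.card_sdiff_of_subset h, hS.1]
      · exact Finset.sdiff_union_of_subset h
  refine (Finset.card_le_card hsub).trans ((Finset.card_union_le _ _).trans ?_)
  rw [Finset.card_powersetCard, hc]
  refine Nat.add_le_add_left ?_ _
  split_ifs
  · refine Finset.card_image_le.trans ?_
    rw [Finset.card_powersetCard, hc]
  · simp

theorem aux_ge {n : ℕ} (y : Equiv.Perm (Fin n)) (l : ℕ) :
    (n - y.support.card).choose l ≤
    Nat.card {S : Finset (Fin n) // S.card = l ∧ S.image y = S} := by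
  rw [Nat.card_eq_fintype_card, Fintype.card_subtype]
  have hc : (y.supportᶜ).card = n - y.support.card := by
    rw [Finset.card_compl, Fintype.card_fin]
  rw [← hc, ← Finset.card_powersetCard]
  apply Finset.card_le_card
  intro S hS
  rw [Finset.mem_powersetCard] at hS
  simp only [Finset.mem_filter, Finset.mem_univ, true_and]
  exact ⟨hS.2, aux_fix y S hS.1⟩


/-- (Remark 3.4 of the paper.) For `n ≥ 5`, `1 ≤ ℓ`, `2ℓ < n` and a prime
`r ≤ n - ℓ`, the fixed point ratio of an `r`-cycle `y ∈ Sym(n)` on `ℓ`-element subsets is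
at most `1 - r/n`, with equality if and only if `ℓ = 1`. -/
theorem stmt_4 (n ℓ r : ℕ) (hn : 5 ≤ n) (hl : 1 ≤ ℓ) (hln : 2 * ℓ < n)
    (hr : r.Prime) (hrn : r ≤ n - ℓ) (y : Equiv.Perm (Fin n))
    (hy : y.IsCycle ∧ y.support.card = r) :
    (Nat.card {S : Finset (Fin n) // S.card = ℓ ∧ S.image y = S} : ℚ) / (n.choose ℓ : ℚ) ≤
        1 - (r : ℚ) / (n : ℚ) ∧
      ((Nat.card {S : Finset (Fin n) // S.card = ℓ ∧ S.image y = S} : ℚ) / (n.choose ℓ : ℚ) =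
          1 - (r : ℚ) / (n : ℚ) ↔ ℓ = 1) := by
  obtain ⟨hy, hc⟩ := hy
  have hle := aux_le y hy ℓ
  have hge := aux_ge y ℓ
  rw [hc] at hle hge
  have h2 := hr.two_le
  generalize Nat.card {S : Finset (Fin n) // S.card = ℓ ∧ S.image y = S} = F at *
  obtain ⟨m, rfl⟩ : ∃ m, n = m + r := ⟨n - r, by omega⟩
  rw [Nat.add_sub_cancel] at hle hge
  have hnQ : (0:ℚ) < ((m + r : ℕ) : ℚ) := by exact_mod_cast (by omega : 0 < m + r)
  have hcQ : (0:ℚ) < ((m + r).choose ℓ : ℚ) := by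
    exact_mod_cast Nat.choose_pos (by omega)
  have e : 1 - (r:ℚ) / ((m + r : ℕ) : ℚ) = (m:ℚ) / ((m + r : ℕ) : ℚ) := by
    field_simp
    push_cast
    ring
  rw [e]
  rcases Nat.lt_or_ge 1 ℓ with h1 | h1
  · have hlt : (F:ℚ) / ((m + r).choose ℓ : ℚ) < (m:ℚ) / ((m + r : ℕ) : ℚ) := by
      rw [div_lt_div_iff₀ hcQ hnQ]
      have := aux_num m ℓ r h1 (by omega) h2
      have h3 : F * (m + r) < m * (m+r).choose ℓ := by
        rw [mul_comm F]
        exact lt_of_le_of_lt (Nat.mul_le_mul_left _ hle) this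
      exact_mod_cast h3
    exact ⟨hlt.le, fun h => absurd h hlt.ne, fun h => by omega⟩
  · obtain rfl : ℓ = 1 := by omega
    rw [if_neg (by omega)] at hle
    have hF : F = m := by simp at hle hge; omega
    subst hF
    simp
end

section
/- Let n ≥ 5 and let ℓ be an integer with 1 ≤ ℓ and 2ℓ < n, and let y be a transposition in Sym(n). Let F be the number of ℓ-element subsets S of {0,…,n−1} with y(S) = S. Then, as rational numbers, F / C(n,ℓ) ≥ 1/2 − 1/(2n), with equality if and only if n is odd and ℓ = (n−1)/2. In particular F / C(n,ℓ) > 1/3. -/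
theorem aux_count (n k : ℕ) (a b : Fin n) (hab : a ≠ b) :
    ((Finset.univ : Finset (Finset (Fin n))).filter
      (fun S => S.card = k + 1 ∧ a ∈ S ∧ b ∉ S)).card = (n - 2).choose k := by
  have h2 : ((Finset.univ : Finset (Fin n)) \ {a, b}).card = n - 2 := by
    rw [Finset.card_sdiff_of_subset (Finset.subset_univ _), Finset.card_pair hab]
    simp
  rw [← h2, ← Finset.card_powersetCard]
  refine Finset.card_nbij' (fun S => S.erase a) (fun T => insert a T) ?_ ?_ ?_ ?_
  · intro S hS
    simp only [Finset.coe_filter, Finset.mem_univ, true_and, Set.mem_setOf_eq] at hS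
    obtain ⟨h1, h3, h4⟩ := hS
    simp only [Finset.mem_coe, Finset.mem_powersetCard]
    refine ⟨?_, by rw [Finset.card_erase_of_mem h3]; omega⟩
    intro x hx
    simp only [Finset.mem_erase] at hx
    simp only [Finset.mem_sdiff, Finset.mem_univ, true_and, Finset.mem_insert,
      Finset.mem_singleton, not_or]
    exact ⟨hx.1, fun h => h4 (h ▸ hx.2)⟩
  · intro T hT
    simp only [Finset.mem_coe, Finset.mem_powersetCard] at hT
    obtain ⟨h1, h3⟩ := hT
    have ha : a ∉ T := fun h => by simpa using h1 h
    have hb : b ∉ T := fun h => by simpa using h1 h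
    simp [Finset.card_insert_of_notMem ha, h3, hb, hab.symm]
  · intro S hS
    simp only [Finset.coe_filter, Finset.mem_univ, true_and, Set.mem_setOf_eq] at hS
    exact Finset.insert_erase hS.2.1
  · intro T hT
    simp only [Finset.mem_coe, Finset.mem_powersetCard] at hT
    exact Finset.erase_insert (fun h => by simpa using hT.1 h)

theorem aux_fix_s5 (n : ℕ) (a b : Fin n) (S : Finset (Fin n)) :
    S.image (Equiv.swap a b) = S ↔ (a ∈ S ↔ b ∈ S) := by
  constructor
  · intro h
    constructor
    · intro ha
      rw [← h]
      exact Finset.mem_image.2 ⟨a, ha, Equiv.swap_apply_left a b⟩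
    · intro ha
      rw [← h]
      exact Finset.mem_image.2 ⟨b, ha, Equiv.swap_apply_right a b⟩
  · intro h
    apply Finset.eq_of_subset_of_card_le
    · intro x hx
      obtain ⟨z, hz, rfl⟩ := Finset.mem_image.1 hx
      rw [Equiv.swap_apply_def]
      split_ifs with h1 h2
      · subst h1; exact h.1 hz
      · subst h2; exact h.2 hz
      · exact hz
    · rw [Finset.card_image_of_injective _ (Equiv.injective _)]

theorem aux_total (n k : ℕ) (y : Equiv.Perm (Fin n)) (hy : y.IsSwap) :
    Nat.card {S : Finset (Fin n) // S.card = k + 1 ∧ S.image y = S} + 2 * (n - 2).choose k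
      = n.choose (k + 1) := by
  obtain ⟨a, b, hab, rfl⟩ := hy
  have h1 := aux_count n k a b hab
  have h2 := aux_count n k b a hab.symm
  have h3 : ((Finset.univ : Finset (Finset (Fin n))).filter
      (fun S => S.card = k + 1)).card = n.choose (k + 1) := by
    have := Finset.card_powersetCard (k + 1) (Finset.univ : Finset (Fin n))
    rw [Finset.card_univ, Fintype.card_fin] at this
    rw [← this]
    congr 1
    ext S
    simp [Finset.mem_powersetCard]
  rw [Nat.card_eq_fintype_card, Fintype.card_subtype]
  simp only [aux_fix_s5]
  rw [two_mul]
  nth_rewrite 1 [← h1]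
  rw [← h2, ← h3]
  simp only [Finset.card_filter, ← Finset.sum_add_distrib]
  refine Finset.sum_congr rfl fun S _ => ?_
  by_cases hc : S.card = k + 1 <;> by_cases ha : a ∈ S <;> by_cases hb : b ∈ S <;>
    simp [hc, ha, hb]

/-- (Remark 3.4 of the paper.) For `n ≥ 5`, `1 ≤ ℓ`, `2ℓ < n`, the fixed
point ratio of a transposition `y ∈ Sym(n)` on `ℓ`-element subsets is at least
`1/2 - 1/(2n)`, with equality if and only if `n` is odd and `ℓ = (n-1)/2` (i.e. `2ℓ+1 = n`).
In particular it is greater than `1/3`. -/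
theorem stmt_5 (n ℓ : ℕ) (hn : 5 ≤ n) (hl : 1 ≤ ℓ) (hln : 2 * ℓ < n)
    (y : Equiv.Perm (Fin n)) (hy : y.IsSwap) :
    (1 : ℚ) / 2 - 1 / (2 * (n : ℚ)) ≤
        (Nat.card {S : Finset (Fin n) // S.card = ℓ ∧ S.image y = S} : ℚ) / (n.choose ℓ : ℚ) ∧
      ((Nat.card {S : Finset (Fin n) // S.card = ℓ ∧ S.image y = S} : ℚ) / (n.choose ℓ : ℚ) =
          (1 : ℚ) / 2 - 1 / (2 * (n : ℚ)) ↔ 2 * ℓ + 1 = n) ∧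
      (1 : ℚ) / 3 <
        (Nat.card {S : Finset (Fin n) // S.card = ℓ ∧ S.image y = S} : ℚ) / (n.choose ℓ : ℚ) := by
  obtain ⟨k, rfl⟩ : ∃ k, ℓ = k + 1 := ⟨ℓ - 1, by omega⟩
  obtain ⟨m, rfl⟩ : ∃ m, n = m + 2 := ⟨n - 2, by omega⟩
  have ht := aux_total (m + 2) k y hy
  generalize Nat.card {S : Finset (Fin (m + 2)) // S.card = k + 1 ∧ S.image y = S} = F at *
  have e1 := Nat.add_one_mul_choose_eq (m + 1) k
  have e2 := Nat.choose_mul_succ_eq m k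
  have hpos : 0 < (m + 2).choose (k + 1) := Nat.choose_pos (by omega)
  obtain ⟨d, hd⟩ : ∃ d, m = 2 * k + 1 + d := ⟨m - (2 * k + 1), by omega⟩
  have e3 : m + 1 - k = k + 2 + d := by omega
  rw [e3] at e2
  simp only [Nat.add_sub_cancel] at ht
  generalize (m + 2).choose (k + 1) = N at *
  generalize m.choose k = A at *
  generalize (m + 1).choose k = B at *
  have hNq : (0 : ℚ) < N := by exact_mod_cast hpos
  have htq : (F : ℚ) + 2 * A = N := by exact_mod_cast ht
  have e1q : ((m : ℚ) + 1 + 1) * B = N * (k + 1) := by exact_mod_cast e1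
  have e2q : (A : ℚ) * (m + 1) = B * (k + 2 + d) := by exact_mod_cast e2
  have hmq : (m : ℚ) = 2 * k + 1 + d := by exact_mod_cast hd
  have hk : (0 : ℚ) ≤ k := Nat.cast_nonneg k
  have hdq : (0 : ℚ) ≤ d := Nat.cast_nonneg d
  have hm3 : (3 : ℚ) ≤ m := by exact_mod_cast (by omega : 3 ≤ m)
  have hA : (A : ℚ) * ((m + 1) * (m + 2)) = N * ((k + 1) * (k + 2 + d)) := by
    linear_combination (m + 2 : ℚ) * e2q + (k + 2 + d : ℚ) * e1q
  have key : (F : ℚ) / N = 1 / 2 - 1 / (2 * ((m + 2 : ℕ) : ℚ))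
      + d * (d + 2) / (2 * ((m + 1) * (m + 2))) := by
    have hAd : (A : ℚ) = N * ((k + 1) * (k + 2 + d)) / ((m + 1) * (m + 2)) := by
      rw [eq_div_iff (by positivity)]; exact hA
    have hF : (F : ℚ) = N - 2 * A := by linarith
    rw [hF, hAd]
    push_cast
    have h1 : (m : ℚ) + 1 ≠ 0 := by positivity
    have h2 : (m : ℚ) + 2 ≠ 0 := by positivity
    field_simp
    rw [hmq]
    ring
  rw [key]
  have hnn : (0 : ℚ) ≤ d * (d + 2) / (2 * ((m + 1) * (m + 2))) := by positivity
  refine ⟨by linarith, ?_, ?_⟩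
  · constructor
    · intro h
      have h0 : (d : ℚ) * (d + 2) / (2 * ((m + 1) * (m + 2))) = 0 := by linarith
      rw [div_eq_zero_iff] at h0
      rcases h0 with h0 | h0
      · rcases mul_eq_zero.1 h0 with h0 | h0
        · have : d = 0 := by exact_mod_cast h0
          omega
        · linarith
      · have : (0 : ℚ) < 2 * ((m + 1) * (m + 2)) := by positivity
        linarith
    · intro h
      have : d = 0 := by omega
      subst this
      simp
  · have : (1 : ℚ) / (2 * ((m + 2 : ℕ) : ℚ)) ≤ 1 / 10 := by
      push_cast
      apply one_div_le_one_div_of_le <;> linarith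
    linarith
end

section
/- Let n ≥ 14, let ℓ ≥ 2 be a divisor of n, and let r be a prime with ℓ < r ≤ n/ℓ (so r ≥ 3). Then (r+1) · ℓ · C(n/ℓ, r) ≤ C(n, r). -/
theorem aux_desc (l m : ℕ) (hl : 1 ≤ l) (r : ℕ) :
    l ^ r * m.descFactorial r ≤ (l * m).descFactorial r := by
  induction r with
  | zero => simp
  | succ k ih =>
    rw [Nat.descFactorial_succ, Nat.descFactorial_succ]
    have h : l * (m - k) ≤ l * m - k := by
      rw [Nat.mul_sub]
      have : k ≤ l * k := Nat.le_mul_of_pos_left k hl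
      omega
    calc l ^ (k + 1) * ((m - k) * m.descFactorial k)
        = (l * (m - k)) * (l ^ k * m.descFactorial k) := by ring
      _ ≤ _ := Nat.mul_le_mul h ih

theorem aux_choose (l m : ℕ) (hl : 1 ≤ l) (r : ℕ) :
    l ^ r * m.choose r ≤ (l * m).choose r := by
  have h := aux_desc l m hl r
  rw [Nat.descFactorial_eq_factorial_mul_choose, Nat.descFactorial_eq_factorial_mul_choose] at h
  refine Nat.le_of_mul_le_mul_left ?_ (Nat.factorial_pos r)
  calc _ = l ^ r * (r.factorial * m.choose r) := by ring
    _ ≤ _ := h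

theorem aux_pow (k : ℕ) : k + 4 ≤ 2 ^ (k + 2) := by
  induction k with
  | zero => norm_num
  | succ k ih => rw [pow_succ 2 (k + 2)] at *; omega


/-- (From Case 2 of the proof of Proposition 3.2 of the paper.) Let
`n ≥ 14`, let `ℓ ≥ 2` be a divisor of `n`, and let `r` be a prime with `ℓ < r ≤ n/ℓ`.
Then `(r+1) · ℓ · C(n/ℓ, r) ≤ C(n, r)`. -/
theorem stmt_7 (n ℓ r : ℕ) (hn : 14 ≤ n) (hl : 2 ≤ ℓ) (hdvd : ℓ ∣ n)
    (hr : r.Prime) (hlr : ℓ < r) (hrn : r ≤ n / ℓ) :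
    (r + 1) * ℓ * ((n / ℓ).choose r) ≤ n.choose r := by
  obtain ⟨m, rfl⟩ := hdvd
  rw [Nat.mul_div_cancel_left m (by omega)]
  refine le_trans (Nat.mul_le_mul_right _ ?_) (aux_choose ℓ m (by omega) r)
  obtain ⟨k, rfl⟩ : ∃ k, r = k + 3 := ⟨r - 3, by omega⟩
  rw [pow_succ]
  refine Nat.mul_le_mul_right _ ?_
  exact (aux_pow k).trans (Nat.pow_le_pow_left hl _)
end

section
/- Let Ω be a finite set with |Ω| ≥ 2 and let G be a primitive subgroup of Sym(Ω). Suppose x ∈ G is nontrivial and ind(x) ≤ ind(y) for every nontrivial y ∈ G. Then the order of x is a prime number. -/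
/-- The index `ind(x) = |Ω| - orb(x)` of a group element `x` acting on `Ω`, where `orb(x)`
is the number of orbits of the cyclic subgroup generated by `x` on `Ω`. -/
noncomputable def ind (Ω : Type*) {G : Type*} [Group G] [MulAction G Ω] (x : G) : ℕ :=
  Nat.card Ω - Nat.card (MulAction.orbitRel.Quotient (Subgroup.zpowers x) Ω)

/-- A permutation group `G ≤ Sym(Ω)` is primitive if it is transitive and every block of
the action is trivial (equivalently, `G` preserves no nontrivial partition of `Ω`). -/
def IsPrimitive (G Ω : Type*) [Group G] [MulAction G Ω] : Prop :=
  MulAction.IsPretransitive G Ω ∧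
    ∀ B : Set Ω, MulAction.IsBlock G B → B.Subsingleton ∨ B = Set.univ

/-- (Lemma 7.1 of the paper.) Let `Ω` be a finite set with `|Ω| ≥ 2` and
let `G` be a primitive subgroup of `Sym(Ω)`. If `x ∈ G` is nontrivial and minimizes the
index among nontrivial elements of `G`, then `x` has prime order. -/
theorem stmt_8 (Ω : Type*) [Finite Ω] (hΩ : 2 ≤ Nat.card Ω)
    (G : Subgroup (Equiv.Perm Ω)) (hprim : IsPrimitive G Ω)
    (x : Equiv.Perm Ω) (hxG : x ∈ G) (hx1 : x ≠ 1)
    (hmin : ∀ y : Equiv.Perm Ω, y ∈ G → y ≠ 1 → ind Ω x ≤ ind Ω y) :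
    (orderOf x).Prime := by
  have hn1 : orderOf x ≠ 1 := fun h => hx1 (orderOf_eq_one_iff.mp h)
  obtain ⟨p, hp, hpn⟩ := Nat.exists_prime_and_dvd hn1
  obtain ⟨m, hm⟩ := hpn
  have hnpos : 0 < orderOf x := orderOf_pos x
  have hmpos : 0 < m := by
    rcases Nat.eq_zero_or_pos m with h | h
    · rw [h] at hm; omega
    · exact h
  by_cases hxp : x ^ p = 1
  · haveI : Fact p.Prime := ⟨hp⟩
    rw [orderOf_eq_prime_iff.mpr ⟨hxp, hx1⟩]
    exact hp
  exfalso
  have hle := hmin (x ^ p) (G.pow_mem hxG p) hxp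
  -- a point moved out of its `x ^ p`-orbit
  have key : ∃ a : Ω, ∀ k : ℤ, ((x ^ p) ^ k) a ≠ x a := by
    by_contra hcon
    push Not at hcon
    have hm1 : x ^ m = 1 := by
      ext a
      obtain ⟨k, hk⟩ := hcon a
      have h1 : (x ^ ((p : ℤ) * k - 1)) a = a := by
        have : x ^ ((p : ℤ) * k - 1) = x⁻¹ * (x ^ p) ^ k := by
          rw [← zpow_natCast, ← zpow_mul, ← zpow_neg_one, ← zpow_add]
          congr 1; ring
        rw [this, Equiv.Perm.mul_apply, hk]; simp
      have h2 : ((x ^ ((p : ℤ) * k - 1)) ^ (-(m : ℤ))) a = a :=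
        Equiv.Perm.zpow_apply_eq_self_of_apply_eq_self h1 _
      have h3 : (x ^ ((p : ℤ) * k - 1)) ^ (-(m : ℤ)) = x ^ m := by
        rw [← zpow_mul]
        have : ((p : ℤ) * k - 1) * (-(m : ℤ)) = ((orderOf x : ℕ) : ℤ) * (-k) + (m : ℤ) := by
          rw [hm]; push_cast; ring
        rw [this, zpow_add, zpow_mul, zpow_natCast, pow_orderOf_eq_one, one_zpow, one_mul,
          zpow_natCast]
      rw [h3] at h2
      simpa using h2
    have := orderOf_le_of_pow_eq_one hmpos hm1
    have := hp.two_le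
    nlinarith
  obtain ⟨a, ha⟩ := key
  let Q := MulAction.orbitRel.Quotient (Subgroup.zpowers x) Ω
  let Q' := MulAction.orbitRel.Quotient (Subgroup.zpowers (x ^ p)) Ω
  let f : Q' → Q := Quotient.map' id (by
    rintro b c ⟨⟨g, k, rfl⟩, hg⟩
    refine ⟨⟨(x ^ p) ^ k, Subgroup.zpow_mem _ (Subgroup.pow_mem _ (Subgroup.mem_zpowers x) _) _⟩,
      ?_⟩
    exact hg)
  have hfs : Function.Surjective f := by
    intro q
    induction q using Quotient.inductionOn' with
    | h b => exact ⟨Quotient.mk'' b, rfl⟩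
  have hfi : ¬ Function.Injective f := by
    intro hinj
    have h1 : f (Quotient.mk'' (x a)) = f (Quotient.mk'' a) := by
      apply Quotient.sound'
      exact ⟨⟨x, Subgroup.mem_zpowers x⟩, rfl⟩
    obtain ⟨⟨g, k, rfl⟩, hg⟩ := Quotient.exact' (hinj h1)
    exact ha k hg
  have hle1 : Nat.card Q ≤ Nat.card Q' := Nat.card_le_card_of_surjective f hfs
  have hne : Nat.card Q ≠ Nat.card Q' := fun h =>
    hfi ((Nat.bijective_iff_surjective_and_card f).mpr ⟨hfs, h.symm⟩).1
  have hle2 : Nat.card Q' ≤ Nat.card Ω :=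
    Nat.card_le_card_of_surjective (Quotient.mk'' : Ω → Q') Quotient.mk''_surjective
  change Nat.card Ω - Nat.card Q ≤ Nat.card Ω - Nat.card Q' at hle
  omega
end

section
/- Let n ≥ 5 and let ℓ be an integer with 1 ≤ ℓ and 2ℓ < n, and let Ω be the set of ℓ-element subsets of {0,…,n−1} with the natural action of G = Sym(n). Then Ind(G) = C(n−2, ℓ−1); moreover, for a nontrivial x ∈ Sym(n), ind(x) = C(n−2, ℓ−1) if and only if x is a transposition. -/
/-- The natural action of `Sym(n)` on the set of `ℓ`-element subsets of `{0, …, n-1}`. -/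
instance permSubsetsSMul (n ℓ : ℕ) :
    SMul (Equiv.Perm (Fin n)) {S : Finset (Fin n) // S.card = ℓ} :=
  ⟨fun x S => ⟨S.1.image x, by rw [Finset.card_image_of_injective _ x.injective]; exact S.2⟩⟩

instance permSubsetsMulAction (n ℓ : ℕ) :
    MulAction (Equiv.Perm (Fin n)) {S : Finset (Fin n) // S.card = ℓ} where
  one_smul S := by
    apply Subtype.ext
    show S.1.image ⇑(1 : Equiv.Perm (Fin n)) = S.1
    simp
  mul_smul x y S := by
    apply Subtype.ext
    show S.1.image ⇑(x * y) = (S.1.image ⇑y).image ⇑x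
    simp [Finset.image_image, Function.comp_def]

lemma aux_B (n ℓ : ℕ) (hl : 1 ≤ ℓ) (a b : Fin n) (hab : a ≠ b) :
    (Finset.univ.filter (fun S : {S : Finset (Fin n) // S.card = ℓ} =>
      a ∈ S.1 ∧ b ∉ S.1)).card = (n - 2).choose (ℓ - 1) := by
  classical
  have hc : ((Finset.univ : Finset (Fin n)) \ {a, b}).card = n - 2 := by
    rw [Finset.card_sdiff_of_subset (Finset.subset_univ _), Finset.card_pair hab]; simp
  rw [← hc, ← Finset.card_powersetCard]
  refine Finset.card_bij (fun S _ => S.1.erase a) ?_ ?_ ?_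
  · intro S hS
    simp only [Finset.mem_filter, Finset.mem_univ, true_and] at hS
    rw [Finset.mem_powersetCard]
    refine ⟨?_, by rw [Finset.card_erase_of_mem hS.1, S.2]⟩
    intro y hy
    simp only [Finset.mem_erase] at hy
    simp only [Finset.mem_sdiff, Finset.mem_univ, true_and, Finset.mem_insert,
      Finset.mem_singleton, not_or]
    refine ⟨hy.1, ?_⟩
    rintro rfl
    exact hS.2 hy.2
  · intro S hS T hT h
    simp only [Finset.mem_filter, Finset.mem_univ, true_and] at hS hT
    apply Subtype.ext
    rw [← Finset.insert_erase hS.1, ← Finset.insert_erase hT.1]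
    rw [h]
  · intro T hT
    rw [Finset.mem_powersetCard] at hT
    have ha : a ∉ T := fun h => by simpa using hT.1 h
    have hb : b ∉ T := fun h => by simpa using hT.1 h
    refine ⟨⟨insert a T, ?_⟩, ?_, ?_⟩
    · rw [Finset.card_insert_of_notMem ha, hT.2]; omega
    · simp [hb, hab.symm]
    · simp [Finset.erase_insert ha]

lemma aux_mem (n ℓ : ℕ) (x : Equiv.Perm (Fin n)) (S : {S : Finset (Fin n) // S.card = ℓ})
    (h : x • S = S) (a : Fin n) : x a ∈ S.1 ↔ a ∈ S.1 := by
  have h1 : S.1.image x = S.1 := congrArg Subtype.val h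
  constructor
  · intro h2
    rw [← h1] at h2
    simpa using h2
  · intro h2
    rw [← h1]
    exact Finset.mem_image_of_mem _ h2

lemma aux_orb {Ω G : Type*} [Fintype Ω] [Group G] [MulAction G Ω] (x : G)
    (M : Finset Ω) (hM : ∀ s ∈ M, x • s ≠ s) : M.card ≤ 2 * ind Ω x := by
  classical
  let Q := MulAction.orbitRel.Quotient (Subgroup.zpowers x) Ω
  have : Fintype Q := Fintype.ofFinite _
  let f : Ω → Q := fun s => Quotient.mk _ s
  have hf : ∀ s, f (x • s) = f s := fun s =>
    Quotient.sound (⟨⟨x, Subgroup.mem_zpowers x⟩, rfl⟩)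
  have h1 := Finset.card_eq_sum_card_fiberwise (f := f) (s := Finset.univ)
    (t := Finset.univ) (by intro _ _; simp)
  have h2 := Finset.card_eq_sum_card_fiberwise (f := f)
    (s := Finset.univ.filter (fun s : Ω => x • s = s))
    (t := Finset.univ) (by intro _ _; simp)
  have h3 : Fintype.card Q * 2 ≤ (Finset.univ : Finset Ω).card +
      (Finset.univ.filter (fun s : Ω => x • s = s)).card := by
    rw [h1, h2, ← Finset.sum_add_distrib, ← Finset.card_univ (α := Q), ← smul_eq_mul]
    apply Finset.card_nsmul_le_sum
    intro q _
    obtain ⟨s, hs⟩ : ∃ s, f s = q := Quotient.exists_rep q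
    by_cases h : x • s = s
    · have e1 : 0 < (Finset.univ.filter (fun t => f t = q)).card :=
        Finset.card_pos.2 ⟨s, by simp [hs]⟩
      have e2 : 0 < ((Finset.univ.filter (fun s : Ω => x • s = s)).filter
          (fun t => f t = q)).card :=
        Finset.card_pos.2 ⟨s, by simp [hs, h]⟩
      omega
    · have e1 : 1 < (Finset.univ.filter (fun t => f t = q)).card :=
        Finset.one_lt_card.2 ⟨x • s, by simp [hs, hf], s, by simp [hs], h⟩
      omega
  have h4 : M.card + (Finset.univ.filter (fun s : Ω => x • s = s)).card
      ≤ (Finset.univ : Finset Ω).card := by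
    rw [← Finset.card_union_of_disjoint]
    · exact Finset.card_le_card (Finset.subset_univ _)
    · rw [Finset.disjoint_left]
      intro s hs h
      exact hM s hs (by simpa using h)
  have h5 : ind Ω x = (Finset.univ : Finset Ω).card - Fintype.card Q := by
    unfold ind
    rw [Nat.card_eq_fintype_card, Nat.card_eq_fintype_card, Finset.card_univ]
  omega

lemma aux_lower (n ℓ : ℕ) (hl : 1 ≤ ℓ) (x : Equiv.Perm (Fin n)) (hx : x ≠ 1) :
    (n - 2).choose (ℓ - 1) ≤ ind {S : Finset (Fin n) // S.card = ℓ} x ∧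
    (5 ≤ n → 2 * ℓ < n → ¬ x.IsSwap →
      (n - 2).choose (ℓ - 1) < ind {S : Finset (Fin n) // S.card = ℓ} x) := by
  classical
  obtain ⟨a, ha⟩ : ∃ a, x a ≠ a := by
    by_contra! h
    exact hx (Equiv.ext h)
  have hA := aux_B n ℓ hl a (x a) ha.symm
  have hB := aux_B n ℓ hl (x a) a ha
  set A := Finset.univ.filter (fun S : {S : Finset (Fin n) // S.card = ℓ} =>
      a ∈ S.1 ∧ x a ∉ S.1) with hAd
  set B := Finset.univ.filter (fun S : {S : Finset (Fin n) // S.card = ℓ} =>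
      x a ∈ S.1 ∧ a ∉ S.1) with hBd
  have hAB : Disjoint A B := by
    rw [Finset.disjoint_left]
    intro S h1 h2
    simp only [hAd, hBd, Finset.mem_filter, Finset.mem_univ, true_and] at h1 h2
    exact h2.2 h1.1
  have hM : ∀ S ∈ A ∪ B, x • S ≠ S := by
    intro S hS h
    have := aux_mem n ℓ x S h a
    simp only [hAd, hBd, Finset.mem_union, Finset.mem_filter, Finset.mem_univ, true_and] at hS
    tauto
  have hc := Finset.card_union_of_disjoint hAB
  refine ⟨by have := aux_orb x _ hM; omega, ?_⟩
  intro hn hln hs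
  obtain ⟨c, hca, hcb, hc'⟩ : ∃ c, c ≠ a ∧ c ≠ x a ∧ x c ≠ c := by
    by_contra! h
    apply hs
    refine ⟨a, x a, ha.symm, Equiv.ext fun y => ?_⟩
    by_cases hya : y = a
    · subst hya; simp
    by_cases hyb : y = x a
    · subst hyb
      rw [Equiv.swap_apply_right]
      by_contra h1
      have h2 : x (x a) ≠ x a := fun h => ha (x.injective h)
      exact h2 (x.injective (h _ h1 h2))
    · rw [Equiv.swap_apply_of_ne_of_ne hya hyb]
      exact h y hya hyb
  have hU : ℓ - 1 ≤ ((Finset.univ : Finset (Fin n)) \ {a, x a, c, x c}).card := by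
    have h1 := Finset.le_card_sdiff ({a, x a, c, x c} : Finset (Fin n)) Finset.univ
    have h2 : ({a, x a, c, x c} : Finset (Fin n)).card ≤ 4 := Finset.card_le_four
    simp only [Finset.card_univ, Fintype.card_fin] at h1
    omega
  obtain ⟨T, hT, hTc⟩ := Finset.exists_subset_card_eq hU
  have n1 : a ∉ T := fun h => by simpa using hT h
  have n2 : x a ∉ T := fun h => by simpa using hT h
  have n3 : c ∉ T := fun h => by simpa using hT h
  have n4 : x c ∉ T := fun h => by simpa using hT h
  let S : {S : Finset (Fin n) // S.card = ℓ} :=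
    ⟨insert c T, by rw [Finset.card_insert_of_notMem n3, hTc]; omega⟩
  have hS : S ∉ A ∪ B := by
    simp [hAd, hBd, S, n1, n2, hca.symm, hcb.symm]
  have hS2 : x • S ≠ S := by
    intro h
    have := aux_mem n ℓ x S h c
    simp [S, n4, hc'] at this
  have := aux_orb x (insert S (A ∪ B)) (by
    intro s hs
    rcases Finset.mem_insert.1 hs with rfl | h
    · exact hS2
    · exact hM s h)
  rw [Finset.card_insert_of_notMem hS] at this
  omega

lemma aux_upper (n ℓ : ℕ) (hl : 1 ≤ ℓ) (x : Equiv.Perm (Fin n)) (hx : x.IsSwap) :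
    ind {S : Finset (Fin n) // S.card = ℓ} x ≤ (n - 2).choose (ℓ - 1) := by
  classical
  obtain ⟨a, b, hab, rfl⟩ := hx
  rw [← aux_B n ℓ hl a b hab]
  set A := Finset.univ.filter (fun S : {S : Finset (Fin n) // S.card = ℓ} =>
      a ∈ S.1 ∧ b ∉ S.1) with hAd
  let Q := MulAction.orbitRel.Quotient (Subgroup.zpowers (Equiv.swap a b))
    {S : Finset (Fin n) // S.card = ℓ}
  have : Fintype Q := Fintype.ofFinite _
  have key : Aᶜ.card ≤ Fintype.card Q := by
    rw [← Finset.card_univ (α := Q)]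
    refine Finset.card_le_card_of_injOn (fun S => (Quotient.mk _ S : Q)) (by intro _ _; simp) ?_
    intro S hS T hT h
    obtain ⟨⟨g, hg⟩, hgT⟩ := Quotient.exact h
    have hgT : g • T = S := hgT
    have hg' : g = 1 ∨ g = Equiv.swap a b := by
      obtain ⟨k, rfl⟩ := Subgroup.mem_zpowers_iff.1 hg
      rcases Int.even_or_odd' k with ⟨m, rfl | rfl⟩
      · left
        rw [zpow_mul, show (Equiv.swap a b) ^ (2 : ℤ) = 1 by
          rw [zpow_two, Equiv.swap_mul_self], one_zpow]
      · right
        rw [zpow_add, zpow_mul, show (Equiv.swap a b) ^ (2 : ℤ) = 1 by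
          rw [zpow_two, Equiv.swap_mul_self], one_zpow, zpow_one, one_mul]
    rcases hg' with rfl | rfl
    · rw [← hgT, one_smul]
    · have h1 : T.1.image (Equiv.swap a b) = S.1 := congrArg Subtype.val hgT
      have hm : ∀ y, y ∈ S.1 ↔ Equiv.swap a b y ∈ T.1 := by
        intro y
        rw [← h1, Finset.mem_image]
        constructor
        · rintro ⟨z, hz, rfl⟩
          simpa using hz
        · intro hy
          exact ⟨_, hy, by simp⟩
      simp only [hAd, Finset.coe_compl, Set.mem_compl_iff, Finset.mem_coe, Finset.mem_filter,
        Finset.mem_univ, true_and] at hS hT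
      have ea := hm a
      have eb := hm b
      rw [Equiv.swap_apply_left] at ea
      rw [Equiv.swap_apply_right] at eb
      apply Subtype.ext
      ext y
      by_cases hya : y = a
      · subst hya; tauto
      by_cases hyb : y = b
      · subst hyb; tauto
      rw [hm y, Equiv.swap_apply_of_ne_of_ne hya hyb]
  have h5 : ind {S : Finset (Fin n) // S.card = ℓ} (Equiv.swap a b) =
      Fintype.card {S : Finset (Fin n) // S.card = ℓ} - Fintype.card Q := by
    unfold ind
    rw [Nat.card_eq_fintype_card, Nat.card_eq_fintype_card]
  have h6 := Finset.card_add_card_compl A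
  omega

/-- (The `S_n` case of Proposition 7.2 of the paper.) For `n ≥ 5` and
`1 ≤ ℓ` with `2ℓ < n`, the minimal index of `G = Sym(n)` acting on `ℓ`-element subsets of
`{0, …, n-1}` is `C(n-2, ℓ-1)`, and a nontrivial `x ∈ Sym(n)` attains this value if and
only if `x` is a transposition. -/
theorem stmt_9 (n ℓ : ℕ) (hn : 5 ≤ n) (hl : 1 ≤ ℓ) (hln : 2 * ℓ < n) :
    sInf {k | ∃ x : Equiv.Perm (Fin n), x ≠ 1 ∧
        ind {S : Finset (Fin n) // S.card = ℓ} x = k} = (n - 2).choose (ℓ - 1) ∧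
      ∀ x : Equiv.Perm (Fin n), x ≠ 1 →
        (ind {S : Finset (Fin n) // S.card = ℓ} x = (n - 2).choose (ℓ - 1) ↔ x.IsSwap) := by
  have hiff : ∀ x : Equiv.Perm (Fin n), x ≠ 1 →
        (ind {S : Finset (Fin n) // S.card = ℓ} x = (n - 2).choose (ℓ - 1) ↔ x.IsSwap) := by
    intro x hx
    obtain ⟨h1, h2⟩ := aux_lower n ℓ hl x hx
    constructor
    · intro h
      by_contra hs
      have := h2 hn hln hs
      omega
    · intro hs
      exact le_antisymm (aux_upper n ℓ hl x hs) h1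
  refine ⟨?_, hiff⟩
  have hne : (⟨0, by omega⟩ : Fin n) ≠ ⟨1, by omega⟩ := by simp
  have hmem : (n - 2).choose (ℓ - 1) ∈ {k | ∃ x : Equiv.Perm (Fin n), x ≠ 1 ∧
        ind {S : Finset (Fin n) // S.card = ℓ} x = k} := by
    have h1 : Equiv.swap (⟨0, by omega⟩ : Fin n) ⟨1, by omega⟩ ≠ 1 := by
      intro h
      exact hne (Equiv.swap_eq_one_iff.1 h)
    exact ⟨_, h1, (hiff _ h1).2 ⟨_, _, hne, rfl⟩⟩
  apply le_antisymm (Nat.sInf_le hmem)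
  apply le_csInf ⟨_, hmem⟩
  rintro k ⟨x, hx, rfl⟩
  exact (aux_lower n ℓ hl x hx).1
end

section
/- Let n ≥ 5 and let ℓ be an integer with 1 ≤ ℓ and 2ℓ < n, and let Ω be the set of ℓ-element subsets of {0,…,n−1} with the natural action of the alternating group G = Alt(n). Then Ind(G) = ( C(n,ℓ) − C(n−4,ℓ) − 2·C(n−4,ℓ−2) − C(n−4,ℓ−4) ) / 2; moreover, for a nontrivial x ∈ Alt(n), ind(x) = Ind(G) if and only if x is a product of two disjoint transpositions, or ℓ = 1 and x is a 3-cycle. -/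
/-- The binomial coefficient `C(m, k)` for an integer argument `k`, equal to `0` when
`k < 0` (the convention used in the paper). -/
def chooseZ (m : ℕ) (k : ℤ) : ℕ :=
  if 0 ≤ k then m.choose k.toNat else 0

/-- `x` is a product of two disjoint transpositions. -/
def IsDoubleTransposition {α : Type*} [DecidableEq α] (x : Equiv.Perm α) : Prop :=
  ∃ a b c d : α, a ≠ b ∧ c ≠ d ∧ a ≠ c ∧ a ≠ d ∧ b ≠ c ∧ b ≠ d ∧
    x = Equiv.swap a b * Equiv.swap c d

open Equiv Equiv.Perm

section general
open Classical in
lemma fiber_facts {Ω G : Type*} [Group G] [MulAction G Ω] [Fintype Ω] (x : G) (S : Ω) :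
    (Finset.univ.filter (fun T : Ω =>
      (Quotient.mk'' T : MulAction.orbitRel.Quotient (Subgroup.zpowers x) Ω) = Quotient.mk'' S)).card
      = Function.minimalPeriod (x • ·) S := by
  rw [MulAction.minimalPeriod_eq_card, ← Set.toFinset_card]
  congr 1
  ext T
  simp only [Finset.mem_filter, Finset.mem_univ, true_and, Set.mem_toFinset]
  rw [Quotient.eq'']
  rfl

open Classical in
lemma fiber_fixed {Ω G : Type*} [Group G] [MulAction G Ω] [Fintype Ω] (x : G) (S : Ω) :
    (Finset.univ.filter (fun T : Ω => x • T = T ∧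
      (Quotient.mk'' T : MulAction.orbitRel.Quotient (Subgroup.zpowers x) Ω) = Quotient.mk'' S)).card
      = if x • S = S then 1 else 0 := by
  have key : ∀ T : Ω, (Quotient.mk'' T : MulAction.orbitRel.Quotient (Subgroup.zpowers x) Ω)
      = Quotient.mk'' S → x • T = T → T = S := by
    intro T h hT
    rw [eq_comm, Quotient.eq''] at h
    obtain ⟨⟨g, k, rfl⟩, hg⟩ := h
    have : x ^ k ∈ MulAction.stabilizer G T :=
      Subgroup.zpow_mem _ (by simpa [MulAction.mem_stabilizer_iff] using hT) k
    have h2 : x ^ k • T = T := this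
    have h3 : x ^ k • T = S := hg
    exact h2.symm.trans h3
  split_ifs with h
  · rw [Finset.card_eq_one]
    refine ⟨S, ?_⟩
    ext T
    simp only [Finset.mem_filter, Finset.mem_univ, true_and, Finset.mem_singleton]
    constructor
    · rintro ⟨h1, h2⟩; exact key T h2 h1
    · rintro rfl; exact ⟨h, rfl⟩
  · rw [Finset.card_eq_zero, Finset.filter_eq_empty_iff]
    rintro T - ⟨h1, h2⟩
    have := key T h2 h1
    subst this
    exact h h1

open Classical in
lemma sums {Ω G : Type*} [Group G] [MulAction G Ω] [Fintype Ω] (x : G)  :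
    (Fintype.card Ω = ∑ q : MulAction.orbitRel.Quotient (Subgroup.zpowers x) Ω,
      (Finset.univ.filter (fun T : Ω => (Quotient.mk'' T :
        MulAction.orbitRel.Quotient (Subgroup.zpowers x) Ω) = q)).card) ∧
    ((Finset.univ.filter (fun T : Ω => x • T = T)).card =
      ∑ q : MulAction.orbitRel.Quotient (Subgroup.zpowers x) Ω,
      (Finset.univ.filter (fun T : Ω => x • T = T ∧ (Quotient.mk'' T :
        MulAction.orbitRel.Quotient (Subgroup.zpowers x) Ω) = q)).card) := by
  constructor
  · exact Finset.card_eq_sum_card_fiberwise (fun _ _ => Finset.mem_coe.2 (Finset.mem_univ _))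
  · rw [Finset.card_eq_sum_card_fiberwise (f := fun T : Ω => (Quotient.mk'' T :
        MulAction.orbitRel.Quotient (Subgroup.zpowers x) Ω)) (t := Finset.univ)
        (fun _ _ => Finset.mem_coe.2 (Finset.mem_univ _))]
    simp only [Finset.filter_filter]

open Classical in
lemma ind_lower {Ω G : Type*} [Group G] [MulAction G Ω] [Fintype Ω] (x : G) :
    Fintype.card Ω ≤ (Finset.univ.filter (fun T : Ω => x • T = T)).card + 2 * ind Ω x := by
  have h : 2 * Fintype.card (MulAction.orbitRel.Quotient (Subgroup.zpowers x) Ω) ≤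
      Fintype.card Ω + (Finset.univ.filter (fun T : Ω => x • T = T)).card := by
    rw [(sums (Ω := Ω) x).1, (sums (Ω := Ω) x).2, ← Finset.sum_add_distrib, mul_comm, ← smul_eq_mul,
      ← Finset.card_univ]
    apply Finset.card_nsmul_le_sum
    intro q _
    induction q using Quotient.inductionOn' with | h S => ?_
    rw [fiber_facts, fiber_fixed]
    have h0 : 0 < Function.minimalPeriod (x • ·) S := by
      rw [← fiber_facts, Finset.card_pos]; exact ⟨S, by simp⟩
    split_ifs with hS
    · omega
    · have : Function.minimalPeriod (x • ·) S ≠ 1 := by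
        rw [Ne, Function.minimalPeriod_eq_one_iff_isFixedPt]; exact hS
      omega
  unfold ind
  rw [Nat.card_eq_fintype_card, Nat.card_eq_fintype_card]
  omega

open Classical in
lemma ind_exact {Ω G : Type*} [Group G] [MulAction G Ω] [Fintype Ω] (x : G) (p : ℕ)
    (hp : p.Prime) (hx : x ^ p = 1) :
    p * ind Ω x + (p - 1) * (Finset.univ.filter (fun T : Ω => x • T = T)).card
      = (p - 1) * Fintype.card Ω := by
  have h : Fintype.card Ω + (p - 1) * (Finset.univ.filter (fun T : Ω => x • T = T)).card
      = p * Fintype.card (MulAction.orbitRel.Quotient (Subgroup.zpowers x) Ω) := by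
    rw [(sums (Ω := Ω) x).1, (sums (Ω := Ω) x).2, Finset.mul_sum, ← Finset.sum_add_distrib, mul_comm p,
      ← Finset.card_univ]
    apply Finset.sum_const_nat
    intro q _
    induction q using Quotient.inductionOn' with | h S => ?_
    rw [fiber_facts, fiber_fixed]
    have hd : Function.minimalPeriod (x • ·) S ∣ p := by
      apply Function.IsPeriodicPt.minimalPeriod_dvd
      show (x • ·)^[p] S = S
      rw [smul_iterate]; simp [hx]
    have := hp.one_lt
    split_ifs with hS
    · have : Function.minimalPeriod (x • ·) S = 1 := by
        rw [Function.minimalPeriod_eq_one_iff_isFixedPt]; exact hS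
      omega
    · have : Function.minimalPeriod (x • ·) S ≠ 1 := by
        rw [Ne, Function.minimalPeriod_eq_one_iff_isFixedPt]; exact hS
      rcases (Nat.dvd_prime hp).1 hd with h | h <;> omega
  have hle : Fintype.card (MulAction.orbitRel.Quotient (Subgroup.zpowers x) Ω) ≤ Fintype.card Ω :=
    Fintype.card_le_of_surjective (Quotient.mk'') Quotient.mk''_surjective
  unfold ind
  rw [Nat.card_eq_fintype_card, Nat.card_eq_fintype_card]
  obtain ⟨d, hd⟩ := Nat.exists_eq_add_of_le hle
  obtain ⟨r, rfl⟩ : ∃ r, p = r + 1 := ⟨p - 1, by have := hp.pos; omega⟩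
  rw [hd] at h ⊢
  simp only [Nat.add_sub_cancel, Nat.add_sub_cancel_left] at h ⊢
  nlinarith

lemma ind_lower' {Ω G : Type*} [Group G] [MulAction G Ω] [Fintype Ω] (x : G)
    [DecidablePred fun T : Ω => x • T = T] :
    Fintype.card Ω ≤ (Finset.univ.filter (fun T : Ω => x • T = T)).card + 2 * ind Ω x := by
  convert ind_lower (Ω := Ω) x

lemma ind_exact' {Ω G : Type*} [Group G] [MulAction G Ω] [Fintype Ω] (x : G) (p : ℕ)
    [DecidablePred fun T : Ω => x • T = T] (hp : p.Prime) (hx : x ^ p = 1) :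
    p * ind Ω x + (p - 1) * (Finset.univ.filter (fun T : Ω => x • T = T)).card
      = (p - 1) * Fintype.card Ω := by
  convert ind_exact (Ω := Ω) x p hp hx
end general

section counting

lemma chooseZ_pascal (m : ℕ) (k : ℤ) : chooseZ (m + 1) k = chooseZ m k + chooseZ m (k - 1) := by
  unfold chooseZ
  rcases lt_trichotomy k 0 with h | h | h
  · rw [if_neg (by omega), if_neg (by omega), if_neg (by omega)]
  · subst h; simp
  · rw [if_pos (by omega), if_pos (by omega), if_pos (by omega)]
    obtain ⟨j, rfl⟩ : ∃ j : ℕ, k = j + 1 := ⟨(k - 1).toNat, by omega⟩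
    have h1 : ((j : ℤ) + 1).toNat = j + 1 := by omega
    have h2 : ((j : ℤ) + 1 - 1).toNat = j := by omega
    rw [h1, h2, Nat.choose_succ_succ]; ring

lemma chooseZ_nat (m k : ℕ) : chooseZ m k = m.choose k := by simp [chooseZ]

lemma count_inter (n ℓ : ℕ) (A B : Finset (Fin n)) (hB : B ⊆ A) :
    (Finset.univ.filter (fun S : Finset (Fin n) => S.card = ℓ ∧ S ∩ A = B)).card
      = chooseZ (n - A.card) ((ℓ : ℤ) - B.card) := by
  unfold chooseZ
  split_ifs with h
  · have hc : (Aᶜ).card = n - A.card := by simp [Finset.card_compl]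
    have ht : ((ℓ : ℤ) - B.card).toNat = ℓ - B.card := by omega
    rw [ht, ← hc, ← Finset.card_powersetCard]
    symm
    have hd : ∀ T ⊆ Aᶜ, Disjoint T B := fun T hT =>
      Finset.disjoint_left.2 fun e he he' => by have := hT he; simp at this; exact this (hB he')
    refine Finset.card_bij' (fun T _ => T ∪ B) (fun S _ => S \ A) ?_ ?_ ?_ ?_
    · intro T hT
      rw [Finset.mem_powersetCard] at hT
      simp only [Finset.mem_filter, Finset.mem_univ, true_and]
      constructor
      · rw [Finset.card_union_of_disjoint (hd T hT.1)]; omega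
      · ext e
        have h1 := @hT.1 e
        have h2 := @hB e
        simp at h1 ⊢; tauto
    · intro S hS
      simp only [Finset.mem_filter, Finset.mem_univ, true_and] at hS
      rw [Finset.mem_powersetCard]
      constructor
      · intro e; simp
      · have := Finset.card_sdiff_add_card_inter S A
        rw [hS.2] at this; omega
    · intro T hT
      rw [Finset.mem_powersetCard] at hT
      ext e
      have h1 := @hT.1 e
      have h2 := @hB e
      simp at h1 ⊢; tauto
    · intro S hS
      simp only [Finset.mem_filter, Finset.mem_univ, true_and] at hS
      rw [← hS.2]
      ext e; simp; tauto
  · rw [Finset.card_eq_zero, Finset.filter_eq_empty_iff]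
    rintro S - ⟨h1, h2⟩
    have := Finset.card_le_card (Finset.inter_subset_left (s₁ := S) (s₂ := A))
    rw [h2] at this; omega

end counting

section perms
variable {n ℓ : ℕ}

lemma fixed_iff (x : Perm (Fin n)) (S : {S : Finset (Fin n) // S.card = ℓ}) :
    x • S = S ↔ ∀ e, x e ∈ S.1 ↔ e ∈ S.1 := by
  rw [Subtype.ext_iff]
  show S.1.image x = S.1 ↔ _
  constructor
  · intro h e
    conv_lhs => rw [← h]
    simp
  · intro h
    ext e
    rw [Finset.mem_image]
    constructor
    · rintro ⟨f, hf, rfl⟩; exact (h f).2 hf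
    · intro he; exact ⟨x⁻¹ e, (h _).1 (by simpa using he), by simp⟩

lemma fixed_same (x : Perm (Fin n)) (S : Finset (Fin n)) (h : ∀ e, x e ∈ S ↔ e ∈ S)
    {a b : Fin n} (hab : x.SameCycle a b) : a ∈ S ↔ b ∈ S := by
  obtain ⟨k, rfl⟩ := hab
  have h' : ∀ e, x⁻¹ e ∈ S ↔ e ∈ S := fun e => by rw [← h]; simp
  induction k using Int.induction_on with
  | zero => simp
  | succ i ih => refine ih.trans ?_; rw [add_comm, zpow_add, zpow_one, Perm.mul_apply, h]
  | pred i ih => refine ih.trans ?_; rw [sub_eq_neg_add, zpow_add, zpow_neg_one, Perm.mul_apply, h']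

/-- the double transposition's fixed sets -/
lemma dt_fixed_iff {a b c d : Fin n} (_hab : a ≠ b) (_hcd : c ≠ d) (hac : a ≠ c) (had : a ≠ d)
    (hbc : b ≠ c) (hbd : b ≠ d) (S : {S : Finset (Fin n) // S.card = ℓ}) :
    (swap a b * swap c d) • S = S ↔ (a ∈ S.1 ↔ b ∈ S.1) ∧ (c ∈ S.1 ↔ d ∈ S.1) := by
  rw [fixed_iff]
  constructor
  · intro h
    have h1 := h a
    have h2 := h c
    rw [Perm.mul_apply, swap_apply_of_ne_of_ne hac had, swap_apply_left] at h1
    rw [Perm.mul_apply, swap_apply_left, swap_apply_of_ne_of_ne had.symm hbd.symm] at h2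
    tauto
  · rintro ⟨h1, h2⟩ e
    simp only [Perm.mul_apply, swap_apply_def]
    grind

lemma subtype_count (P : Finset (Fin n) → Prop) [DecidablePred P]
    [DecidablePred fun S : {S : Finset (Fin n) // S.card = ℓ} => P S.1] :
    (Finset.univ.filter (fun S : {S : Finset (Fin n) // S.card = ℓ} => P S.1)).card =
      (Finset.univ.filter (fun S : Finset (Fin n) => S.card = ℓ ∧ P S)).card := by
  rw [← Finset.card_map (Function.Embedding.subtype _)]
  congr 1
  ext S
  simp only [Finset.mem_map, Finset.mem_filter, Finset.mem_univ, true_and,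
    Function.Embedding.coe_subtype]
  constructor
  · rintro ⟨T, h, rfl⟩; exact ⟨T.2, h⟩
  · rintro ⟨h1, h2⟩; exact ⟨⟨S, h1⟩, h2, rfl⟩

open Classical in
lemma dt_count {a b c d : Fin n} (hab : a ≠ b) (hcd : c ≠ d) (hac : a ≠ c) (had : a ≠ d)
    (hbc : b ≠ c) (hbd : b ≠ d) :
    (Finset.univ.filter (fun S : {S : Finset (Fin n) // S.card = ℓ} =>
      (swap a b * swap c d) • S = S)).card = chooseZ (n - 4) ℓ + 2 * chooseZ (n - 4) ((ℓ : ℤ) - 2)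
        + chooseZ (n - 4) ((ℓ : ℤ) - 4) := by
  simp_rw [dt_fixed_iff hab hcd hac had hbc hbd]
  rw [subtype_count (fun S => (a ∈ S ↔ b ∈ S) ∧ (c ∈ S ↔ d ∈ S))]
  have hA : ({a, b, c, d} : Finset (Fin n)).card = 4 := by
    rw [Finset.card_eq_succ]; exact ⟨a, {b, c, d}, by simp [*], rfl, by
      rw [Finset.card_eq_three]; exact ⟨b, c, d, hbc, hbd, hcd, rfl⟩⟩
  have h0 := count_inter n ℓ {a, b, c, d} ∅ (by simp)
  have h1 := count_inter n ℓ {a, b, c, d} {a, b} (by intro e; simp; tauto)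
  have h2 := count_inter n ℓ {a, b, c, d} {c, d} (by intro e; simp; tauto)
  have h3 := count_inter n ℓ {a, b, c, d} {a, b, c, d} (by simp)
  rw [hA] at h0 h1 h2 h3
  rw [Finset.card_pair hab] at h1
  rw [Finset.card_pair hcd] at h2
  simp only [Finset.card_empty, Nat.cast_zero, sub_zero, Nat.cast_ofNat] at h0 h1 h2 h3
  have : (Finset.univ.filter (fun S : Finset (Fin n) => S.card = ℓ ∧
      ((a ∈ S ↔ b ∈ S) ∧ (c ∈ S ↔ d ∈ S)))) =
      ((Finset.univ.filter (fun S : Finset (Fin n) => S.card = ℓ ∧ S ∩ {a, b, c, d} = ∅)) ∪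
      (Finset.univ.filter (fun S : Finset (Fin n) => S.card = ℓ ∧ S ∩ {a, b, c, d} = {a, b}))) ∪
      ((Finset.univ.filter (fun S : Finset (Fin n) => S.card = ℓ ∧ S ∩ {a, b, c, d} = {c, d})) ∪
      (Finset.univ.filter
        (fun S : Finset (Fin n) => S.card = ℓ ∧ S ∩ {a, b, c, d} = {a, b, c, d}))) := by
    ext S
    simp only [Finset.mem_union, Finset.mem_filter, Finset.mem_univ, true_and, Finset.ext_iff,
      Finset.mem_inter, Finset.mem_insert, Finset.mem_singleton, Finset.notMem_empty, iff_false]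
    constructor
    · rintro ⟨h, hh1, hh2⟩
      by_cases ha : a ∈ S <;> by_cases hc : c ∈ S
      · right; right; grind
      · left; right; grind
      · right; left; grind
      · left; left; grind
    · rintro ((⟨h, hh⟩ | ⟨h, hh⟩) | (⟨h, hh⟩ | ⟨h, hh⟩)) <;>
      · have e1 := hh a
        have e2 := hh b
        have e3 := hh c
        have e4 := hh d
        refine ⟨h, ?_⟩
        grind
  have hdis : ∀ B C : Finset (Fin n), B ≠ C → Disjoint
      (Finset.univ.filter (fun S : Finset (Fin n) => S.card = ℓ ∧ S ∩ {a, b, c, d} = B))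
      (Finset.univ.filter (fun S : Finset (Fin n) => S.card = ℓ ∧ S ∩ {a, b, c, d} = C)) := by
    intro B C hBC
    rw [Finset.disjoint_left]
    intro S h1 h2
    simp only [Finset.mem_filter, Finset.mem_univ, true_and] at h1 h2
    exact hBC (h1.2.symm.trans h2.2)
  have n1 : (∅ : Finset (Fin n)) ≠ {a, b} := fun h => by have := Finset.ext_iff.1 h a; simp at this
  have n2 : (∅ : Finset (Fin n)) ≠ {c, d} := fun h => by have := Finset.ext_iff.1 h c; simp at this
  have n3 : (∅ : Finset (Fin n)) ≠ {a, b, c, d} := fun h => by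
    have := Finset.ext_iff.1 h a; simp at this
  have n4 : ({a, b} : Finset (Fin n)) ≠ {c, d} := fun h => by
    have := Finset.ext_iff.1 h a; simp [hac, had] at this
  have n5 : ({a, b} : Finset (Fin n)) ≠ {a, b, c, d} := fun h => by
    have := Finset.ext_iff.1 h c; simp [hac.symm, hbc.symm] at this
  have n6 : ({c, d} : Finset (Fin n)) ≠ {a, b, c, d} := fun h => by
    have := Finset.ext_iff.1 h a; simp [hac, had] at this
  rw [this, Finset.card_union_of_disjoint, Finset.card_union_of_disjoint (hdis _ _ n1),
    Finset.card_union_of_disjoint (hdis _ _ n6), h0, h1, h2, h3]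
  · ring
  · simp only [Finset.disjoint_union_left, Finset.disjoint_union_right]
    exact ⟨⟨hdis _ _ n2, hdis _ _ n4⟩, ⟨hdis _ _ n3, hdis _ _ n5⟩⟩

open Classical in
lemma tc_count {a b c : Fin n} (hab : a ≠ b) (hac : a ≠ c) (hbc : b ≠ c) :
    (Finset.univ.filter (fun S : {S : Finset (Fin n) // S.card = ℓ} =>
      (swap a b * swap b c) • S = S)).card = chooseZ (n - 3) ℓ + chooseZ (n - 3) ((ℓ : ℤ) - 3) := by
  have hfix : ∀ S : {S : Finset (Fin n) // S.card = ℓ}, (swap a b * swap b c) • S = S ↔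
      (a ∈ S.1 ↔ b ∈ S.1) ∧ (b ∈ S.1 ↔ c ∈ S.1) := by
    intro S
    rw [fixed_iff]
    constructor
    · intro h
      have h1 := h a
      have h2 := h b
      rw [Perm.mul_apply, swap_apply_of_ne_of_ne hab hac, swap_apply_left] at h1
      rw [Perm.mul_apply, swap_apply_left, swap_apply_of_ne_of_ne hac.symm hbc.symm] at h2
      tauto
    · rintro ⟨h1, h2⟩ e
      simp only [Perm.mul_apply, swap_apply_def]
      grind
  simp_rw [hfix]
  rw [subtype_count (fun S => (a ∈ S ↔ b ∈ S) ∧ (b ∈ S ↔ c ∈ S))]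
  have hA : ({a, b, c} : Finset (Fin n)).card = 3 := by
    rw [Finset.card_eq_three]; exact ⟨a, b, c, hab, hac, hbc, rfl⟩
  have h0 := count_inter n ℓ {a, b, c} ∅ (by simp)
  have h3 := count_inter n ℓ {a, b, c} {a, b, c} (by simp)
  rw [hA] at h0 h3
  simp only [Finset.card_empty, Nat.cast_zero, sub_zero, Nat.cast_ofNat] at h0 h3
  have : (Finset.univ.filter (fun S : Finset (Fin n) => S.card = ℓ ∧
      ((a ∈ S ↔ b ∈ S) ∧ (b ∈ S ↔ c ∈ S)))) =
      ((Finset.univ.filter (fun S : Finset (Fin n) => S.card = ℓ ∧ S ∩ {a, b, c} = ∅)) ∪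
      (Finset.univ.filter (fun S : Finset (Fin n) => S.card = ℓ ∧ S ∩ {a, b, c} = {a, b, c}))) := by
    ext S
    simp only [Finset.mem_union, Finset.mem_filter, Finset.mem_univ, true_and, Finset.ext_iff,
      Finset.mem_inter, Finset.mem_insert, Finset.mem_singleton, Finset.notMem_empty, iff_false]
    constructor
    · rintro ⟨h, hh1, hh2⟩
      by_cases ha : a ∈ S
      · right; grind
      · left; grind
    · rintro (⟨h, hh⟩ | ⟨h, hh⟩) <;>
      · have e1 := hh a
        have e2 := hh b
        have e3 := hh c
        refine ⟨h, ?_⟩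
        grind
  rw [this, Finset.card_union_of_disjoint, h0, h3]
  rw [Finset.disjoint_left]
  intro S h1 h2
  simp only [Finset.mem_filter, Finset.mem_univ, true_and] at h1 h2
  have := Finset.ext_iff.1 (h1.2.symm.trans h2.2) a
  simp at this

lemma dt_sq {a b c d : Fin n} (hac : a ≠ c) (had : a ≠ d) (hbc : b ≠ c) (hbd : b ≠ d) :
    (swap a b * swap c d) ^ 2 = 1 := by
  ext e
  simp only [pow_two, Perm.mul_apply, swap_apply_def, Perm.one_apply]
  grind

lemma even_dichotomy (x : Perm (Fin n)) (hx : x ∈ alternatingGroup (Fin n)) (h1 : x ≠ 1) :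
    (∃ a b c : Fin n, a ≠ b ∧ a ≠ c ∧ b ≠ c ∧ x = swap a b * swap b c) ∨
    (∃ a b c d : Fin n, a ≠ b ∧ c ≠ d ∧ a ≠ c ∧ a ≠ d ∧ b ≠ c ∧ b ≠ d ∧
      x.SameCycle a b ∧ x.SameCycle c d) := by
  have hinj := x.injective
  obtain ⟨a, ha⟩ : ∃ a, x a ≠ a := by
    by_contra! h; exact h1 (Perm.ext h)
  by_cases hc : ∃ c, c ≠ a ∧ c ≠ x a ∧ x c ≠ a ∧ x c ≠ x a ∧ x c ≠ c
  · obtain ⟨c, h1, h2, h3, h4, h5⟩ := hc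
    right
    exact ⟨a, x a, c, x c, ha.symm, h5.symm, h1.symm, h3.symm, h2.symm, h4.symm,
      ⟨1, by simp⟩, ⟨1, by simp⟩⟩
  · push Not at hc
    left
    by_cases hb : x (x a) = a
    · exfalso
      have : x = swap a (x a) := by
        apply Perm.ext
        intro e
        rw [swap_apply_def]
        have := @hinj e a
        have := @hinj e (x a)
        have := hc e
        grind
      rw [mem_alternatingGroup, this, sign_swap ha.symm] at hx
      exact absurd hx (by decide)
    · have e1 : x (x a) ≠ x a := fun h => ha (hinj h)
      refine ⟨a, x a, x (x a), ha.symm, Ne.symm hb, e1.symm, ?_⟩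
      have e2 : x (x (x a)) = a := by
        have := hc (x (x a)) hb e1
        have := @hinj (x (x a)) a
        have := @hinj (x (x a)) (x a)
        grind
      apply Perm.ext
      intro e
      rw [Perm.mul_apply, swap_apply_def, swap_apply_def]
      have := @hinj e a
      have := @hinj e (x a)
      have := @hinj e (x (x a))
      have := hc e
      grind

lemma not_even_four (x : Perm (Fin n)) (hx : x ∈ alternatingGroup (Fin n)) {a b c d : Fin n}
    (hab : a ≠ b) (hcd : c ≠ d) (hac : a ≠ c) (had : a ≠ d) (hbc : b ≠ c) (hbd : b ≠ d)
    (h1 : x a = b) (h2 : x b = c) (h3 : x c = d) (h4 : x d = a)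
    (h5 : ∀ e, e ≠ a → e ≠ b → e ≠ c → e ≠ d → x e = e) : False := by
  have : x = swap a b * swap b c * swap c d := by
    apply Perm.ext
    intro e
    rw [Perm.mul_apply, Perm.mul_apply, swap_apply_def c d]
    simp only [swap_apply_def]
    have := h5 e
    grind
  rw [mem_alternatingGroup, this, Perm.sign_mul, Perm.sign_mul, sign_swap hab, sign_swap hbc,
    sign_swap hcd] at hx
  exact absurd hx (by decide)

lemma moved_of_same (x : Perm (Fin n)) {a b : Fin n} (hab : a ≠ b) (h : x.SameCycle a b) :
    x a ≠ a := fun h' => hab (h.eq_of_left h')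

/-- some point outside is moved -/
lemma moved_outside (x : Perm (Fin n)) (hx : x ∈ alternatingGroup (Fin n)) {a b c d : Fin n}
    (hab : a ≠ b) (hcd : c ≠ d) (hac : a ≠ c) (had : a ≠ d) (hbc : b ≠ c) (hbd : b ≠ d)
    (s1 : x.SameCycle a b) (s2 : x.SameCycle c d) (hnd : ¬ IsDoubleTransposition x) :
    ∃ e, e ≠ a ∧ e ≠ b ∧ e ≠ c ∧ e ≠ d ∧ x e ≠ e := by
  by_contra! h
  have hinj := x.injective
  have ma := moved_of_same x hab s1
  have mb := moved_of_same x hab.symm s1.symm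
  have mc := moved_of_same x hcd s2
  have md := moved_of_same x hcd.symm s2.symm
  have mem : ∀ e, x e ≠ e → x e = a ∨ x e = b ∨ x e = c ∨ x e = d := by
    intro e he
    by_contra! h'
    have := h (x e) h'.1 h'.2.1 h'.2.2.1 h'.2.2.2
    exact he (hinj this)
  have dt : ∀ p q r s : Fin n, p ≠ q → r ≠ s → p ≠ r → p ≠ s → q ≠ r → q ≠ s →
      x p = q → x q = p → x r = s → x s = r →
      (∀ e, e ≠ p → e ≠ q → e ≠ r → e ≠ s → x e = e) → False := by
    intro p q r s h1 h2 h3 h4 h5 h6 e1 e2 e3 e4 h7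
    refine hnd ⟨p, q, r, s, h1, h2, h3, h4, h5, h6, ?_⟩
    apply Perm.ext
    intro e
    rw [Perm.mul_apply, swap_apply_def r s]
    simp only [swap_apply_def]
    have := h7 e
    grind
  have iab := fun h => hab (@hinj a b h)
  have iac := fun h => hac (@hinj a c h)
  have iad := fun h => had (@hinj a d h)
  have ibc := fun h => hbc (@hinj b c h)
  have ibd := fun h => hbd (@hinj b d h)
  have icd := fun h => hcd (@hinj c d h)
  have FC := fun p q r s h1 h2 h3 h4 h5 h6 => @not_even_four n x hx p q r s h1 h2 h3 h4 h5 h6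
  -- general step
  have step : ∀ p q r s : Fin n, p ≠ q → r ≠ s → p ≠ r → p ≠ s → q ≠ r → q ≠ s →
      (∀ e, e ≠ p → e ≠ q → e ≠ r → e ≠ s → x e = e) → x p ≠ p → x q ≠ q → x r ≠ r → x s ≠ s →
      (∀ e, x e ≠ e → x e = p ∨ x e = q ∨ x e = r ∨ x e = s) → x p = q → False := by
    intro p q r s h1 h2 h3 h4 h5 h6 h7 mp mq mr ms hm e1
    have i1 := fun h => h1 (@hinj p q h)
    have i2 := fun h => h3 (@hinj p r h)
    have i3 := fun h => h4 (@hinj p s h)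
    have i4 := fun h => h5 (@hinj q r h)
    have i5 := fun h => h6 (@hinj q s h)
    have i6 := fun h => h2 (@hinj r s h)
    have mq' := hm q mq
    have mr' := hm r mr
    have ms' := hm s ms
    by_cases c1 : x q = p
    · exact dt p q r s h1 h2 h3 h4 h5 h6 e1 c1 (by grind) (by grind) h7
    · by_cases c2 : x q = r
      · exact FC p q r s h1 h2 h3 h4 h5 h6 e1 c2 (by grind) (by grind) h7
      · exact FC p q s r h1 h2.symm h4 h3 h6 h5 e1 (by grind) (by grind) (by grind)
          (fun e u1 u2 u3 u4 => h7 e u1 u2 u4 u3)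
  rcases mem a ma with e | e | e | e
  · exact ma e
  · exact step a b c d hab hcd hac had hbc hbd h ma mb mc md mem e
  · exact step a c b d hac hbd hab had hbc.symm hcd (fun e u1 u2 u3 u4 => h e u1 u3 u2 u4)
      ma mc mb md (fun e he => by have := mem e he; tauto) e
  · exact step a d b c had hbc hab hac hbd.symm hcd.symm (fun e u1 u2 u3 u4 => h e u1 u3 u4 u2)
      ma md mb mc (fun e he => by have := mem e he; tauto) e

lemma caseB (hln : 2 * ℓ < n) (hl : 2 ≤ ℓ) (x : Perm (Fin n)) {a b c d p : Fin n}
    (hab : a ≠ b) (hac : a ≠ c) (had : a ≠ d) (hbc : b ≠ c) (hbd : b ≠ d)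
    (hp : p = a ∨ p = b) (h1 : x p ≠ a) (h2 : x p ≠ b) :
    ∃ S : Finset (Fin n), S.card = ℓ ∧ ((a ∈ S ↔ b ∈ S) ∧ (c ∈ S ↔ d ∈ S)) ∧
      ∃ e, e ∈ S ∧ x e ∉ S := by
  have hcard : ℓ - 2 ≤ (({a, b, c, d, x p} : Finset (Fin n))ᶜ).card := by
    rw [Finset.card_compl, Fintype.card_fin]
    have := Finset.card_le_five (a := a) (b := b) (c := c) (d := d) (e := x p)
    omega
  obtain ⟨T, hT, hTc⟩ := Finset.exists_subset_card_eq hcard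
  have hT' : ∀ e ∈ T, e ≠ a ∧ e ≠ b ∧ e ≠ c ∧ e ≠ d ∧ e ≠ x p := by
    intro e he
    have := hT he
    simpa using this
  have ta : a ∉ T := fun h => (hT' a h).1 rfl
  have tb : b ∉ T := fun h => (hT' b h).2.1 rfl
  have tc : c ∉ T := fun h => (hT' c h).2.2.1 rfl
  have td : d ∉ T := fun h => (hT' d h).2.2.2.1 rfl
  have tp : x p ∉ T := fun h => (hT' _ h).2.2.2.2 rfl
  refine ⟨insert a (insert b T), ?_, ?_, p, ?_, ?_⟩
  · rw [Finset.card_insert_of_notMem (by simp [hab, ta]), Finset.card_insert_of_notMem tb]; omega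
  · simp [hac.symm, had.symm, hbc.symm, hbd.symm, tc, td]
  · rcases hp with rfl | rfl <;> simp
  · simp [h1, h2, tp]

lemma strict (hl : 1 ≤ ℓ) (hln : 2 * ℓ < n) (x : Perm (Fin n))
    (hx : x ∈ alternatingGroup (Fin n)) {a b c d : Fin n}
    (hab : a ≠ b) (hcd : c ≠ d) (hac : a ≠ c) (had : a ≠ d) (hbc : b ≠ c) (hbd : b ≠ d)
    (s1 : x.SameCycle a b) (s2 : x.SameCycle c d) (hnd : ¬ IsDoubleTransposition x) :
    ∃ S : Finset (Fin n), S.card = ℓ ∧ ((a ∈ S ↔ b ∈ S) ∧ (c ∈ S ↔ d ∈ S)) ∧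
      ∃ e, e ∈ S ∧ x e ∉ S := by
  have hinj := x.injective
  obtain ⟨e, ea, eb, ec, ed, he⟩ := moved_outside x hx hab hcd hac had hbc hbd s1 s2 hnd
  rcases Nat.lt_or_ge ℓ 2 with hl2 | hl2
  · exact ⟨{e}, by simp; omega, by simp [ea.symm, eb.symm, ec.symm, ed.symm], e, by simp,
      by simpa using he⟩
  have ma := moved_of_same x hab s1
  have mb := moved_of_same x hab.symm s1.symm
  have mc := moved_of_same x hcd s2
  have md := moved_of_same x hcd.symm s2.symm
  by_cases qa : x a = b
  swap
  · exact caseB hln hl2 x hab hac had hbc hbd (Or.inl rfl) ma qa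
  by_cases qb : x b = a
  swap
  · exact caseB hln hl2 x hab hac had hbc hbd (Or.inr rfl) qb mb
  by_cases qc : x c = d
  swap
  · obtain ⟨S, h1, h2, h3⟩ := caseB hln hl2 x (c := a) (d := b) hcd hac.symm hbc.symm had.symm
      hbd.symm (Or.inl rfl) mc qc
    exact ⟨S, h1, h2.symm, h3⟩
  by_cases qd : x d = c
  swap
  · obtain ⟨S, h1, h2, h3⟩ := caseB hln hl2 x (c := a) (d := b) hcd hac.symm hbc.symm had.symm
      hbd.symm (Or.inr rfl) qd md
    exact ⟨S, h1, h2.symm, h3⟩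
  have fa : x e ≠ a := fun h => eb (hinj (h.trans qb.symm))
  have fb : x e ≠ b := fun h => ea (hinj (h.trans qa.symm))
  have fc : x e ≠ c := fun h => ed (hinj (h.trans qd.symm))
  have fd : x e ≠ d := fun h => ec (hinj (h.trans qc.symm))
  by_cases h3 : ℓ = 3
  · refine ⟨{a, b, e}, ?_, ?_, e, by simp, ?_⟩
    · rw [h3, Finset.card_eq_three]; exact ⟨a, b, e, hab, ea.symm, eb.symm, rfl⟩
    · simp [hac.symm, had.symm, hbc.symm, hbd.symm, ec.symm, ed.symm]
    · simp [fa, fb, he]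
  have hcU := Finset.card_le_six (a := a) (b := b) (c := c) (d := d) (e := e) (f := x e)
  have hU : 0 < (({a, b, c, d, e, x e} : Finset (Fin n))ᶜ).card := by
    rw [Finset.card_pos]
    by_contra hne
    rw [Finset.not_nonempty_iff_eq_empty] at hne
    have hall : ∀ g, g = a ∨ g = b ∨ g = c ∨ g = d ∨ g = e ∨ g = x e := by
      intro g
      have : g ∉ (({a, b, c, d, e, x e} : Finset (Fin n))ᶜ) := by rw [hne]; simp
      simp at this; tauto
    have hee : x (x e) = e := by
      have := hall (x (x e))
      have := @hinj (x e) a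
      have := @hinj (x e) b
      have := @hinj (x e) c
      have := @hinj (x e) d
      have := @hinj (x e) e
      grind
    have : x = swap a b * swap c d * swap e (x e) := by
      apply Perm.ext
      intro g
      rw [Perm.mul_apply, Perm.mul_apply, swap_apply_def e]
      simp only [swap_apply_def]
      have := hall g
      grind
    rw [mem_alternatingGroup, this, Perm.sign_mul, Perm.sign_mul, sign_swap hab, sign_swap hcd,
      sign_swap he.symm] at hx
    exact absurd hx (by decide)
  have hcard : ℓ - 1 ≤ (({a, b, c, d, e, x e} : Finset (Fin n))ᶜ).card := by
    rw [Finset.card_compl, Fintype.card_fin] at hU ⊢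
    omega
  obtain ⟨T, hT, hTc⟩ := Finset.exists_subset_card_eq hcard
  have hT' : ∀ g ∈ T, g ≠ a ∧ g ≠ b ∧ g ≠ c ∧ g ≠ d ∧ g ≠ e ∧ g ≠ x e := by
    intro e he
    have := hT he
    simpa using this
  have ta : a ∉ T := fun h => (hT' a h).1 rfl
  have tb : b ∉ T := fun h => (hT' b h).2.1 rfl
  have tc : c ∉ T := fun h => (hT' c h).2.2.1 rfl
  have td : d ∉ T := fun h => (hT' d h).2.2.2.1 rfl
  have te : e ∉ T := fun h => (hT' _ h).2.2.2.2.1 rfl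
  have tp : x e ∉ T := fun h => (hT' _ h).2.2.2.2.2 rfl
  refine ⟨insert e T, ?_, ?_, e, by simp, by simp [he, tp]⟩
  · rw [Finset.card_insert_of_notMem te]; omega
  · simp [ea.symm, eb.symm, ec.symm, ed.symm, ta, tb, tc, td]

/-- the target value -/
def tgt (n ℓ : ℕ) : ℕ := (n.choose ℓ - (n - 4).choose ℓ - 2 * chooseZ (n - 4) ((ℓ : ℤ) - 2) -
          chooseZ (n - 4) ((ℓ : ℤ) - 4)) / 2

lemma cardΩ : Fintype.card {S : Finset (Fin n) // S.card = ℓ} = n.choose ℓ := by simp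

lemma dt_ind {a b c d : Fin n} (hab : a ≠ b) (hcd : c ≠ d) (hac : a ≠ c) (had : a ≠ d)
    (hbc : b ≠ c) (hbd : b ≠ d) :
    2 * ind {S : Finset (Fin n) // S.card = ℓ} (swap a b * swap c d) +
      (chooseZ (n - 4) ℓ + 2 * chooseZ (n - 4) ((ℓ : ℤ) - 2)
        + chooseZ (n - 4) ((ℓ : ℤ) - 4)) = n.choose ℓ ∧
    ind {S : Finset (Fin n) // S.card = ℓ} (swap a b * swap c d) = tgt n ℓ := by
  classical
  have h := ind_exact' (Ω := {S : Finset (Fin n) // S.card = ℓ}) (swap a b * swap c d) 2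
    Nat.prime_two (dt_sq hac had hbc hbd)
  rw [dt_count hab hcd hac had hbc hbd, cardΩ] at h
  refine ⟨by omega, ?_⟩
  unfold tgt
  rw [chooseZ_nat] at h
  omega

lemma tc_ind (hn : 5 ≤ n) (hl : 1 ≤ ℓ) (hln : 2 * ℓ < n) {a b c : Fin n} (hab : a ≠ b)
    (hac : a ≠ c) (hbc : b ≠ c) :
    tgt n ℓ ≤ ind {S : Finset (Fin n) // S.card = ℓ} (swap a b * swap b c) ∧
    (ind {S : Finset (Fin n) // S.card = ℓ} (swap a b * swap b c) = tgt n ℓ ↔ ℓ = 1) := by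
  classical
  have h3 : (swap a b * swap b c).IsThreeCycle := by
    rw [swap_comm a b]
    exact isThreeCycle_swap_mul_swap_same hab.symm hbc hac
  have h := ind_exact' (Ω := {S : Finset (Fin n) // S.card = ℓ}) (swap a b * swap b c) 3
    Nat.prime_three (by rw [← h3.orderOf, pow_orderOf_eq_one])
  rw [tc_count hab hac hbc, cardΩ] at h
  obtain ⟨m, rfl⟩ : ∃ m, n = m + 4 := ⟨n - 4, by omega⟩
  unfold tgt
  rw [← chooseZ_nat (m + 4), ← chooseZ_nat (m + 4 - 4)]
  rw [← chooseZ_nat (m + 4)] at h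
  rw [show m + 4 - 3 = m + 1 by omega] at h
  rw [show m + 4 - 4 = m by omega]
  have E : chooseZ (m + 4) ℓ = chooseZ m ℓ + 4 * chooseZ m ((ℓ : ℤ) - 1) +
      6 * chooseZ m ((ℓ : ℤ) - 2) + 4 * chooseZ m ((ℓ : ℤ) - 3) + chooseZ m ((ℓ : ℤ) - 4) := by
    simp only [chooseZ_pascal, show m + 4 = m + 1 + 1 + 1 + 1 by omega, sub_sub]
    norm_num
    ring
  have E1 := chooseZ_pascal m ℓ
  have E2 := chooseZ_pascal m ((ℓ : ℤ) - 3)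
  rw [sub_sub, show (3 : ℤ) + 1 = 4 by norm_num] at E2
  rw [E, E1, E2] at h
  rw [E]
  have Z : chooseZ m ((ℓ : ℤ) - 2) = 0 ↔ ℓ = 1 := by
    unfold chooseZ
    split_ifs with hh
    · rw [Nat.choose_eq_zero_iff]; omega
    · omega
  generalize chooseZ m ((ℓ : ℤ) - 2) = u2 at *
  generalize chooseZ m ((ℓ : ℤ) - 1) = u1 at *
  generalize chooseZ m ((ℓ : ℤ) - 3) = u3 at *
  generalize chooseZ m ((ℓ : ℤ) - 4) = u4 at *
  generalize chooseZ m (ℓ : ℤ) = u0 at *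
  generalize ind {S : Finset (Fin (m + 4)) // S.card = ℓ} (swap a b * swap b c) = i at *
  rw [← Z]
  omega

lemma main (hn : 5 ≤ n) (hl : 1 ≤ ℓ) (hln : 2 * ℓ < n) (x : Perm (Fin n))
    (hx : x ∈ alternatingGroup (Fin n)) (h1 : x ≠ 1) :
    tgt n ℓ ≤ ind {S : Finset (Fin n) // S.card = ℓ} x ∧
    (ind {S : Finset (Fin n) // S.card = ℓ} x = tgt n ℓ ↔
      (IsDoubleTransposition x ∨ (ℓ = 1 ∧ x.IsThreeCycle))) := by
  classical
  by_cases hd : IsDoubleTransposition x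
  · have hd' := hd
    obtain ⟨a, b, c, d, hab, hcd, hac, had, hbc, hbd, rfl⟩ := hd
    have := (dt_ind (ℓ := ℓ) hab hcd hac had hbc hbd).2
    exact ⟨this.ge, fun _ => Or.inl hd', fun _ => this⟩
  rcases even_dichotomy x hx h1 with ⟨a, b, c, hab, hac, hbc, rfl⟩ |
    ⟨a, b, c, d, hab, hcd, hac, had, hbc, hbd, s1, s2⟩
  · have h3 : (swap a b * swap b c).IsThreeCycle := by
      rw [swap_comm a b]
      exact isThreeCycle_swap_mul_swap_same hab.symm hbc hac
    have := tc_ind hn hl hln hab hac hbc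
    exact ⟨this.1, by rw [this.2]; tauto⟩
  · have hlt : tgt n ℓ < ind {S : Finset (Fin n) // S.card = ℓ} x := by
      have hy := dt_ind (ℓ := ℓ) hab hcd hac had hbc hbd
      have hc := dt_count (ℓ := ℓ) hab hcd hac had hbc hbd
      have hlow := ind_lower' (Ω := {S : Finset (Fin n) // S.card = ℓ}) x
      rw [cardΩ] at hlow
      have hss : (Finset.univ.filter (fun S : {S : Finset (Fin n) // S.card = ℓ} => x • S = S)).card
          < (Finset.univ.filter (fun S : {S : Finset (Fin n) // S.card = ℓ} =>
            (swap a b * swap c d) • S = S)).card := by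
        apply Finset.card_lt_card
        rw [Finset.ssubset_iff_of_subset]
        · obtain ⟨S, hS, hS2, e, he, he'⟩ :=
            strict hl hln x hx hab hcd hac had hbc hbd s1 s2 hd
          refine ⟨⟨S, hS⟩, ?_, ?_⟩
          · simp only [Finset.mem_filter, Finset.mem_univ, true_and]
            rw [dt_fixed_iff hab hcd hac had hbc hbd]
            exact hS2
          · simp only [Finset.mem_filter, Finset.mem_univ, true_and]
            rw [fixed_iff]
            intro h
            exact he' ((h e).2 he)
        · intro S hS
          simp only [Finset.mem_filter, Finset.mem_univ, true_and] at hS ⊢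
          rw [fixed_iff] at hS
          rw [dt_fixed_iff hab hcd hac had hbc hbd]
          exact ⟨fixed_same x S.1 hS s1, fixed_same x S.1 hS s2⟩
      omega
    refine ⟨hlt.le, fun h => absurd h hlt.ne', ?_⟩
    rintro (h | ⟨rfl, h3⟩)
    · exact absurd h hd
    · exfalso
      -- a three-cycle has support of size three
      have hs := h3.card_support
      have : ({a, b, c, d} : Finset (Fin n)) ⊆ x.support := by
        intro e he
        simp only [Finset.mem_insert, Finset.mem_singleton] at he
        rw [mem_support]
        rcases he with rfl | rfl | rfl | rfl
        · exact moved_of_same x hab s1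
        · exact moved_of_same x hab.symm s1.symm
        · exact moved_of_same x hcd s2
        · exact moved_of_same x hcd.symm s2.symm
      have := Finset.card_le_card this
      have hA : ({a, b, c, d} : Finset (Fin n)).card = 4 := by
        rw [Finset.card_eq_succ]; exact ⟨a, {b, c, d}, by simp [*], rfl, by
          rw [Finset.card_eq_three]; exact ⟨b, c, d, hbc, hbd, hcd, rfl⟩⟩
      omega

end perms

/-- (The `A_n` case of Proposition 7.2 of the paper.) For `n ≥ 5` and
`1 ≤ ℓ` with `2ℓ < n`, the minimal index of `G = Alt(n)` acting on `ℓ`-element subsets of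
`{0, …, n-1}` is `(C(n,ℓ) - C(n-4,ℓ) - 2·C(n-4,ℓ-2) - C(n-4,ℓ-4))/2`, and a nontrivial
`x ∈ Alt(n)` attains this value if and only if `x` is a product of two disjoint
transpositions, or `ℓ = 1` and `x` is a `3`-cycle. -/
theorem stmt_10 (n ℓ : ℕ) (hn : 5 ≤ n) (hl : 1 ≤ ℓ) (hln : 2 * ℓ < n) :
    sInf {k | ∃ x ∈ alternatingGroup (Fin n), x ≠ 1 ∧
        ind {S : Finset (Fin n) // S.card = ℓ} x = k} =
      (n.choose ℓ - (n - 4).choose ℓ - 2 * chooseZ (n - 4) ((ℓ : ℤ) - 2) -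
          chooseZ (n - 4) ((ℓ : ℤ) - 4)) / 2 ∧
      ∀ x ∈ alternatingGroup (Fin n), x ≠ 1 →
        (ind {S : Finset (Fin n) // S.card = ℓ} x =
            (n.choose ℓ - (n - 4).choose ℓ - 2 * chooseZ (n - 4) ((ℓ : ℤ) - 2) -
              chooseZ (n - 4) ((ℓ : ℤ) - 4)) / 2 ↔
          (IsDoubleTransposition x ∨ (ℓ = 1 ∧ x.IsThreeCycle))) := by
  have hm := fun x hx h1 => main (n := n) (ℓ := ℓ) hn hl hln x hx h1
  refine ⟨?_, fun x hx h1 => (hm x hx h1).2⟩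
  change _ = tgt n ℓ
  apply IsLeast.csInf_eq
  constructor
  · have hab : (⟨0, by omega⟩ : Fin n) ≠ ⟨1, by omega⟩ := by simp
    have hcd : (⟨2, by omega⟩ : Fin n) ≠ ⟨3, by omega⟩ := by simp
    have hac : (⟨0, by omega⟩ : Fin n) ≠ ⟨2, by omega⟩ := by simp
    have had : (⟨0, by omega⟩ : Fin n) ≠ ⟨3, by omega⟩ := by simp
    have hbc : (⟨1, by omega⟩ : Fin n) ≠ ⟨2, by omega⟩ := by simp
    have hbd : (⟨1, by omega⟩ : Fin n) ≠ ⟨3, by omega⟩ := by simp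
    refine ⟨_, ?_, ?_, (dt_ind (ℓ := ℓ) hab hcd hac had hbc hbd).2⟩
    · rw [Equiv.Perm.mem_alternatingGroup, Equiv.Perm.sign_mul, Equiv.Perm.sign_swap hab,
        Equiv.Perm.sign_swap hcd]
      decide
    · intro h
      have := congrArg (fun y : Equiv.Perm (Fin n) => y ⟨0, by omega⟩) h
      simp only [Equiv.Perm.mul_apply, Equiv.Perm.one_apply] at this
      rw [Equiv.swap_apply_of_ne_of_ne hac had, Equiv.swap_apply_left] at this
      exact hab this.symm
  · rintro k ⟨x, hx, h1, rfl⟩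
    exact (hm x hx h1).1
end

section
/- Let p be an odd prime, d ≥ 1, V = (ℤ/pℤ)^d and m = p^d. Let H be a subgroup of GL(V) of odd order which acts irreducibly on V, and let G be the group of all affine transformations v ↦ h(v) + t with h ∈ H and t ∈ V, regarded as a permutation group on V. Let r be the smallest prime divisor of |G|. Then, as rational numbers, min( m·(1 − 3/(2r+1)), m·(1 − 1/p)² ) ≤ Ind(G) ≤ m·(1 − 1/r). -/
lemma aux_orb_s12 {Ω : Type*} [Fintype Ω] (x : Equiv.Perm Ω) (s : ℕ) (hs : s.Prime)
    (hx : orderOf x = s) :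
    Nat.card (MulAction.orbitRel.Quotient (Subgroup.zpowers x) Ω) * s =
      Nat.card Ω + (s - 1) * Nat.card {v : Ω // x v = v} := by
  classical
  have hb := MulAction.sum_card_fixedBy_eq_card_orbits_mul_card_group (Subgroup.zpowers x) Ω
  have hc : Fintype.card (Subgroup.zpowers x) = s := by
    rw [Fintype.card_zpowers, hx]
  rw [hc] at hb
  rw [Nat.card_eq_fintype_card, ← hb, ← Finset.add_sum_erase _ _ (Finset.mem_univ 1)]
  congr 1
  · rw [Nat.card_eq_fintype_card]
    apply Fintype.card_congr
    exact (Equiv.subtypeUnivEquiv (by intro v; simp))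
  · rw [Finset.sum_const_nat (m := Nat.card {v : Ω // x v = v})]
    · rw [Finset.card_erase_of_mem (Finset.mem_univ _), Finset.card_univ, hc]
    · rintro ⟨y, hy⟩ hne
      have hne' : y ≠ 1 := by
        intro h
        apply (Finset.mem_erase.1 hne).1
        ext1
        exact h
      have hz : Subgroup.zpowers y = Subgroup.zpowers x := by
        have hle : Subgroup.zpowers y ≤ Subgroup.zpowers x := by simpa using hy
        apply Subgroup.eq_of_le_of_card_ge hle
        rw [Nat.card_zpowers, Nat.card_zpowers, hx]
        have hd : orderOf y ∣ s := by
          rw [← hx, ← Nat.card_zpowers x, ← Nat.card_zpowers y]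
          exact Subgroup.card_dvd_of_le hle
        rcases (Nat.dvd_prime hs).1 hd with h | h
        · exact absurd (orderOf_eq_one_iff.1 h) hne'
        · exact h.ge
      have key : ∀ a b : Equiv.Perm Ω, a ∈ Subgroup.zpowers b → ∀ v, b v = v → a v = v := by
        rintro a b ⟨k, rfl⟩ v hv
        exact Equiv.Perm.zpow_apply_eq_self_of_apply_eq_self hv k
      rw [Nat.card_eq_fintype_card]
      apply Fintype.card_congr
      apply Equiv.subtypeEquivRight
      intro v
      rw [MulAction.mem_fixedBy]
      constructor
      · intro h
        exact key x y (hz ▸ Subgroup.mem_zpowers x) v h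
      · intro h
        exact key y x hy v h

lemma aux_pow_s12 {Ω : Type*} [Fintype Ω] (x y : Equiv.Perm Ω) (hy : y ∈ Subgroup.zpowers x) :
    ind Ω y ≤ ind Ω x := by
  classical
  unfold ind
  apply Nat.sub_le_sub_left
  let f : MulAction.orbitRel.Quotient (Subgroup.zpowers y) Ω →
      MulAction.orbitRel.Quotient (Subgroup.zpowers x) Ω :=
    Quotient.map' id (by
      rintro a b ⟨⟨g, hg⟩, h⟩
      have hle : Subgroup.zpowers y ≤ Subgroup.zpowers x := by simpa using hy
      exact ⟨⟨g, hle hg⟩, h⟩)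
  apply Nat.card_le_card_of_surjective f
  intro q
  induction q using Quotient.inductionOn' with
  | h a => exact ⟨Quotient.mk'' a, rfl⟩

lemma aux_fix_s12 {p d : ℕ} [Fact p.Prime] (h : (Fin d → ZMod p) ≃ₗ[ZMod p] (Fin d → ZMod p))
    (t : Fin d → ZMod p) (x : Equiv.Perm (Fin d → ZMod p)) (hx : ∀ v, x v = h v + t)
    (hne : x ≠ 1) :
    Nat.card {v // x v = v} = 0 ∨ ∃ e < d, Nat.card {v // x v = v} = p ^ e := by
  classical
  by_cases he : ∃ v0, x v0 = v0
  swap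
  · left
    push Not at he
    have : IsEmpty {v // x v = v} := ⟨fun v => he v.1 v.2⟩
    exact Nat.card_of_isEmpty
  right
  obtain ⟨v0, h0⟩ := he
  let K := LinearMap.ker (h.toLinearMap - LinearMap.id)
  have hK : ∀ v, v ∈ K ↔ h v = v := by
    intro v; simp [K, sub_eq_zero]
  have hcard : Nat.card {v // x v = v} = Nat.card K := by
    apply Nat.card_congr
    refine ((Equiv.addRight v0).subtypeEquiv ?_).symm
    intro v
    rw [hK, Equiv.coe_addRight, hx, map_add, add_assoc, ← hx, h0]
    simp
  have hKc : Nat.card K = p ^ Module.finrank (ZMod p) K := by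
    rw [Module.natCard_eq_pow_finrank (K := ZMod p), Nat.card_zmod]
  refine ⟨Module.finrank (ZMod p) K, ?_, hcard.trans hKc⟩
  have : K ≠ ⊤ := by
    intro hT
    apply hne
    ext1 v
    have e1 : ∀ v, h v = v := fun v => (hK v).1 (hT ▸ Submodule.mem_top)
    have ht : t = 0 := by
      have := hx v0
      rw [h0, e1] at this
      simpa using this.symm
    rw [hx, e1, ht]; simp
  have := Submodule.finrank_lt this
  simpa using this

lemma aux_main {p d r s N f : ℕ} (hp : p.Prime) (hpo : Odd p) (hs : s.Prime) (hso : Odd s)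
    (hr : 1 ≤ r) (hrs : r ≤ s)
    (hN : N * s = p ^ d + (s - 1) * f) (hf : f = 0 ∨ ∃ e < d, f = p ^ e) :
    min ((p ^ d : ℚ) * (1 - 3 / (2 * (r : ℚ) + 1))) ((p ^ d : ℚ) * (1 - 1 / (p : ℚ)) ^ 2) ≤
      ((p ^ d - N : ℕ) : ℚ) := by
  have hs1 := hs.two_le
  have hp1 := hp.two_le
  have hNle : (p ^ d : ℚ) - N ≤ ((p ^ d - N : ℕ) : ℚ) := by
    rw [sub_le_iff_le_add]
    exact_mod_cast (by omega : p ^ d ≤ p ^ d - N + N)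
  refine le_trans ?_ hNle
  have hNq : (N : ℚ) * s = p ^ d + ((s : ℚ) - 1) * f := by
    have : ((s - 1 : ℕ) : ℚ) = (s : ℚ) - 1 := by push_cast [Nat.cast_sub hs.one_le]; ring
    rw [← this]; exact_mod_cast hN
  have hrsq : (r : ℚ) ≤ s := by exact_mod_cast hrs
  have hrq : (1 : ℚ) ≤ r := by exact_mod_cast hr
  have hsq : (2 : ℚ) ≤ s := by exact_mod_cast hs1
  have hpq : (2 : ℚ) ≤ p := by exact_mod_cast hp1
  have hm : (0 : ℚ) < p ^ d := by positivity
  have hfq : (0 : ℚ) ≤ f := by positivity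
  have first : (N : ℚ) * (2 * s + 1) ≤ 3 * p ^ d →
      (p ^ d : ℚ) * (1 - 3 / (2 * (r : ℚ) + 1)) ≤ p ^ d - N := by
    intro h
    have h1 : (N : ℚ) ≤ 3 * p ^ d / (2 * r + 1) := by
      rw [le_div_iff₀ (by positivity)]
      refine le_trans ?_ h
      have : (0 : ℚ) ≤ N := by positivity
      gcongr
    have : (p ^ d : ℚ) * (1 - 3 / (2 * (r : ℚ) + 1)) = p ^ d - 3 * p ^ d / (2 * r + 1) := by ring
    linarith
  have second : (2 * s + 1) * f ≤ p ^ d → (N : ℚ) * (2 * s + 1) ≤ 3 * p ^ d := by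
    intro h
    have hq : ((2 : ℚ) * s + 1) * f ≤ p ^ d := by exact_mod_cast h
    refine le_of_mul_le_mul_right (a := (s : ℚ)) ?_ (by linarith)
    have : (N : ℚ) * (2 * s + 1) * s = (2 * s + 1) * p ^ d + (s - 1) * ((2 * s + 1) * f) := by
      linear_combination (2 * (s : ℚ) + 1) * hNq
    rw [this]
    have := mul_le_mul_of_nonneg_left hq (by linarith : (0 : ℚ) ≤ s - 1)
    linarith
  rcases hf with hf | ⟨e, hed, hf⟩
  · exact (min_le_left _ _).trans (first (second (by simp [hf])))
  obtain ⟨k, rfl⟩ : ∃ k, d = e + (k + 1) := ⟨d - e - 1, by omega⟩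
  have hmf : p ^ (e + (k + 1)) = p ^ (k + 1) * f := by rw [hf, pow_add, mul_comm]
  rcases le_or_gt p s with hsp | hsp
  · refine (min_le_right _ _).trans ?_
    have hle : (f : ℚ) * p ≤ p ^ (e + (k + 1)) := by
      have : f * p ≤ p ^ (e + (k + 1)) := by
        rw [hmf, mul_comm]
        exact Nat.mul_le_mul_right _ (Nat.le_self_pow (by omega) p)
      exact_mod_cast this
    have hspq : (p : ℚ) ≤ s := by exact_mod_cast hsp
    generalize (p ^ (e + (k + 1)) : ℚ) = m at *
    have e1 : m - N = (m - f) * (1 - 1 / s) := by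
      field_simp
      linarith
    have e2 : m * (1 - 1 / (p : ℚ)) ≤ m - f := by
      have : (f : ℚ) ≤ m / p := by rwa [le_div_iff₀ (by linarith)]
      have h3 : m * (1 - 1 / (p : ℚ)) = m - m / p := by ring
      linarith
    have e3 : (1 : ℚ) / s ≤ 1 / p := one_div_le_one_div_of_le (by linarith) hspq
    have e4 : (1 : ℚ) / p ≤ 1 := by rw [div_le_one (by linarith)]; linarith
    rw [e1, sq, ← mul_assoc]
    apply mul_le_mul e2 (by linarith) (by linarith)
    exact le_trans (mul_nonneg hm.le (by linarith)) e2
  · refine (min_le_left _ _).trans (first (second ?_))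
    rw [hmf]
    apply Nat.mul_le_mul_right
    rcases k with _ | k
    · -- codimension one
      simp only [zero_add, pow_one]
      have hdv : s ∣ f * (p - 1) := by
        have : N * s = f * (p - 1) + s * f := by
          rw [hN, hmf]
          obtain ⟨a, rfl⟩ : ∃ a, p = a + 1 := ⟨p - 1, by omega⟩
          obtain ⟨b, rfl⟩ : ∃ b, s = b + 1 := ⟨s - 1, by omega⟩
          simp; ring
        have h2 : s ∣ f * (p - 1) + s * f := ⟨N, by rw [← this, mul_comm]⟩
        exact (Nat.dvd_add_left (Dvd.intro _ rfl)).1 h2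
      rcases hs.dvd_mul.1 hdv with h | h
      · rw [hf] at h
        have := (Nat.prime_dvd_prime_iff_eq hs hp).1 (hs.dvd_of_dvd_pow h)
        omega
      · obtain ⟨c, hc⟩ := h
        obtain ⟨a, ha⟩ := hpo
        obtain ⟨b, hb⟩ := hso
        have hc2 : 2 ≤ c := by
          by_contra hlt
          have : c = 0 ∨ c = 1 := by omega
          rcases this with rfl | rfl <;> omega
        have : s * 2 ≤ s * c := Nat.mul_le_mul_left _ hc2
        omega
    · calc 2 * s + 1 ≤ p ^ 2 := by nlinarith
        _ ≤ p ^ (k + 1 + 1) := Nat.pow_le_pow_right (by omega) (by omega)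

/-- (Theorem 7.6 of the paper.) Let `p` be an odd prime, `d ≥ 1`,
`V = (ℤ/pℤ)^d`, `m = p^d`. Let `H ≤ GL(V)` be of odd order acting irreducibly on `V`, and
let `G` be the group of all affine transformations `v ↦ h v + t` (`h ∈ H`, `t ∈ V`) as a
permutation group on `V`. If `r` is the smallest prime divisor of `|G|`, then
`min(m(1 - 3/(2r+1)), m(1 - 1/p)²) ≤ Ind(G) ≤ m(1 - 1/r)`. -/
theorem stmt_12 (p d r : ℕ) [Fact p.Prime] (hp : Odd p) (hd : 1 ≤ d)
    (H : Subgroup ((Fin d → ZMod p) ≃ₗ[ZMod p] (Fin d → ZMod p)))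
    (hHodd : Odd (Nat.card H))
    (hirr : ∀ W : Submodule (ZMod p) (Fin d → ZMod p),
      (∀ h ∈ H, ∀ v ∈ W, h v ∈ W) → W = ⊥ ∨ W = ⊤)
    (G : Subgroup (Equiv.Perm (Fin d → ZMod p)))
    (hG : ∀ x : Equiv.Perm (Fin d → ZMod p),
      x ∈ G ↔ ∃ h ∈ H, ∃ t : Fin d → ZMod p, ∀ v, x v = h v + t)
    (hr : r.Prime) (hrdvd : r ∣ Nat.card G)
    (hrmin : ∀ s : ℕ, s.Prime → s ∣ Nat.card G → r ≤ s) :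
    min ((p ^ d : ℚ) * (1 - 3 / (2 * (r : ℚ) + 1))) ((p ^ d : ℚ) * (1 - 1 / (p : ℚ)) ^ 2) ≤
        ((sInf {k : ℕ | ∃ x ∈ G, x ≠ 1 ∧ ind (Fin d → ZMod p) x = k} : ℕ) : ℚ) ∧
      ((sInf {k : ℕ | ∃ x ∈ G, x ≠ 1 ∧ ind (Fin d → ZMod p) x = k} : ℕ) : ℚ) ≤
        (p ^ d : ℚ) * (1 - 1 / (r : ℚ)) := by
  classical
  have hodd : ∀ x ∈ G, orderOf x ≠ 2 := by
    intro x hx ho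
    obtain ⟨h, hh, t, ht⟩ := (hG x).1 hx
    have hxx : ∀ v, x (x v) = v := by
      intro v
      have h2 : x ^ 2 = 1 := by rw [← ho]; exact pow_orderOf_eq_one x
      have := congrArg (fun y : Equiv.Perm (Fin d → ZMod p) => y v) h2
      simpa [sq] using this
    have h0 : h t + t = 0 := by
      have := hxx 0
      rw [ht, ht] at this
      simpa using this
    have hh2 : h ^ 2 = 1 := by
      ext1 v
      have := hxx v
      rw [ht, ht, map_add, add_assoc, h0, add_zero] at this
      simpa [sq] using this
    have hh1 : h = 1 := by
      have h3 : orderOf h ∣ 2 := orderOf_dvd_of_pow_eq_one hh2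
      have h4 : orderOf h ∣ Nat.card H := Subgroup.orderOf_dvd_natCard H hh
      have h5 : orderOf h ∣ 1 := by
        have := Nat.dvd_gcd h3 h4
        rwa [(Nat.coprime_two_left.2 hHodd).gcd_eq_one] at this
      exact orderOf_eq_one_iff.1 (Nat.dvd_one.1 h5)
    have ht0 : t = 0 := by
      rw [hh1] at h0
      have h6 : t + t = 0 := by simpa using h0
      funext i
      have h7 : (2 : ZMod p) * t i = 0 := by
        have := congrFun h6 i
        rw [two_mul]; simpa using this
      rcases mul_eq_zero.1 h7 with h8 | h8
      · exfalso
        have h9 : p ∣ 2 := (ZMod.natCast_eq_zero_iff 2 p).1 (by exact_mod_cast h8)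
        have h10 := (Nat.prime_dvd_prime_iff_eq Fact.out Nat.prime_two).1 h9
        rw [h10] at hp
        exact absurd hp (by decide)
      · exact h8
    have : x = 1 := by
      ext1 v
      rw [ht, hh1, ht0]; simp
    rw [this, orderOf_one] at ho
    omega
  have hcardV : Nat.card (Fin d → ZMod p) = p ^ d := by simp
  have hfr : Fact r.Prime := ⟨hr⟩
  obtain ⟨⟨g, hgG⟩, hgo⟩ := exists_prime_orderOf_dvd_card' (G := G) r hrdvd
  have hgo' : orderOf g = r := by rw [← hgo, Subgroup.orderOf_mk]
  have hg1 : g ≠ 1 := by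
    intro h
    rw [h, orderOf_one] at hgo'
    exact hr.one_lt.ne hgo'
  have hmem : ind (Fin d → ZMod p) g ∈
      {k : ℕ | ∃ x ∈ G, x ≠ 1 ∧ ind (Fin d → ZMod p) x = k} := ⟨g, hgG, hg1, rfl⟩
  constructor
  · obtain ⟨x, hxG, hx1, hxk⟩ := Nat.sInf_mem ⟨_, hmem⟩
    rw [← hxk]
    have hox : orderOf x ≠ 1 := fun h => hx1 (orderOf_eq_one_iff.1 h)
    have hs := Nat.minFac_prime hox
    set s := (orderOf x).minFac with hsdef
    have hdvd : s ∣ orderOf x := Nat.minFac_dvd _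
    set y := x ^ (orderOf x / s) with hy
    have hyo : orderOf y = s := orderOf_pow_orderOf_div (orderOf_pos x).ne' hdvd
    have hyG : y ∈ G := G.pow_mem hxG _
    have hy1 : y ≠ 1 := by
      intro h
      rw [h, orderOf_one] at hyo
      exact hs.one_lt.ne hyo
    have hle : ind (Fin d → ZMod p) y ≤ ind (Fin d → ZMod p) x :=
      aux_pow_s12 x y (Subgroup.pow_mem _ (Subgroup.mem_zpowers x) _)
    refine le_trans ?_ (Nat.cast_le.2 hle)
    obtain ⟨h, hh, t, ht⟩ := (hG y).1 hyG
    have hN := aux_orb_s12 y s hs hyo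
    rw [hcardV] at hN
    unfold ind
    rw [hcardV]
    refine aux_main Fact.out hp hs ?_ hr.one_le ?_ hN (aux_fix_s12 h t y ht hy1)
    · exact hs.odd_of_ne_two (fun h => hodd y hyG (hyo.trans h))
    · exact hrmin s hs (hyo ▸ Subgroup.orderOf_dvd_natCard G hyG)
  · refine le_trans (Nat.cast_le.2 (Nat.sInf_le hmem)) ?_
    have hN := aux_orb_s12 g r hr hgo'
    unfold ind
    rw [hcardV] at hN ⊢
    have hNle : Nat.card (MulAction.orbitRel.Quotient (Subgroup.zpowers g) (Fin d → ZMod p))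
        ≤ p ^ d := by
      rw [← hcardV]
      exact Nat.card_le_card_of_surjective (α := Fin d → ZMod p) _ Quotient.mk''_surjective
    rw [Nat.cast_sub hNle]
    generalize Nat.card (MulAction.orbitRel.Quotient (Subgroup.zpowers g) (Fin d → ZMod p)) = N
      at *
    have h1 : p ^ d ≤ N * r := by rw [hN]; exact Nat.le_add_right _ _
    have h2 : (p ^ d : ℚ) ≤ N * r := by exact_mod_cast h1
    have hr0 : (0 : ℚ) < r := by exact_mod_cast hr.pos
    have h3 : (p ^ d : ℚ) / r ≤ N := by rwa [div_le_iff₀ hr0]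
    have h4 : (p ^ d : ℚ) * (1 - 1 / (r : ℚ)) = p ^ d - p ^ d / r := by ring
    rw [h4]
    push_cast
    linarith
end

section
/- Let F be a finite field with q elements and characteristic p, let n ≥ 2, V = F^n, and m = (q^n − 1)/(q − 1), the number of 1-dimensional subspaces of V. Let x ∈ GL(V) be non-scalar such that x^r is scalar for a prime r (that is, the image of x in PGL_n(q) has order r), and let N be the number of 1-dimensional subspaces L of V with x(L) = L. Then at least one of the following holds: (a) (r+1)·N ≤ m; (b) r = p = q, some eigenspace ker(x − a·id) with a ∈ F has dimension n − 1, and N = (q^{n−1} − 1)/(q − 1); (c) r = q − 1, some eigenspace ker(x − a·id) with a ∈ F has dimension n − 1, and N = 1 + (q^{n−1} − 1)/(q − 1). -/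
section Helpers

variable {F : Type*} [Field F] [Fintype F] {V : Type*} [AddCommGroup V] [Module F V] [Finite V]

lemma aux_eq_mul (x : V ≃ₗ[F] V) (L : Submodule F V) (hL : Module.finrank F L = 1)
    (hx : Submodule.map x.toLinearMap L = L) (v : V) (hv : v ∈ L) (hv0 : v ≠ 0) :
    ∃ a : F, x v = a • v := by
  have h1 : x v ∈ L := by
    rw [← hx]; exact Submodule.mem_map_of_mem hv
  have := (finrank_eq_one_iff_of_nonzero' (⟨v, hv⟩ : L) (by simpa using hv0)).1 hL ⟨x v, h1⟩
  obtain ⟨c, hc⟩ := this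
  exact ⟨c, by simpa using (congrArg Subtype.val hc).symm⟩

lemma aux_span (L : Submodule F V) (hL : Module.finrank F L = 1) (v : V) (hv : v ∈ L)
    (hv0 : v ≠ 0) : L = Submodule.span F {v} := by
  symm
  apply Submodule.eq_of_le_of_finrank_le
  · simpa using hv
  · rw [hL, finrank_span_singleton hv0]

lemma aux_card_ne (W : Submodule F V) :
    Nat.card {v : V // v ≠ 0 ∧ v ∈ W} = Fintype.card F ^ Module.finrank F W - 1 := by
  classical
  have h1 : Nat.card W = Fintype.card F ^ Module.finrank F W := by
    rw [Module.natCard_eq_pow_finrank (K := F), Nat.card_eq_fintype_card]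
  rw [← h1]
  have e : {v : V // v ≠ 0 ∧ v ∈ W} ≃ {w : W // w ≠ 0} :=
    { toFun := fun v => ⟨⟨v.1, v.2.2⟩, by simpa using v.2.1⟩
      invFun := fun w => ⟨w.1.1, by simpa using w.2, w.1.2⟩
      left_inv := fun _ => rfl
      right_inv := fun _ => rfl }
  rw [Nat.card_congr e]
  have := Fintype.ofFinite W
  rw [Nat.card_eq_fintype_card, Nat.card_eq_fintype_card]
  exact Set.card_ne_eq (0 : W)

lemma aux_count_s13 (x : V ≃ₗ[F] V) (W : F → Submodule F V) (hW : ∀ a v, v ∈ W a ↔ x v = a • v) :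
    Nat.card {L : Submodule F V // Module.finrank F L = 1 ∧
        Submodule.map x.toLinearMap L = L} * (Fintype.card F - 1)
      = ∑ a : F, (Fintype.card F ^ Module.finrank F (W a) - 1) := by
  classical
  have hfin : Finite (Submodule F V) := inferInstance
  have := Fintype.ofFinite {L : Submodule F V // Module.finrank F L = 1 ∧
        Submodule.map x.toLinearMap L = L}
  let E := {v : V // v ≠ 0 ∧ ∃ a : F, x v = a • v}
  let f1 : (Σ L : {L : Submodule F V // Module.finrank F L = 1 ∧
        Submodule.map x.toLinearMap L = L}, {v : V // v ≠ 0 ∧ v ∈ L.1}) → E :=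
    fun s => ⟨s.2.1, s.2.2.1, aux_eq_mul x s.1.1 s.1.2.1 s.1.2.2 s.2.1 s.2.2.2 s.2.2.1⟩
  let f2 : (Σ a : F, {v : V // v ≠ 0 ∧ v ∈ W a}) → E :=
    fun s => ⟨s.2.1, s.2.2.1, s.1, (hW _ _).1 s.2.2.2⟩
  have h1 : Function.Bijective f1 := by
    constructor
    · rintro ⟨⟨L, hL, hL'⟩, ⟨v, hv, hv'⟩⟩ ⟨⟨M, hM, hM'⟩, ⟨w, hw, hw'⟩⟩ h
      have : v = w := congrArg Subtype.val h
      subst this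
      have : L = M := by rw [aux_span L hL v hv' hv, aux_span M hM v hw' hv]
      subst this
      rfl
    · rintro ⟨v, hv, a, ha⟩
      have ha0 : a ≠ 0 := by
        rintro rfl
        rw [zero_smul] at ha
        exact hv (x.map_eq_zero_iff.1 ha)
      refine ⟨⟨⟨Submodule.span F {v}, finrank_span_singleton hv, ?_⟩,
        ⟨v, hv, Submodule.mem_span_singleton_self v⟩⟩, rfl⟩
      rw [Submodule.map_span, Set.image_singleton]
      change Submodule.span F {x v} = _
      rw [ha]
      exact Submodule.span_singleton_smul_eq (IsUnit.mk0 a ha0) v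
  have h2 : Function.Bijective f2 := by
    constructor
    · rintro ⟨a, ⟨v, hv, hv'⟩⟩ ⟨b, ⟨w, hw, hw'⟩⟩ h
      have : v = w := congrArg Subtype.val h
      subst this
      have : a = b := by
        have h3 := (hW _ _).1 hv'
        rw [(hW _ _).1 hw'] at h3
        exact (smul_left_injective F hv h3).symm
      subst this
      rfl
    · rintro ⟨v, hv, a, ha⟩
      exact ⟨⟨a, ⟨v, hv, (hW _ _).2 ha⟩⟩, rfl⟩
  have h3 := (Nat.card_congr (Equiv.ofBijective f1 h1)).trans
    (Nat.card_congr (Equiv.ofBijective f2 h2)).symm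
  rw [Nat.card_sigma, Nat.card_sigma] at h3
  simp only [aux_card_ne] at h3
  rw [← h3, Finset.sum_congr rfl (fun L _ => by rw [L.2.1, pow_one])]
  simp [Nat.card_eq_fintype_card]

lemma aux_pow_s13 (x : V ≃ₗ[F] V) (a : F) (v : V) (h : x v = a • v) (k : ℕ) :
    (x ^ k) v = a ^ k • v := by
  induction k with
  | zero => simp
  | succ k ih => rw [pow_succ', LinearEquiv.mul_apply, ih, map_smul, h, smul_smul, pow_succ]

lemma aux_mod (x : V ≃ₗ[F] V) (W : F → Submodule F V) (hW : ∀ a v, v ∈ W a ↔ x v = a • v)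
    (r : ℕ) (hr : r.Prime) (a : F) (ha0 : a ≠ 0) (h : ∀ v, (x ^ r) v = a ^ r • v) :
    Fintype.card F ^ Module.finrank F V ≡ Fintype.card F ^ Module.finrank F (W a) [MOD r] := by
  classical
  have := Fintype.ofFinite V
  have : Fact r.Prime := ⟨hr⟩
  let f : Function.End V := fun v => a⁻¹ • x v
  have hf : ∀ k v, (f ^ k) v = a⁻¹ ^ k • (x ^ k) v := by
    intro k
    induction k with
    | zero => intro v; simp; rfl
    | succ k ih =>
      intro v
      rw [pow_succ']
      change f ((f ^ k) v) = _
      rw [ih, pow_succ' x, LinearEquiv.mul_apply]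
      change a⁻¹ • x _ = _
      rw [map_smul, smul_smul, pow_succ']
  have hf1 : f ^ r ^ 1 = 1 := by
    rw [pow_one]
    funext v
    rw [hf, h, smul_smul, ← mul_pow, inv_mul_cancel₀ ha0, one_pow, one_smul]
    rfl
  have key := Equiv.Perm.card_fixedPoints_modEq hf1
  have e : Function.fixedPoints f ≃ W a :=
    Equiv.subtypeEquivRight (fun v => by
      rw [hW]
      change a⁻¹ • x v = v ↔ _
      exact inv_smul_eq_iff₀ ha0)
  rw [← Nat.card_eq_fintype_card, ← Nat.card_eq_fintype_card, Nat.card_congr e,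
    Module.natCard_eq_pow_finrank (K := F) (V := V),
    Module.natCard_eq_pow_finrank (K := F) (V := W a), Nat.card_eq_fintype_card] at key
  exact key

lemma aux_two (x : V ≃ₗ[F] V) (W : F → Submodule F V) (hW : ∀ a v, v ∈ W a ↔ x v = a • v)
    (a b : F) (hab : a ≠ b) (ha : Module.finrank F V ≤ Module.finrank F (W a) + 1)
    (hb : 0 < Module.finrank F (W b)) :
    Module.finrank F (W b) = 1 ∧ ∀ c, c ≠ a → c ≠ b → Module.finrank F (W c) = 0 := by
  have hE : W = Module.End.eigenspace (x.toLinearMap : Module.End F V) := by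
    funext a
    ext v
    rw [hW, Module.End.mem_eigenspace_iff]; rfl
  have hind : iSupIndep W := hE ▸ Module.End.eigenspaces_iSupIndep _
  have h1 := Submodule.finrank_add_finrank_le_of_disjoint (hind a)
  have hbU : W b ≤ ⨆ j, ⨆ (_ : j ≠ a), W j := le_iSup₂_of_le b hab.symm le_rfl
  have h2 := Submodule.finrank_mono hbU
  have h3 := Submodule.eq_of_le_of_finrank_le hbU (by omega)
  refine ⟨by omega, fun c hca hcb => ?_⟩
  have hcU : W c ≤ ⨆ j, ⨆ (_ : j ≠ a), W j := le_iSup₂_of_le c hca le_rfl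
  rw [← h3] at hcU
  have h4 : W c = ⊥ := by
    have := hind.pairwiseDisjoint hcb
    exact le_bot_iff.1 (this le_rfl hcU)
  rw [h4]; exact finrank_bot F V

end Helpers

/-- (The `H = P_1` subspace action for linear groups, Lemma 5.4 of the
paper.) Let `F` be a finite field with `q` elements and characteristic `p`, `n ≥ 2`,
`V = F^n`, `m = (q^n - 1)/(q - 1)`. Let `x ∈ GL(V)` be non-scalar with `x^r` scalar for a
prime `r`, and let `N` be the number of `1`-dimensional subspaces `L` with `x(L) = L`.
Then `(r+1)·N ≤ m`, or `r = p = q` with an eigenspace of dimension `n-1` and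
`N = (q^{n-1}-1)/(q-1)`, or `r = q - 1` with an eigenspace of dimension `n-1` and
`N = 1 + (q^{n-1}-1)/(q-1)`. -/
theorem stmt_13 (F : Type*) [Field F] [Fintype F] (q p n r : ℕ)
    (hq : Fintype.card F = q) (hp : p.Prime) [CharP F p] (hn : 2 ≤ n)
    (x : (Fin n → F) ≃ₗ[F] (Fin n → F))
    (hns : ¬ ∃ a : F, ∀ v, x v = a • v)
    (hr : r.Prime)
    (hscal : ∃ a : F, ∀ v, (x ^ r) v = a • v) :
    (r + 1) * Nat.card {L : Submodule F (Fin n → F) // Module.finrank F L = 1 ∧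
        Submodule.map x.toLinearMap L = L} ≤ (q ^ n - 1) / (q - 1) ∨
      (r = p ∧ p = q ∧
        (∃ a : F, Module.finrank F (LinearMap.ker
          (x.toLinearMap - a • (LinearMap.id : (Fin n → F) →ₗ[F] (Fin n → F)))) = n - 1) ∧
        Nat.card {L : Submodule F (Fin n → F) // Module.finrank F L = 1 ∧
          Submodule.map x.toLinearMap L = L} = (q ^ (n - 1) - 1) / (q - 1)) ∨
      (r = q - 1 ∧
        (∃ a : F, Module.finrank F (LinearMap.ker
          (x.toLinearMap - a • (LinearMap.id : (Fin n → F) →ₗ[F] (Fin n → F)))) = n - 1) ∧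
        Nat.card {L : Submodule F (Fin n → F) // Module.finrank F L = 1 ∧
          Submodule.map x.toLinearMap L = L} = 1 + (q ^ (n - 1) - 1) / (q - 1)) := by
  classical
  subst hq
  set q := Fintype.card F with hqdef
  have hq1 : 1 < q := Fintype.one_lt_card
  let W : F → Submodule F (Fin n → F) := fun a => LinearMap.ker
          (x.toLinearMap - a • (LinearMap.id : (Fin n → F) →ₗ[F] (Fin n → F)))
  have hW : ∀ a v, v ∈ W a ↔ x v = a • v := by
    intro a v
    simp [W, sub_eq_zero]
  have hcount := aux_count_s13 x W hW
  rw [← hqdef] at hcount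
  set N := Nat.card {L : Submodule F (Fin n → F) // Module.finrank F L = 1 ∧
        Submodule.map x.toLinearMap L = L} with hN
  have hV : Module.finrank F (Fin n → F) = n := by simp
  -- dimension bound
  have hd : ∀ a, Module.finrank F (W a) < n := by
    intro a
    by_contra hcon
    have h1 := Submodule.finrank_le (W a)
    have h2 : W a = ⊤ := Submodule.eq_top_of_finrank_eq (by omega)
    exact hns ⟨a, fun v => (hW a v).1 (by rw [h2]; trivial)⟩
  obtain ⟨c, hc⟩ := hscal
  -- eigenvalues are roots
  have hroot : ∀ a, 0 < Module.finrank F (W a) → a ≠ 0 ∧ a ^ r = c := by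
    intro a ha
    have : Nontrivial (W a) := Module.finrank_pos_iff.1 ha
    obtain ⟨⟨v, hv⟩, hvne⟩ := exists_ne (0 : W a)
    have hv0 : v ≠ 0 := by simpa using hvne
    have hxv := (hW a v).1 hv
    constructor
    · rintro rfl
      rw [zero_smul] at hxv
      exact hv0 (x.map_eq_zero_iff.1 hxv)
    · have h1 := aux_pow_s13 x a v hxv r
      rw [hc] at h1
      exact (smul_left_injective F hv0 h1).symm
  have hgoal_a : (r + 1) * (N * (q - 1)) ≤ q ^ n - 1 → (r + 1) * N ≤ (q ^ n - 1) / (q - 1) := by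
    intro h
    rw [Nat.le_div_iff_mul_le (by omega), mul_assoc]
    exact h
  have hqn : 0 < q ^ n := by positivity
  by_cases h2 : ∃ a b, a ≠ b ∧ 0 < Module.finrank F (W a) ∧ 0 < Module.finrank F (W b)
  · have hrq : r ∣ q - 1 := by
      obtain ⟨a, b, hab, ha, hb⟩ := h2
      obtain ⟨ha0, har⟩ := hroot a ha
      obtain ⟨hb0, hbr⟩ := hroot b hb
      have h1 : (a / b) ^ r = 1 := by
        rw [div_pow, har, hbr, div_self]
        rw [← hbr]; exact pow_ne_zero _ hb0
      have h3 : a / b ≠ 1 := by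
        intro h; exact hab ((div_eq_one_iff_eq hb0).1 h)
      have : Fact r.Prime := ⟨hr⟩
      rw [← orderOf_eq_prime h1 h3]
      exact orderOf_dvd_of_pow_eq_one
        (FiniteField.pow_card_sub_one_eq_one _ (div_ne_zero ha0 hb0))
    have hrle : r ≤ q - 1 := Nat.le_of_dvd (by omega) hrq
    by_cases hmax : ∃ a, Module.finrank F (W a) = n - 1
    · obtain ⟨a, ha⟩ := hmax
      obtain ⟨b, hab, hb⟩ : ∃ b, a ≠ b ∧ 0 < Module.finrank F (W b) := by
        obtain ⟨a', b', hab', ha', hb'⟩ := h2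
        by_cases h : a = a'
        · exact ⟨b', h ▸ hab', hb'⟩
        · exact ⟨a', h, ha'⟩
      obtain ⟨hb1, hc0⟩ := aux_two x W hW a b hab (by omega) hb
      have hsum : N * (q - 1) = (q ^ (n - 1) - 1) + (q - 1) := by
        rw [hcount, ← Finset.sum_subset (Finset.subset_univ {a, b}), Finset.sum_pair hab, ha,
          hb1, pow_one]
        intro c _ hcab
        simp only [Finset.mem_insert, Finset.mem_singleton, not_or] at hcab
        rw [hc0 c hcab.1 hcab.2]; simp
      by_cases hrq1 : r = q - 1
      · right; right
        refine ⟨hrq1, ⟨a, ha⟩, ?_⟩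
        have h5 : q ^ (n - 1) - 1 = (N - 1) * (q - 1) := by
          rw [Nat.sub_mul, hsum]; omega
        have h6 : N ≠ 0 := by
          intro h
          rw [h] at hsum; omega
        rw [h5, Nat.mul_div_cancel _ (by omega)]
        omega
      · left
        apply hgoal_a
        rw [hsum]
        obtain ⟨t, ht⟩ := hrq
        have ht2 : 2 ≤ t := by
          rcases t with _ | _ | t
          · omega
          · omega
          · omega
        have hr2 : 2 * r ≤ q - 1 := by rw [ht]; nlinarith
        obtain ⟨k, rfl⟩ : ∃ k, n = k + 2 := ⟨n - 2, by omega⟩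
        obtain ⟨s, hs⟩ : ∃ s, q = s + 1 := ⟨q - 1, by omega⟩
        have hQ : 1 ≤ q ^ k := Nat.one_le_pow _ _ (by omega)
        have e1 : q ^ (k + 2) = q ^ k * q * q := by ring
        have e2 : q ^ (k + 2 - 1) = q ^ k * q := by
          rw [show k + 2 - 1 = k + 1 by omega]; ring
        rw [e1, e2]
        obtain ⟨Q, hQ'⟩ : ∃ Q, q ^ k = Q + 1 := ⟨q ^ k - 1, by omega⟩
        rw [hQ', hs]
        have f1 : (Q + 1) * (s + 1) - 1 + (s + 1 - 1) = Q * s + Q + 2 * s := by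
          have : (Q + 1) * (s + 1) = Q * s + Q + s + 1 := by ring
          omega
        rw [f1]
        apply Nat.le_sub_of_add_le
        have hr2' : 2 * r ≤ s := by omega
        have g : (2 * r + 2) * (Q * s + Q + 2 * s) ≤ (s + 2) * (Q * s + Q + 2 * s) :=
          Nat.mul_le_mul_right _ (by omega)
        nlinarith [mul_nonneg (Nat.zero_le Q) (Nat.zero_le s),
          mul_nonneg (Nat.zero_le Q) (Nat.zero_le (s * s))]
    · left
      apply hgoal_a
      push Not at hmax
      have hn2 : ∀ a, Module.finrank F (W a) ≤ n - 2 := by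
        intro a
        have := hd a
        have := hmax a
        omega
      have hsum : N * (q - 1) ≤ r * (q ^ (n - 2) - 1) := by
        rw [hcount, ← Finset.sum_subset
          (Finset.subset_univ (Polynomial.nthRoots r c).toFinset)]
        · calc _ ≤ (Polynomial.nthRoots r c).toFinset.card • (q ^ (n - 2) - 1) := by
                apply Finset.sum_le_card_nsmul
                intro a _
                exact Nat.sub_le_sub_right (Nat.pow_le_pow_right (by omega) (hn2 a)) 1
            _ ≤ _ := by
                rw [smul_eq_mul]
                apply Nat.mul_le_mul_right
                exact (Multiset.toFinset_card_le _).trans (Polynomial.card_nthRoots r c)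
        · intro a _ ha
          have : Module.finrank F (W a) = 0 := by
            by_contra h
            apply ha
            rw [Multiset.mem_toFinset, Polynomial.mem_nthRoots hr.pos]
            exact (hroot a (by omega)).2
          rw [this]; simp
      have e1 : q ^ n = q * q * q ^ (n - 2) := by
        conv_lhs => rw [show n = (n - 2) + 2 by omega]
        ring
      have hQ : 1 ≤ q ^ (n - 2) := Nat.one_le_pow _ _ (by omega)
      calc _ ≤ q * (q * (q ^ (n - 2) - 1)) := by
            apply Nat.mul_le_mul (by omega)
            exact hsum.trans (Nat.mul_le_mul_right _ (by omega))
        _ ≤ _ := by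
            rw [e1, ← mul_assoc, Nat.mul_sub]
            apply Nat.sub_le_sub_left
            nlinarith
  · push Not at h2
    by_cases h1 : ∃ a, 0 < Module.finrank F (W a)
    · obtain ⟨a, ha⟩ := h1
      have hsum : N * (q - 1) = q ^ Module.finrank F (W a) - 1 := by
        rw [hcount]
        apply Finset.sum_eq_single a
        · intro b _ hb
          have := h2 a b hb.symm ha
          rw [show Module.finrank F (W b) = 0 by omega]; simp
        · simp
      obtain ⟨ha0, har⟩ := hroot a ha
      have hda := hd a
      have hbig : r + 1 ≤ q ^ (n - Module.finrank F (W a)) →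
          (r + 1) * N ≤ (q ^ n - 1) / (q - 1) := by
        intro h
        apply hgoal_a
        rw [hsum]
        calc _ ≤ q ^ (n - Module.finrank F (W a)) * (q ^ Module.finrank F (W a) - 1) :=
              Nat.mul_le_mul_right _ h
          _ ≤ _ := by
              rw [Nat.mul_sub, ← pow_add, Nat.sub_add_cancel hda.le]
              apply Nat.sub_le_sub_left
              have : 0 < q ^ (n - Module.finrank F (W a)) := by positivity
              omega
      obtain ⟨⟨k, hk⟩, hpq⟩ : (∃ k : ℕ, q = p ^ (k + 1)) ∧ p ≤ q := by
        obtain ⟨k, _, hk⟩ := FiniteField.card F p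
        refine ⟨⟨k - 1, ?_⟩, ?_⟩
        · rw [Nat.sub_add_cancel k.pos]; exact hk
        · rw [hqdef, hk]; exact Nat.le_self_pow k.ne_zero p
      by_cases hrp : r = p
      · subst hrp
        by_cases hrq : r = q
        · by_cases hdn : Module.finrank F (W a) = n - 1
          · right; left
            refine ⟨rfl, hrq, ⟨a, hdn⟩, ?_⟩
            rw [← hdn, ← hsum, Nat.mul_div_cancel _ (by omega)]
          · left
            apply hbig
            calc r + 1 ≤ q ^ 2 := by rw [hrq]; nlinarith
              _ ≤ _ := Nat.pow_le_pow_right (by omega) (by omega)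
        · left
          apply hbig
          calc r + 1 ≤ q ^ 1 := by rw [pow_one]; omega
            _ ≤ _ := Nat.pow_le_pow_right (by omega) (by omega)
      · left
        apply hbig
        have hm := aux_mod x W hW r hr a ha0 (by rw [har]; exact hc)
        rw [hV, ← hqdef] at hm
        have hdvd := (Nat.modEq_iff_dvd' (Nat.pow_le_pow_right (by omega) hda.le)).1 hm.symm
        have e1 : q ^ n - q ^ Module.finrank F (W a) =
            q ^ Module.finrank F (W a) * (q ^ (n - Module.finrank F (W a)) - 1) := by
          rw [Nat.mul_sub, ← pow_add, Nat.add_sub_cancel' hda.le, mul_one]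
        rw [e1] at hdvd
        have h3 : r ∣ q ^ (n - Module.finrank F (W a)) - 1 := by
          refine (hr.dvd_mul.1 hdvd).resolve_left ?_
          intro h
          have h4 := hr.dvd_of_dvd_pow h
          rw [hk] at h4
          exact hrp ((Nat.prime_dvd_prime_iff_eq hr hp).1 (hr.dvd_of_dvd_pow h4))
        have h5 : 1 < q ^ (n - Module.finrank F (W a)) :=
          Nat.one_lt_pow (by omega) hq1
        have := Nat.le_of_dvd (by omega) h3
        omega
    · left
      apply hgoal_a
      push Not at h1
      rw [hcount, Finset.sum_eq_zero]
      · simp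
      · intro a _
        rw [show Module.finrank F (W a) = 0 by have := h1 a; omega]; simp
end

section
/- Let F be a finite field with q elements, let r be an odd prime not dividing q, and let i be the multiplicative order of q modulo r (the least i ≥ 1 with r dividing q^i − 1). Let V be a finite-dimensional F-vector space and y : V → V an invertible linear map with y^r = id. Suppose V = U ⊕ C, where C = ker(y − id) has dimension e and U is a direct sum of a ≥ 1 pairwise isomorphic y-invariant subspaces on each of which y acts irreducibly and nontrivially (each such subspace then has dimension i). Let m = i + k with 0 ≤ k < i. Then the number of m-dimensional subspaces W of V with y(W) = W equals N(e, m) + N(e, k)·(q^{i·a} − 1)/(q^i − 1), where N(e, j) denotes the number of j-dimensional subspaces of an e-dimensional F-vector space. -/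
/-- The number of `j`-dimensional subspaces of an `e`-dimensional vector space over `F`
(the Gaussian binomial coefficient). -/
noncomputable def numSubspaces (F : Type*) [Field F] (e j : ℕ) : ℕ :=
  Nat.card {W : Submodule F (Fin e → F) // Module.finrank F W = j}

section helpers
open Polynomial

variable {F : Type*} [Field F] {V : Type*} [AddCommGroup V] [Module F V]

lemma aux_aeval_mem (T : V →ₗ[F] V) (X : Submodule F V) (hX : ∀ v ∈ X, T v ∈ X) (p : F[X])
    (v : V) (hv : v ∈ X) : aeval T p v ∈ X := by
  induction p using Polynomial.induction_on' with
  | add p q hp hq => simpa using X.add_mem hp hq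
  | monomial n c =>
    rw [aeval_monomial]
    have : ∀ n, (T ^ n) v ∈ X := by
      intro n
      induction n with
      | zero => simpa using hv
      | succ n ih => rw [pow_succ']; exact hX _ ih
    simpa [Algebra.algebraMap_eq_smul_one] using X.smul_mem c (this n)

/-- evaluation of polynomials in `T` at `u` -/
noncomputable def auxEv (T : V →ₗ[F] V) (u : V) : F[X] →ₗ[F] V :=
  (LinearMap.applyₗ u) ∘ₗ (aeval T : F[X] →ₐ[F] Module.End F V).toLinearMap

lemma auxEv_apply (T : V →ₗ[F] V) (u : V) (p : F[X]) : auxEv T u p = aeval T p u := rfl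

lemma aux_cyc_inv (T : V →ₗ[F] V) (u : V) :
    ∀ v ∈ LinearMap.range (auxEv T u), T v ∈ LinearMap.range (auxEv T u) := by
  rintro _ ⟨p, rfl⟩
  exact ⟨X * p, by simp [auxEv_apply]⟩

lemma aux_cyc_self (T : V →ₗ[F] V) (u : V) : u ∈ LinearMap.range (auxEv T u) :=
  ⟨1, by simp [auxEv_apply]⟩

lemma aux_cyc_le (T : V →ₗ[F] V) (u : V) (X : Submodule F V) (hX : ∀ v ∈ X, T v ∈ X)
    (hu : u ∈ X) : LinearMap.range (auxEv T u) ≤ X := by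
  rintro _ ⟨p, rfl⟩
  exact aux_aeval_mem T X hX p u hu

/-- annihilator ideal -/
noncomputable def auxAnn (T : V →ₗ[F] V) (u : V) : Ideal F[X] where
  carrier := {p | aeval T p u = 0}
  add_mem' := by intro a b ha hb; simp_all
  zero_mem' := by simp
  smul_mem' := by intro c x hx; simp_all

lemma auxAnn_mem (T : V →ₗ[F] V) (u : V) (p : F[X]) : p ∈ auxAnn T u ↔ aeval T p u = 0 := Iff.rfl

lemma aux_cyc_finrank (T : V →ₗ[F] V) (u : V) (f : F[X]) (hf : Irreducible f)
    (hu : u ≠ 0) (hfu : aeval T f u = 0) :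
    Module.finrank F (LinearMap.range (auxEv T u)) = f.natDegree := by
  have h1 : auxAnn T u = Ideal.span {f} := by
    symm
    have : (Ideal.span {f}).IsMaximal := PrincipalIdealRing.isMaximal_of_irreducible hf
    refine this.eq_of_le ?_ ?_
    · intro h
      have : (1 : F[X]) ∈ auxAnn T u := h ▸ Submodule.mem_top
      rw [auxAnn_mem] at this
      simp at this
      exact hu this
    · rw [Ideal.span_singleton_le_iff_mem]; exact hfu
  have h2 : LinearMap.ker (auxEv T u) = (Ideal.span {f}).restrictScalars F := by
    rw [← h1]; ext p; rfl
  rw [← finrank_quotient_span_eq_natDegree, ← (LinearMap.quotKerEquivRange (auxEv T u)).finrank_eq,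
    (Submodule.quotEquivOfEq _ _ h2).finrank_eq]
  exact (Submodule.Quotient.restrictScalarsEquiv F _).finrank_eq

lemma aux_ker_inv (T : V →ₗ[F] V) (X : Submodule F V) (hX : ∀ v ∈ X, T v ∈ X) (p : F[X]) :
    ∀ v ∈ LinearMap.ker (aeval T p) ⊓ X, T v ∈ LinearMap.ker (aeval T p) ⊓ X := by
  rintro v ⟨h1, h2⟩
  refine ⟨?_, hX v h2⟩
  rw [SetLike.mem_coe, LinearMap.mem_ker] at *
  have : aeval T p (T v) = aeval T (p * Polynomial.X) v := by simp
  rw [this, mul_comm]; simp [h1]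

/-- irreducible subspace has an irreducible annihilating polynomial -/
lemma aux_exists_poly (T : V →ₗ[F] V) (r : ℕ) (hr : 0 < r) (hT : T ^ r = 1)
    (W : Submodule F V) (hne : W ≠ ⊥) (hinv : ∀ v ∈ W, T v ∈ W)
    (hirr : ∀ W' : Submodule F V, W' ≤ W → (∀ v ∈ W', T v ∈ W') → W' = ⊥ ∨ W' = W) :
    ∃ f : F[X], Irreducible f ∧ f ∣ X ^ r - 1 ∧ ∀ v ∈ W, aeval T f v = 0 := by
  obtain ⟨w, hw, hw0⟩ := W.ne_bot_iff.1 hne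
  have key : ∀ p : F[X], aeval T p w = 0 → ∀ v ∈ W, aeval T p v = 0 := by
    intro p hp v hv
    rcases hirr _ inf_le_right (aux_ker_inv T W hinv p) with h | h
    · exact absurd ((Submodule.eq_bot_iff _).1 h w ⟨hp, hw⟩) hw0
    · rw [← h] at hv; exact hv.1
  have hprime : (auxAnn T w).IsPrime := by
    refine ⟨?_, ?_⟩
    · intro h
      have : (1 : F[X]) ∈ auxAnn T w := h ▸ Submodule.mem_top
      rw [auxAnn_mem] at this
      simp at this
      exact hw0 this
    · intro p q hpq
      rw [auxAnn_mem] at *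
      by_cases hq : aeval T q w = 0
      · exact Or.inr hq
      · left
        rcases hirr _ inf_le_right (aux_ker_inv T W hinv p) with h | h
        · refine absurd ((Submodule.eq_bot_iff _).1 h (aeval T q w) ⟨?_, ?_⟩) hq
          · simpa using hpq
          · exact aux_aeval_mem T W hinv q w hw
        · rw [← h] at hw; exact hw.1
  have hX : (X ^ r - 1 : F[X]) ∈ auxAnn T w := by
    rw [auxAnn_mem]; simp [hT]
  obtain ⟨f, hf⟩ := (IsPrincipalIdealRing.principal (auxAnn T w)).principal
  have hf' : auxAnn T w = Ideal.span {f} := hf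
  have hdvd : f ∣ X ^ r - 1 := by rw [hf', Ideal.mem_span_singleton] at hX; exact hX
  have hf0 : f ≠ 0 := by
    rintro rfl
    rw [zero_dvd_iff] at hdvd
    exact (X_pow_sub_C_ne_zero hr (1 : F)) (by simpa using hdvd)
  refine ⟨f, ?_, hdvd, key f ?_⟩
  · rw [hf', Ideal.span_singleton_prime hf0] at hprime
    exact hprime.irreducible
  · rw [← auxAnn_mem, hf']; exact Ideal.mem_span_singleton_self f

lemma aux_transport (T φ : V →ₗ[F] V) (W : Submodule F V) (hinv : ∀ v ∈ W, T v ∈ W)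
    (hφ : ∀ v ∈ W, φ (T v) = T (φ v)) (p : F[X]) (v : V) (hv : v ∈ W) :
    φ (aeval T p v) = aeval T p (φ v) := by
  induction p using Polynomial.induction_on' with
  | add p q hp hq => simp [hp, hq]
  | monomial n c =>
    have : ∀ n, (T ^ n) v ∈ W ∧ φ ((T ^ n) v) = (T ^ n) (φ v) := by
      intro n
      induction n with
      | zero => simpa using hv
      | succ n ih =>
        rw [pow_succ']
        refine ⟨hinv _ ih.1, ?_⟩
        simp only [Module.End.mul_apply]
        rw [hφ _ ih.1, ih.2]
    simp [aeval_monomial, Algebra.algebraMap_eq_smul_one, (this n).2]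

lemma aux_degree [Fintype F] (q r i : ℕ) (hq : Fintype.card F = q)
    (hr : r.Prime)
    (hi1 : 1 ≤ i) (hi2 : r ∣ q ^ i - 1) (hi3 : ∀ j, 1 ≤ j → r ∣ q ^ j - 1 → i ≤ j)
    (f : F[X]) (hf : Irreducible f) (hdvd : f ∣ X ^ r - 1) (hf1 : ¬ f ∣ X - 1) :
    f.natDegree = i := by
  have : Fact (Irreducible f) := ⟨hf⟩
  have : Fact r.Prime := ⟨hr⟩
  have hfr : Module.finrank F (AdjoinRoot f) = f.natDegree := finrank_quotient_span_eq_natDegree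
  have : Module.Finite F (AdjoinRoot f) := (AdjoinRoot.powerBasis hf.ne_zero).finite
  have : Finite (AdjoinRoot f) := Module.finite_of_finite F
  let : Fintype (AdjoinRoot f) := Fintype.ofFinite _
  have hcard : Fintype.card (AdjoinRoot f) = q ^ f.natDegree := by
    rw [Module.card_eq_pow_finrank (K := F), hq, hfr]
  have hx : AdjoinRoot.root f ^ r = 1 := by
    have := AdjoinRoot.mk_eq_zero.2 hdvd
    simpa [sub_eq_zero] using this
  have hx1 : AdjoinRoot.root f ≠ 1 := by
    intro h
    apply hf1
    rw [← AdjoinRoot.mk_eq_zero]; simp [h]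
  have hord := orderOf_eq_prime hx hx1
  have hx0 : AdjoinRoot.root f ≠ 0 := by
    intro h; rw [h, zero_pow hr.ne_zero] at hx; exact zero_ne_one hx
  have hd := hf.natDegree_pos
  apply le_antisymm
  · have : FiniteField.frobeniusAlgHom F (AdjoinRoot f) ^ i = 1 := by
      apply AdjoinRoot.algHom_ext
      have h : ∀ n, ∀ x, (FiniteField.frobeniusAlgHom F (AdjoinRoot f) ^ n) x = x ^ q ^ n := by
        intro n
        induction n with
        | zero => simp
        | succ n ih => intro x; rw [pow_succ, AlgHom.mul_apply, ih]; simp [hq, ← pow_mul, pow_succ']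
      rw [h]
      have h1 : 1 ≤ q ^ i := Nat.one_le_pow _ _ (hq ▸ Fintype.card_pos)
      have h2 : AdjoinRoot.root f ^ (q ^ i - 1) = 1 := by
        rw [← orderOf_dvd_iff_pow_eq_one, hord]; exact hi2
      rw [← Nat.sub_add_cancel h1, pow_succ, h2]; simp
    have := orderOf_dvd_of_pow_eq_one this
    rw [FiniteField.orderOf_frobeniusAlgHom, hfr] at this
    exact Nat.le_of_dvd hi1 this
  · apply hi3 _ hd
    rw [← hord, orderOf_dvd_iff_pow_eq_one, ← hcard]
    exact FiniteField.pow_card_sub_one_eq_one _ hx0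

lemma aux_finrank_iSup [FiniteDimensional F V] (a d : ℕ) (W : Fin a → Submodule F V)
    (hindep : iSupIndep W) (h : ∀ j, Module.finrank F (W j) = d) :
    Module.finrank F (⨆ j, W j : Submodule F V) = d * a := by
  classical
  have : ∀ s : Finset (Fin a), Module.finrank F (s.sup W : Submodule F V) = d * s.card := by
    intro s
    induction s using Finset.induction_on with
    | empty => simp
    | insert j s hj ih =>
      have hd : Disjoint (W j) (s.sup W) := by
        have := hindep.supIndep' (insert j s)
        exact this (Finset.subset_insert j s) (Finset.mem_insert_self j s) hj
      have := Submodule.finrank_sup_add_finrank_inf_eq (W j) (s.sup W)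
      rw [hd.eq_bot, finrank_bot, h, ih] at this
      rw [Finset.sup_insert, Finset.card_insert_of_notMem hj]
      linarith
  have h2 := this Finset.univ
  rw [Finset.sup_univ_eq_iSup] at h2
  simpa using h2

lemma aux_numSub (C : Submodule F V) [FiniteDimensional F V] (e j : ℕ)
    (he : Module.finrank F C = e) :
    Nat.card {A : Submodule F V // A ≤ C ∧ Module.finrank F A = j} = numSubspaces F e j := by
  have L : C ≃ₗ[F] (Fin e → F) := LinearEquiv.ofFinrankEq _ _ (by simp [he])
  unfold numSubspaces
  symm
  refine Nat.card_congr (Equiv.ofBijective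
    (fun A => ⟨(A.1.map L.symm.toLinearMap).map C.subtype, Submodule.map_subtype_le _ _, ?_⟩)
    ⟨?_, ?_⟩)
  · rw [Submodule.finrank_map_subtype_eq]
    exact (LinearEquiv.finrank_map_eq L.symm A.1).trans A.2
  · rintro ⟨A, hA⟩ ⟨B, hB⟩ h
    simp only [Subtype.mk.injEq] at h ⊢
    have h := Submodule.map_injective_of_injective C.subtype_injective h
    exact Submodule.map_injective_of_injective L.symm.injective h
  · rintro ⟨A, hA, hA'⟩
    refine ⟨⟨(A.comap C.subtype).map L.toLinearMap, ?_⟩, ?_⟩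
    · rw [← hA']
      rw [show Module.finrank F ((A.comap C.subtype).map L.toLinearMap : Submodule F _) = _ from
        LinearEquiv.finrank_map_eq L _]
      rw [← Submodule.finrank_map_subtype_eq, Submodule.map_comap_subtype, inf_eq_right.2 hA]
    · apply Subtype.ext
      change (((A.comap C.subtype).map L.toLinearMap).map L.symm.toLinearMap).map C.subtype = A
      have h1 : ((A.comap C.subtype).map L.toLinearMap).map L.symm.toLinearMap
          = A.comap C.subtype := by
        rw [← Submodule.map_comp, LinearEquiv.symm_comp, Submodule.map_id]
      rw [h1, Submodule.map_comap_subtype, inf_eq_right.2 hA]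

lemma aux_count_s15 [Fintype F] [FiniteDimensional F V] (q i a : ℕ) (hq : Fintype.card F = q)
    (hi1 : 1 ≤ i) (T : V →ₗ[F] V) (U : Submodule F V) (hU : Module.finrank F U = i * a)
    (hUinv : ∀ v ∈ U, T v ∈ U)
    (hcyc : ∀ u ∈ U, u ≠ 0 → Module.finrank F (LinearMap.range (auxEv T u)) = i) :
    Nat.card {Z : Submodule F V // Z ≤ U ∧ (∀ v ∈ Z, T v ∈ Z) ∧ Module.finrank F Z = i} =
      (q ^ (i * a) - 1) / (q ^ i - 1) := by
  classical
  have : Finite V := Module.finite_of_finite F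
  have : Finite (Submodule F V) := Finite.of_injective _ SetLike.coe_injective
  set S := {Z : Submodule F V // Z ≤ U ∧ (∀ v ∈ Z, T v ∈ Z) ∧ Module.finrank F Z = i} with hS
  have : Finite S := Subtype.finite
  let : Fintype S := Fintype.ofFinite _
  have hcardne : ∀ X : Submodule F V, Nat.card {v : X // v ≠ 0} = q ^ Module.finrank F X - 1 := by
    intro X
    let : Fintype X := Fintype.ofFinite _
    rw [Nat.card_eq_fintype_card, Fintype.card_subtype_compl, Fintype.card_subtype_eq,
      Module.card_eq_pow_finrank (K := F), hq]
  have hq1 : 1 < q := hq ▸ Fintype.one_lt_card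
  have hpos : 0 < q ^ i - 1 := Nat.sub_pos_of_lt (Nat.one_lt_pow (by omega) hq1)
  have huniq : ∀ Z : S, ∀ u ∈ Z.1, u ≠ 0 → LinearMap.range (auxEv T u) = Z.1 := by
    intro Z u hu hu0
    apply Submodule.eq_of_le_of_finrank_eq (aux_cyc_le T u _ Z.2.2.1 hu)
    rw [hcyc u (Z.2.1 hu) hu0, Z.2.2.2]
  have e1 : (Σ Z : S, {v : Z.1 // v ≠ 0}) ≃ {v : U // v ≠ 0} := by
    refine Equiv.ofBijective (fun p => ⟨⟨p.2.1.1, p.1.2.1 p.2.1.2⟩, ?_⟩) ⟨?_, ?_⟩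
    · intro h
      apply p.2.2
      ext
      simpa using h
    · rintro ⟨Z, ⟨v, hv⟩, hv0⟩ ⟨Z', ⟨v', hv'⟩, hv0'⟩ h
      simp only [Subtype.mk.injEq] at h
      subst h
      have h0 : v ≠ 0 := by simpa using hv0
      have : Z = Z' := Subtype.ext ((huniq Z v hv h0).symm.trans (huniq Z' v hv' h0))
      subst this
      rfl
    · rintro ⟨⟨v, hv⟩, hv0⟩
      have h0 : v ≠ 0 := by simpa using hv0
      exact ⟨⟨⟨LinearMap.range (auxEv T v), aux_cyc_le T v U hUinv hv, aux_cyc_inv T v,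
        hcyc v hv h0⟩, ⟨⟨v, aux_cyc_self T v⟩, by simpa using h0⟩⟩, rfl⟩
  have h2 := Nat.card_congr e1
  rw [Nat.card_sigma, hcardne U, hU] at h2
  rw [Finset.sum_congr rfl (fun Z _ => (hcardne Z.1).trans (by rw [Z.2.2.2]))] at h2
  rw [Finset.sum_const, smul_eq_mul, Finset.card_univ, ← Nat.card_eq_fintype_card] at h2
  rw [← h2, Nat.mul_div_cancel _ hpos]

end helpers

/-- (Lemma 5.3(ii) of the paper.) Let `F` be a finite field with `q`
elements, `r` an odd prime not dividing `q`, and `i` the multiplicative order of `q`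
mod `r`. Let `y` be an invertible linear map of a finite-dimensional `F`-vector space `V`
with `y^r = 1`, and suppose `V = U ⊕ C` where `C = ker(y - 1)` has dimension `e` and `U` is
a direct sum of `a ≥ 1` pairwise isomorphic `y`-invariant subspaces on each of which `y`
acts irreducibly and nontrivially. If `m = i + k` with `0 ≤ k < i`, then the number of
`m`-dimensional `y`-invariant subspaces of `V` equals
`N(e,m) + N(e,k)·(q^{ia} - 1)/(q^i - 1)`. -/
theorem stmt_15 (F : Type*) [Field F] [Fintype F] (q r i a e k m : ℕ)
    (hq : Fintype.card F = q)
    (hr : r.Prime) (hodd : Odd r) (hrq : ¬ r ∣ q)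
    (hi1 : 1 ≤ i) (hi2 : r ∣ q ^ i - 1) (hi3 : ∀ j, 1 ≤ j → r ∣ q ^ j - 1 → i ≤ j)
    (V : Type*) [AddCommGroup V] [Module F V] [FiniteDimensional F V]
    (y : V ≃ₗ[F] V) (hyr : y ^ r = 1)
    (ha : 1 ≤ a) (W : Fin a → Submodule F V)
    (hindep : iSupIndep W)
    (hcompl : IsCompl (⨆ j, W j)
      (LinearMap.ker (y.toLinearMap - (LinearMap.id : V →ₗ[F] V))))
    (he : Module.finrank F
      (LinearMap.ker (y.toLinearMap - (LinearMap.id : V →ₗ[F] V))) = e)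
    (hinv : ∀ j, ∀ v ∈ W j, y v ∈ W j)
    (hne : ∀ j, W j ≠ ⊥)
    (hirr : ∀ j, ∀ W' : Submodule F V, W' ≤ W j → (∀ v ∈ W', y v ∈ W') →
      W' = ⊥ ∨ W' = W j)
    (hnontriv : ∀ j, ∃ v ∈ W j, y v ≠ v)
    (hiso : ∀ j j', ∃ φ : V →ₗ[F] V, (∀ v ∈ W j, φ v = 0 → v = 0) ∧
      Submodule.map φ (W j) = W j' ∧ ∀ v ∈ W j, φ (y v) = y (φ v))
    (hk : k < i) (hm : m = i + k) :
    Nat.card {X : Submodule F V // Module.finrank F X = m ∧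
        Submodule.map y.toLinearMap X = X} =
      numSubspaces F e m + numSubspaces F e k * ((q ^ (i * a) - 1) / (q ^ i - 1)) := by
  set T : V →ₗ[F] V := y.toLinearMap with hTdef
  set C := LinearMap.ker (T - (LinearMap.id : V →ₗ[F] V)) with hC
  set U := ⨆ j, W j with hU
  have hTy : ∀ v, T v = y v := fun v => rfl
  have hTr : T ^ r = 1 := by
    ext v
    have h1 : ∀ n, (T ^ n) v = (y ^ n) v := by
      intro n
      induction n with
      | zero => rfl
      | succ n ih => rw [pow_succ', pow_succ', Module.End.mul_apply, ih]; rfl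
    rw [h1, hyr]; rfl
  have hCmem : ∀ v, v ∈ C ↔ T v = v := by
    intro v
    rw [hC, LinearMap.mem_ker, LinearMap.sub_apply, LinearMap.id_apply, sub_eq_zero]
  obtain ⟨f, hf, hfr, hfW⟩ := aux_exists_poly T r hr.pos hTr (W ⟨0, ha⟩) (hne _) (hinv _) (hirr _)
  have hf1 : ¬ f ∣ Polynomial.X - 1 := by
    rintro ⟨g, hg⟩
    obtain ⟨v, hv, hv1⟩ := hnontriv ⟨0, ha⟩
    apply hv1
    have h := hfW v hv
    have h2 : Polynomial.aeval T (Polynomial.X - 1 : Polynomial F) v = 0 := by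
      rw [hg, mul_comm, map_mul, Module.End.mul_apply, h, map_zero]
    simpa [sub_eq_zero, hTy] using h2
  have hfW' : ∀ j, ∀ v ∈ W j, Polynomial.aeval T f v = 0 := by
    intro j v hv
    obtain ⟨φ, -, h2, h3⟩ := hiso ⟨0, ha⟩ j
    rw [← h2] at hv
    obtain ⟨w, hw, rfl⟩ := hv
    rw [← aux_transport T φ (W ⟨0, ha⟩) (hinv _) h3 f w hw, hfW w hw, map_zero]
  have hfU : ∀ u ∈ U, Polynomial.aeval T f u = 0 := by
    have : U ≤ LinearMap.ker (Polynomial.aeval T f) := iSup_le fun j v hv => hfW' j v hv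
    exact fun u hu => this hu
  have hUinv : ∀ u ∈ U, T u ∈ U := by
    have : U ≤ U.comap T := iSup_le fun j v hv => (le_iSup W j) (hinv j v hv)
    exact fun u hu => this hu
  have hdeg := aux_degree q r i hq hr hi1 hi2 hi3 f hf hfr hf1
  have hcyc : ∀ u ∈ U, u ≠ 0 → Module.finrank F (LinearMap.range (auxEv T u)) = i := by
    intro u hu hu0
    rw [aux_cyc_finrank T u f hf hu0 (hfU u hu), hdeg]
  have hWd : ∀ j, Module.finrank F (W j) = i := by
    intro j
    obtain ⟨w, hw, hw0⟩ := (W j).ne_bot_iff.1 (hne j)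
    rw [← hcyc w ((le_iSup W j) hw) hw0]
    rcases hirr j _ (aux_cyc_le T w _ (hinv j) hw) (aux_cyc_inv T w) with h | h
    · exact absurd ((Submodule.eq_bot_iff _).1 h w (aux_cyc_self T w)) hw0
    · rw [h]
  have hUd : Module.finrank F U = i * a := aux_finrank_iSup a i W hindep hWd
  rw [← aux_count_s15 q i a hq hi1 T U hUd hUinv hcyc, ← aux_numSub C e m he, ← aux_numSub C e k he]
  -- finiteness
  have : Finite V := Module.finite_of_finite F
  have : Finite (Submodule F V) := Finite.of_injective _ SetLike.coe_injective
  rw [← Nat.card_prod, ← Nat.card_sum]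
  -- decomposition
  have hf1' : f.eval 1 ≠ 0 := by
    intro h
    have h1 : (Polynomial.X - Polynomial.C 1) ∣ f := Polynomial.dvd_iff_isRoot.2 h
    apply hf1
    have := (Polynomial.irreducible_X_sub_C (1 : F)).dvd_symm hf h1
    simpa using this
  have hfC : ∀ c ∈ C, Polynomial.aeval T f c = f.eval 1 • c := by
    intro c hc
    rw [hCmem] at hc
    exact Module.End.aeval_apply_of_mem_apply_eq_smul (by simpa using hc)
  have hdec : ∀ X : Submodule F V, (∀ v ∈ X, T v ∈ X) → X = (X ⊓ C) ⊔ (X ⊓ U) := by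
    intro X hX
    apply le_antisymm _ (sup_le inf_le_left inf_le_left)
    intro x hx
    have hxt : x ∈ U ⊔ C := by rw [hcompl.sup_eq_top]; trivial
    obtain ⟨u, hu, c, hc, rfl⟩ := Submodule.mem_sup.1 hxt
    have h1 := aux_aeval_mem T X hX f _ hx
    rw [map_add, hfU u hu, zero_add, hfC c hc] at h1
    have hcX : c ∈ X := (X.smul_mem_iff hf1').1 h1
    have huX : u ∈ X := (X.add_mem_iff_left hcX).1 hx
    rw [add_comm]
    exact Submodule.add_mem_sup ⟨hcX, hc⟩ ⟨huX, hu⟩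
  have hCinv : ∀ A ≤ C, ∀ v ∈ A, T v ∈ A := by
    intro A hA v hv
    rw [(hCmem v).1 (hA hv)]; exact hv
  have hmap : ∀ X : Submodule F V, X.map T = X ↔ ∀ v ∈ X, T v ∈ X := by
    intro X
    constructor
    · intro h v hv
      rw [← h]; exact Submodule.mem_map_of_mem hv
    · intro h
      apply Submodule.eq_of_le_of_finrank_eq
      · exact Submodule.map_le_iff_le_comap.2 h
      · exact LinearEquiv.finrank_map_eq y X
  have hsum : ∀ A B : Submodule F V, A ≤ C → B ≤ U →
      Module.finrank F (A ⊔ B : Submodule F V) = Module.finrank F A + Module.finrank F B := by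
    intro A B hA hB
    have := Submodule.finrank_sup_add_finrank_inf_eq A B
    rw [((hcompl.disjoint.symm).mono hA hB).eq_bot, finrank_bot] at this
    simpa using this
  have hCpart : ∀ A B : Submodule F V, A ≤ C → B ≤ U → (A ⊔ B) ⊓ C = A := by
    intro A B hA hB
    rw [sup_inf_assoc_of_le B hA, (hcompl.disjoint.mono_left hB).eq_bot, sup_bot_eq]
  have hUpart : ∀ A B : Submodule F V, A ≤ C → B ≤ U → (A ⊔ B) ⊓ U = B := by
    intro A B hA hB
    rw [sup_comm, sup_inf_assoc_of_le A hB, (hcompl.disjoint.symm.mono_left hA).eq_bot, sup_bot_eq]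
  have hsmall : ∀ Z ≤ U, (∀ v ∈ Z, T v ∈ Z) → Module.finrank F Z ≤ m →
      Z = ⊥ ∨ Module.finrank F Z = i := by
    intro Z hZ hZi hZm
    by_cases h0 : Z = ⊥
    · exact Or.inl h0
    right
    obtain ⟨w, hw, hw0⟩ := Z.ne_bot_iff.1 h0
    have hle := aux_cyc_le T w Z hZi hw
    by_cases heq : LinearMap.range (auxEv T w) = Z
    · rw [← heq]; exact hcyc w (hZ hw) hw0
    exfalso
    obtain ⟨u, hu, hu'⟩ := SetLike.exists_of_lt (lt_of_le_of_ne hle heq)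
    have hu0 : u ≠ 0 := by rintro rfl; exact hu' (Submodule.zero_mem _)
    have hdisj : LinearMap.range (auxEv T w) ⊓ LinearMap.range (auxEv T u) = ⊥ := by
      rw [Submodule.eq_bot_iff]
      rintro x ⟨hx1, hx2⟩
      by_contra hx0
      have hxU : x ∈ U := hZ (hle hx1)
      have e1 := Submodule.eq_of_le_of_finrank_eq (aux_cyc_le T x _ (aux_cyc_inv T w) hx1)
        (by rw [hcyc x hxU hx0, hcyc w (hZ hw) hw0])
      have e2 := Submodule.eq_of_le_of_finrank_eq (aux_cyc_le T x _ (aux_cyc_inv T u) hx2)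
        (by rw [hcyc x hxU hx0, hcyc u (hZ hu) hu0])
      apply hu'
      rw [← e1, e2]
      exact aux_cyc_self T u
    have h1 := Submodule.finrank_sup_add_finrank_inf_eq
      (LinearMap.range (auxEv T w)) (LinearMap.range (auxEv T u))
    rw [hdisj, finrank_bot, hcyc w (hZ hw) hw0, hcyc u (hZ hu) hu0] at h1
    have h2 := Submodule.finrank_mono (sup_le hle (aux_cyc_le T u Z hZi hu))
    omega
  have hsupinv : ∀ A B : Submodule F V, (∀ v ∈ A, T v ∈ A) → (∀ v ∈ B, T v ∈ B) →
      ∀ v ∈ A ⊔ B, T v ∈ A ⊔ B := by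
    intro A B hA hB v hv
    obtain ⟨x, hx, z, hz, rfl⟩ := Submodule.mem_sup.1 hv
    rw [map_add]
    exact Submodule.add_mem_sup (hA x hx) (hB z hz)
  symm
  refine Nat.card_congr (Equiv.ofBijective (fun s => Sum.elim
    (fun A => ⟨A.1, A.2.2, (hmap _).2 (hCinv _ A.2.1)⟩)
    (fun p => ⟨p.1.1 ⊔ p.2.1, ?_, ?_⟩) s) ⟨?_, ?_⟩)
  · rw [hsum _ _ p.1.2.1 p.2.2.1, p.1.2.2, p.2.2.2.2, hm, add_comm]
  · exact (hmap _).2 (hsupinv _ _ (hCinv _ p.1.2.1) p.2.2.2.1)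
  · rintro (⟨A, hA, hA'⟩ | ⟨⟨A, hA, hA'⟩, ⟨Z, hZ, hZi, hZd⟩⟩)
      (⟨B, hB, hB'⟩ | ⟨⟨B, hB, hB'⟩, ⟨Y, hY, hYi, hYd⟩⟩) h
    · simp only [Sum.elim_inl, Subtype.mk.injEq] at h
      subst h; rfl
    · exfalso
      simp only [Sum.elim_inl, Sum.elim_inr, Subtype.mk.injEq] at h
      have h1 := hUpart B Y hB hY
      rw [← h, (hcompl.disjoint.symm.mono_left hA).eq_bot] at h1
      rw [← h1, finrank_bot] at hYd
      omega
    · exfalso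
      simp only [Sum.elim_inl, Sum.elim_inr, Subtype.mk.injEq] at h
      have h1 := hUpart A Z hA hZ
      rw [h, (hcompl.disjoint.symm.mono_left hB).eq_bot] at h1
      rw [← h1, finrank_bot] at hZd
      omega
    · simp only [Sum.elim_inr, Subtype.mk.injEq] at h
      have h1 := hUpart A Z hA hZ
      have h2 := hCpart A Z hA hZ
      rw [h, hUpart B Y hB hY] at h1
      rw [h, hCpart B Y hB hY] at h2
      subst h1 h2; rfl
  · rintro ⟨X, hXd, hXi⟩
    rw [hmap] at hXi
    have hX := hdec X hXi
    have hUi : ∀ v ∈ X ⊓ U, T v ∈ X ⊓ U := fun v hv => ⟨hXi v hv.1, hUinv v hv.2⟩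
    have hd := hsum (X ⊓ C) (X ⊓ U) inf_le_right inf_le_right
    rw [← hX, hXd] at hd
    rcases hsmall (X ⊓ U) inf_le_right hUi (by omega) with h | h
    · rw [h, sup_bot_eq] at hX
      refine ⟨Sum.inl ⟨X, inf_eq_left.1 hX.symm, hXd⟩, rfl⟩
    · refine ⟨Sum.inr (⟨X ⊓ C, inf_le_right, by omega⟩, ⟨X ⊓ U, inf_le_right, hUi, h⟩), ?_⟩
      exact Subtype.ext hX.symm
end

section
/- Let n ≥ 2 and let x be an invertible linear map of V = 𝔽_2^n with x² = id and x ≠ id, and let e = dim ker(x − id) be the dimension of the fixed space of x. Then the number of 2-dimensional subspaces W of V with x(W) = W equals (2^e − 1)(2^{e−1} − 1)/3 + (2^n − 2^e)/2. -/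
open Classical in
theorem aux_span_s16 {V : Type*} [AddCommGroup V] [Module (ZMod 2) V] [Finite V] {u v : V}
    (hu : u ≠ 0) (hv : v ≠ 0) (huv : u ≠ v) :
    Module.finrank (ZMod 2) (Submodule.span (ZMod 2) {u, v}) = 2 := by
  have h : LinearIndependent (ZMod 2) ![u, v] := by
    rw [LinearIndependent.pair_iff]
    intro s t hst
    have h2 : ∀ a : ZMod 2, a = 0 ∨ a = 1 := by decide
    have hneg : -v = v := by
      have : v + v = 0 := by
        have h0 : (2 : ZMod 2) • v = 0 := by
          rw [show (2 : ZMod 2) = 0 from rfl, zero_smul]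
        rwa [two_smul] at h0
      exact neg_eq_of_add_eq_zero_left this
    rcases h2 s with rfl | rfl <;> rcases h2 t with rfl | rfl
    · simp
    · simp at hst; exact absurd hst hv
    · simp at hst; exact absurd hst hu
    · simp only [one_smul] at hst
      exact absurd ((eq_neg_of_add_eq_zero_left hst).trans hneg) huv
  have := finrank_span_eq_card h
  have hr : Set.range ![u, v] = {u, v} := by
    ext w; simp [eq_comm]; tauto
  rw [hr] at this
  simpa using this

theorem aux_span_eq {V : Type*} [AddCommGroup V] [Module (ZMod 2) V] [Finite V] {u v : V}
    (hu : u ≠ 0) (hv : v ≠ 0) (huv : u ≠ v) (W : Submodule (ZMod 2) V)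
    (hW : Module.finrank (ZMod 2) W = 2) (huW : u ∈ W) (hvW : v ∈ W) :
    Submodule.span (ZMod 2) {u, v} = W := by
  have : Module.Finite (ZMod 2) V := Module.Finite.of_finite
  apply Submodule.eq_of_le_of_finrank_eq
  · rw [Submodule.span_le]
    rintro w (rfl | rfl) <;> assumption
  · rw [aux_span_s16 hu hv huv, hW]

open Classical in
theorem aux_card {V : Type*} [AddCommGroup V] [Module (ZMod 2) V] [Fintype V]
    (W : Submodule (ZMod 2) V) :
    (Finset.univ.filter (fun v : V => v ∈ W)).card = 2 ^ Module.finrank (ZMod 2) W := by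
  have := Module.natCard_eq_pow_finrank (K := ZMod 2) (V := W)
  rw [Nat.card_zmod] at this
  rw [← this, Nat.card_eq_fintype_card, Fintype.card_subtype]

open Classical in
theorem aux_pairs {V : Type*} [AddCommGroup V] [Module (ZMod 2) V] [Fintype V]
    (W : Submodule (ZMod 2) V) :
    (((Finset.univ.filter (fun v : V => v ∈ W)).erase 0).offDiag).card =
      (2 ^ Module.finrank (ZMod 2) W - 1) * (2 ^ Module.finrank (ZMod 2) W - 1)
        - (2 ^ Module.finrank (ZMod 2) W - 1) := by
  rw [Finset.offDiag_card, Finset.card_erase_of_mem (by simp), aux_card]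

open Classical in
theorem aux_A {V : Type*} [AddCommGroup V] [Module (ZMod 2) V] [Fintype V]
    (F : Submodule (ZMod 2) V) (e : ℕ) (he : Module.finrank (ZMod 2) F = e) :
    (2 ^ e - 1) * (2 ^ e - 1) - (2 ^ e - 1) =
    (Finset.univ.filter (fun W : Submodule (ZMod 2) V =>
      Module.finrank (ZMod 2) W = 2 ∧ W ≤ F)).card * 6 := by
  rw [← he, ← aux_pairs F]
  rw [Finset.card_eq_sum_card_fiberwise
    (f := fun p : V × V => Submodule.span (ZMod 2) {p.1, p.2})
    (t := Finset.univ.filter (fun W : Submodule (ZMod 2) V =>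
      Module.finrank (ZMod 2) W = 2 ∧ W ≤ F))]
  · apply Finset.sum_const_nat
    intro W hW
    simp only [Finset.mem_filter, Finset.mem_univ, true_and] at hW
    have h6 := aux_pairs W
    rw [hW.1] at h6
    refine Eq.trans ?_ h6
    refine congrArg Finset.card ?_
    ext ⟨u, v⟩
    simp only [Finset.mem_filter, Finset.mem_offDiag, Finset.mem_erase, Finset.mem_univ, true_and]
    constructor
    · rintro ⟨⟨⟨hu, _⟩, ⟨hv, _⟩, huv⟩, hs⟩
      refine ⟨⟨hu, ?_⟩, ⟨hv, ?_⟩, huv⟩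
      · rw [← hs]; exact Submodule.subset_span (by simp)
      · rw [← hs]; exact Submodule.subset_span (by simp)
    · rintro ⟨⟨hu, huW⟩, ⟨hv, hvW⟩, huv⟩
      exact ⟨⟨⟨hu, hW.2 huW⟩, ⟨hv, hW.2 hvW⟩, huv⟩, aux_span_eq hu hv huv W hW.1 huW hvW⟩
  · rintro ⟨u, v⟩ h
    simp only [Finset.coe_offDiag, Set.mem_offDiag, Finset.mem_coe, Finset.mem_filter,
      Finset.mem_erase, Finset.mem_univ, true_and, Finset.coe_filter, Set.mem_setOf_eq] at h ⊢
    obtain ⟨⟨hu, huF⟩, ⟨hv, hvF⟩, huv⟩ := h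
    refine ⟨aux_span_s16 hu hv huv, ?_⟩
    rw [Submodule.span_le]
    rintro w (rfl | rfl) <;> assumption

open Classical in
theorem aux_B_s16 {V : Type*} [AddCommGroup V] [Module (ZMod 2) V] [Fintype V]
    (x : V ≃ₗ[ZMod 2] V) (hx : ∀ v, x (x v) = v) (F : Submodule (ZMod 2) V)
    (hF : ∀ v, v ∈ F ↔ x v = v) :
    (Finset.univ.filter (fun v : V => v ∉ F)).card =
    (Finset.univ.filter (fun W : Submodule (ZMod 2) V =>
      (Module.finrank (ZMod 2) W = 2 ∧ Submodule.map x.toLinearMap W = W) ∧ ¬ W ≤ F)).card * 2 := by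
  have key : ∀ u, u ∉ F → u ≠ 0 ∧ x u ≠ 0 ∧ u ≠ x u := by
    intro u hu
    have h0 : u ≠ 0 := by rintro rfl; exact hu F.zero_mem
    exact ⟨h0, by simpa using h0, fun h => hu ((hF u).2 h.symm)⟩
  have h2 : ∀ a : ZMod 2, a = 0 ∨ a = 1 := by decide
  rw [Finset.card_eq_sum_card_fiberwise
    (f := fun u : V => Submodule.span (ZMod 2) {u, x u})
    (t := Finset.univ.filter (fun W : Submodule (ZMod 2) V =>
      (Module.finrank (ZMod 2) W = 2 ∧ Submodule.map x.toLinearMap W = W) ∧ ¬ W ≤ F))]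
  · apply Finset.sum_const_nat
    intro W hW
    simp only [Finset.mem_filter, Finset.mem_univ, true_and] at hW
    obtain ⟨⟨hd, hm⟩, hn⟩ := hW
    have hxW : ∀ w ∈ W, x w ∈ W := by
      intro w hw
      rw [← hm]
      exact Submodule.mem_map_of_mem (f := x.toLinearMap) hw
    obtain ⟨u, huW, huF⟩ := SetLike.not_le_iff_exists.1 hn
    obtain ⟨k1, k2, k3⟩ := key u huF
    have hs := aux_span_eq k1 k2 k3 W hd huW (hxW u huW)
    have hxu : x u ∉ F := by
      rw [hF, hx]; exact k3
    refine Eq.trans ?_ (Finset.card_pair k3)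
    refine congrArg Finset.card ?_
    ext w
    simp only [Finset.mem_filter, Finset.mem_univ, true_and, Finset.mem_insert,
      Finset.mem_singleton]
    constructor
    · rintro ⟨hwF, hw⟩
      have hwW : w ∈ W := by rw [← hw]; exact Submodule.subset_span (by simp)
      rw [← hs, Submodule.mem_span_pair] at hwW
      obtain ⟨a, b, rfl⟩ := hwW
      rcases h2 a with rfl | rfl <;> rcases h2 b with rfl | rfl
      · simp at hwF
      · simp
      · simp
      · exfalso
        apply hwF
        rw [hF]
        simp [hx, add_comm]
    · rintro (rfl | rfl)
      · exact ⟨huF, hs⟩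
      · refine ⟨hxu, ?_⟩
        rw [hx, Set.pair_comm, hs]
  · intro u h
    simp only [Finset.mem_coe, Finset.mem_filter, Finset.mem_univ, true_and, Finset.coe_filter,
      Set.mem_setOf_eq] at h ⊢
    obtain ⟨k1, k2, k3⟩ := key u h
    refine ⟨⟨aux_span_s16 k1 k2 k3, ?_⟩, fun hle => h (hle (Submodule.subset_span (by simp)))⟩
    rw [Submodule.map_span, Set.image_pair]
    simp [hx, Set.pair_comm]



/-- (From the proof of Lemma 5.6 of the paper.) Let `n ≥ 2` and let `x`
be a nontrivial involution in `GL_n(𝔽₂)` with fixed space of dimension `e`. Then the number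
of `2`-dimensional subspaces `W` of `𝔽₂^n` with `x(W) = W` equals
`(2^e - 1)(2^{e-1} - 1)/3 + (2^n - 2^e)/2`. -/
theorem stmt_16 (n e : ℕ) (hn : 2 ≤ n)
    (x : (Fin n → ZMod 2) ≃ₗ[ZMod 2] (Fin n → ZMod 2))
    (hx2 : x ^ 2 = 1) (hx1 : x ≠ 1)
    (he : Module.finrank (ZMod 2)
      (LinearMap.ker (x.toLinearMap -
        (LinearMap.id : (Fin n → ZMod 2) →ₗ[ZMod 2] (Fin n → ZMod 2)))) = e) :
    Nat.card {W : Submodule (ZMod 2) (Fin n → ZMod 2) //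
        Module.finrank (ZMod 2) W = 2 ∧ Submodule.map x.toLinearMap W = W} =
      (2 ^ e - 1) * (2 ^ (e - 1) - 1) / 3 + (2 ^ n - 2 ^ e) / 2 := by
  classical
  set F := LinearMap.ker (x.toLinearMap -
        (LinearMap.id : (Fin n → ZMod 2) →ₗ[ZMod 2] (Fin n → ZMod 2))) with hFdef
  have hx : ∀ v, x (x v) = v := fun v => by
    have := congrArg (fun f => f v) hx2
    simpa [pow_two] using this
  have hF : ∀ v, v ∈ F ↔ x v = v := by
    intro v
    simp [hFdef, LinearMap.mem_ker, sub_eq_zero]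
  have hA := aux_A F e he
  have hB := aux_B_s16 x hx F hF
  have he1 : 1 ≤ e := by
    by_contra hlt
    have hz : Module.finrank (ZMod 2) F = 0 := by omega
    rw [Submodule.finrank_eq_zero] at hz
    apply hx1
    ext1 v
    have hmem : x v - v ∈ F := by
      rw [hF, map_sub, hx, ← neg_sub (x v) v]
      funext i
      exact ZMod.neg_eq_self_mod_two _
    rw [hz, Submodule.mem_bot, sub_eq_zero] at hmem
    exact hmem
  have hc : (Finset.univ.filter (fun v : Fin n → ZMod 2 => v ∉ F)).card = 2 ^ n - 2 ^ e := by
    have h1 := aux_card F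
    have h3 := Finset.card_filter_add_card_filter_not
      (s := (Finset.univ : Finset (Fin n → ZMod 2))) (fun v => v ∈ F)
    have h4 : (Finset.univ : Finset (Fin n → ZMod 2)).card = 2 ^ n := by
      simp [ZMod.card]
    rw [he] at h1
    omega
  rw [hc] at hB
  have hAset : (Finset.univ.filter (fun W : Submodule (ZMod 2) (Fin n → ZMod 2) =>
      (Module.finrank (ZMod 2) W = 2 ∧ Submodule.map x.toLinearMap W = W) ∧ W ≤ F)) =
      (Finset.univ.filter (fun W : Submodule (ZMod 2) (Fin n → ZMod 2) =>
      Module.finrank (ZMod 2) W = 2 ∧ W ≤ F)) := by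
    ext W
    simp only [Finset.mem_filter, Finset.mem_univ, true_and]
    constructor
    · rintro ⟨⟨h, _⟩, h'⟩
      exact ⟨h, h'⟩
    · rintro ⟨h, h'⟩
      refine ⟨⟨h, ?_⟩, h'⟩
      ext w
      rw [Submodule.mem_map]
      constructor
      · rintro ⟨y, hy, rfl⟩
        have : x y = y := (hF y).1 (h' hy)
        simpa [this] using hy
      · intro hw
        exact ⟨w, hw, (hF w).1 (h' hw)⟩
  rw [Nat.card_eq_fintype_card, Fintype.card_subtype,
    ← Finset.card_filter_add_card_filter_not (fun W : Submodule (ZMod 2) (Fin n → ZMod 2) => W ≤ F),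
    Finset.filter_filter, Finset.filter_filter, hAset]
  rw [hB, Nat.mul_div_cancel _ (by norm_num)]
  congr 1
  obtain ⟨k, rfl⟩ : ∃ k, e = k + 1 := ⟨e - 1, by omega⟩
  symm
  apply Nat.div_eq_of_eq_mul_left (by norm_num)
  have hk : 1 ≤ 2 ^ k := Nat.one_le_two_pow
  obtain ⟨m, hm⟩ : ∃ m, 2 ^ k = m + 1 := ⟨2 ^ k - 1, by omega⟩
  rw [pow_succ, hm] at hA
  rw [Nat.add_sub_cancel, pow_succ, hm]
  have e1 : (m + 1) * 2 - 1 = 2 * m + 1 := by omega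
  rw [e1] at hA ⊢
  have e2 : (2 * m + 1) * (2 * m + 1) - (2 * m + 1) = 2 * ((2 * m + 1) * m) := by
    rw [Nat.sub_eq_iff_eq_add (by nlinarith)]; ring
  rw [e2] at hA
  rw [Nat.add_sub_cancel]
  omega
end

section
/- Let n ≥ 13 and let x be a permutation in Sym(n) of prime order whose number f of fixed points satisfies 2f ≤ n. Then, as real numbers, the size of the conjugacy class of x in Sym(n) is at least n! / (2^{n/4} · ⌈n/4⌉! · ⌈n/2⌉!). -/
open Nat in
theorem aux_mono1 (n : ℕ) : n‼ ≤ (n+1)‼ := by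
  induction n using Nat.strong_induction_on with
  | _ n ih =>
    match n, ih with
    | 0, _ => simp
    | 1, _ => decide
    | n+2, ih =>
      rw [Nat.doubleFactorial_add_two, show n+2+1 = (n+1)+2 by ring, Nat.doubleFactorial_add_two]
      exact Nat.mul_le_mul (by omega) (ih n (by omega))

open Nat in
theorem aux_mono {a b : ℕ} (h : a ≤ b) : a‼ ≤ b‼ :=
  monotone_nat_of_le_succ (f := fun n => n‼) aux_mono1 h

open Nat in
theorem aux_odd (k : ℕ) : (2*k+1)‼ ≤ 2^k * (k+1)! := by
  induction k with
  | zero => simp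
  | succ k ih =>
    rw [show 2*(k+1)+1 = (2*k+1)+2 by ring, Nat.doubleFactorial_add_two, pow_succ,
      Nat.factorial_succ (k+1)]
    calc (2*k+1+2) * (2*k+1)‼ ≤ (2*(k+2)) * (2^k * (k+1)!) := Nat.mul_le_mul (by omega) ih
      _ = _ := by ring

open Nat in
theorem aux_fact (k : ℕ) (hk : 4 ≤ k) : 2^k ≤ k ! := by
  induction k, hk using Nat.le_induction with
  | base => decide
  | succ k hk ih =>
    rw [pow_succ, Nat.factorial_succ, mul_comm]
    exact Nat.mul_le_mul (by omega) ih

open Nat in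
theorem aux_rh (r h : ℕ) (hr : 2 ≤ r) : r^h * h ! ≤ (h*r)‼ := by
  induction h with
  | zero => simp
  | succ h ih =>
    have h1 : (h+1)*r = (h*r + (r-2)) + 2 := by rw [add_mul]; omega
    have mono : ∀ a b : ℕ, a ≤ b → a‼ ≤ b‼ := by
      intro a b hab
      exact aux_mono hab
    rw [h1, Nat.doubleFactorial_add_two, ← h1, pow_succ, Nat.factorial_succ]
    calc r^h * r * ((h+1) * h !) = ((h+1)*r) * (r^h * h !) := by ring
      _ ≤ _ := Nat.mul_le_mul le_rfl (ih.trans (mono _ _ (by omega)))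

open Nat in
theorem aux_down_s19 (n B : ℕ) (h0 : n‼ ≤ B) (h1 : (n-1)‼ ≤ B) (f : ℕ) (hf : 2*f ≤ n)
    (h : f*(f-1) ≤ n-f+2) : (n-f)‼ * f ! ≤ B := by
  induction f using Nat.strong_induction_on with
  | _ f ih =>
    match f, hf, h, ih with
    | 0, _, _, _ => simpa using h0
    | 1, _, _, _ => simpa using h1
    | f+2, hf, h, ih =>
      have e : n - f = (n-(f+2)) + 2 := by omega
      have h' : (f+2)*(f+1) ≤ n - f := by
        have : f + 2 - 1 = f+1 := by omega
        rw [this] at h; omega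
      have := ih f (by omega) (by omega) (by
        have : f*(f-1) ≤ (f+2)*(f+1) := Nat.mul_le_mul (by omega) (by omega)
        omega)
      refine le_trans ?_ this
      rw [e, Nat.doubleFactorial_add_two, ← e, Nat.factorial_succ, Nat.factorial_succ]
      calc (n-(f+2))‼ * ((f+1+1)*((f+1)*f !)) = ((f+2)*(f+1)) * ((n-(f+2))‼ * f !) := by ring
        _ ≤ (n-f) * ((n-(f+2))‼ * f !) := Nat.mul_le_mul h' le_rfl
        _ = _ := by ring

open Nat in
theorem aux_up_s19 (n B : ℕ) (h0 : n‼ ≤ B) (h1 : (n-1)‼ ≤ B)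
    (hm : ∀ f, 2*f ≤ n → n < 2*(f+2) → (n-f)‼ * f ! ≤ B) (d : ℕ) :
    ∀ f : ℕ, 2*f ≤ n → n - 2*f = d → (n-f)‼ * f ! ≤ B := by
  induction d using Nat.strong_induction_on with
  | _ d ih =>
    intro f hf hd
    by_cases hc : n < 2*(f+2)
    · exact hm f hf hc
    by_cases hb : n - f ≤ (f+2)*(f+1)
    · have := ih (n-2*(f+2)) (by omega) (f+2) (by omega) rfl
      refine le_trans ?_ this
      have e : n - f = (n-(f+2)) + 2 := by omega
      rw [e, Nat.doubleFactorial_add_two, ← e, Nat.factorial_succ, Nat.factorial_succ]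
      calc (n-f) * (n-(f+2))‼ * f ! = (n-f) * ((n-(f+2))‼ * f !) := by ring
        _ ≤ ((f+2)*(f+1)) * ((n-(f+2))‼ * f !) := Nat.mul_le_mul hb le_rfl
        _ = _ := by ring
    · apply aux_down_s19 n B h0 h1 f hf
      have : f*(f-1) ≤ (f+2)*(f+1) := Nat.mul_le_mul (by omega) (by omega)
      omega

open Nat in
theorem aux_main_s19 (n f : ℕ) (hn : 13 ≤ n) (hf : 2*f ≤ n) :
    (n-f)‼ * f ! ≤ 2^(n/4) * ((n+3)/4)! * ((n+1)/2)! := by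
  have mono : (n-1)‼ ≤ n‼ := aux_mono (by omega)
  have key : n‼ ≤ 2^(n/4) * ((n+3)/4)! * ((n+1)/2)! := by
    obtain ⟨k, hk | hk | hk | hk⟩ : ∃ k, n = 4*k ∨ n = 4*k+1 ∨ n = 4*k+2 ∨ n = 4*k+3 :=
      ⟨n/4, by omega⟩
    · rw [show n/4 = k by omega, show (n+3)/4 = k by omega, show (n+1)/2 = 2*k by omega,
        show n = 2*(2*k) by omega, Nat.doubleFactorial_two_mul]
      have := aux_fact k (by omega)
      calc 2^(2*k) * (2*k)! = 2^k * 2^k * (2*k)! := by ring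
        _ ≤ _ := by gcongr
    · rw [show n/4 = k by omega, show (n+3)/4 = k+1 by omega, show (n+1)/2 = 2*k+1 by omega,
        show n = 2*(2*k)+1 by omega]
      have := aux_fact (k+1) (by omega)
      refine (aux_odd _).trans ?_
      have : 2^k ≤ (k+1)! := le_trans (Nat.pow_le_pow_right (by omega) (by omega)) this
      calc 2^(2*k) * (2*k+1)! = 2^k * 2^k * (2*k+1)! := by ring
        _ ≤ _ := by gcongr
    · rw [show n/4 = k by omega, show (n+3)/4 = k+1 by omega, show (n+1)/2 = 2*k+1 by omega,
        show n = 2*(2*k+1) by omega, Nat.doubleFactorial_two_mul]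
      have := aux_fact (k+1) (by omega)
      calc 2^(2*k+1) * (2*k+1)! = 2^k * 2^(k+1) * (2*k+1)! := by ring
        _ ≤ _ := by gcongr
    · rw [show n/4 = k by omega, show (n+3)/4 = k+1 by omega, show (n+1)/2 = 2*k+2 by omega,
        show n = 2*(2*k+1)+1 by omega]
      have := aux_fact (k+1) (by omega)
      refine (aux_odd _).trans ?_
      calc 2^(2*k+1) * (2*k+1+1)! = 2^k * 2^(k+1) * (2*k+2)! := by ring
        _ ≤ _ := by gcongr
  refine aux_up_s19 n _ key (mono.trans key) ?_ _ f hf rfl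
  clear hf f
  intro f hf hf2
  obtain ⟨k, hk | hk | hk | hk⟩ : ∃ k, n = 4*k ∨ n = 4*k+1 ∨ n = 4*k+2 ∨ n = 4*k+3 :=
      ⟨n/4, by omega⟩
  · rw [show n/4 = k by omega, show (n+3)/4 = k by omega, show (n+1)/2 = 2*k by omega]
    obtain h | h : f = 2*k ∨ f + 1 = 2*k := by omega
    · rw [show n - f = 2*k by omega, h, Nat.doubleFactorial_two_mul]
    · rw [show n - f = 2*k+1 by omega]
      rw [show (2*k)! = (f+1) * (f !) by rw [← h, Nat.factorial_succ f]]
      refine (Nat.mul_le_mul (aux_odd k) le_rfl).trans ?_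
      rw [Nat.factorial_succ k]
      calc _ = (k+1) * (2^k * k ! * f !) := by ring
        _ ≤ (f+1) * (2^k * k ! * f !) := Nat.mul_le_mul (by omega) le_rfl
        _ = _ := by ring
  · rw [show n/4 = k by omega, show (n+3)/4 = k+1 by omega, show (n+1)/2 = 2*k+1 by omega]
    obtain h | h : f = 2*k ∨ f + 1 = 2*k := by omega
    · rw [show n - f = 2*k+1 by omega, h]
      exact Nat.mul_le_mul (aux_odd k) (Nat.factorial_le (by omega))
    · rw [show n - f = 2*(k+1) by omega, ← h, Nat.doubleFactorial_two_mul, Nat.factorial_succ (f+1),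
        Nat.factorial_succ f]
      calc _ = 2 * (2^k * (k+1)! * f !) := by ring
        _ ≤ ((f+2) * (f+1)) * (2^k * (k+1)! * f !) := Nat.mul_le_mul (by nlinarith) le_rfl
        _ = _ := by ring
  · rw [show n/4 = k by omega, show (n+3)/4 = k+1 by omega, show (n+1)/2 = 2*k+1 by omega]
    obtain h | h : f = 2*k+1 ∨ f = 2*k := by omega
    · rw [show n - f = 2*k+1 by omega, h]
      exact Nat.mul_le_mul (aux_odd k) le_rfl
    · rw [show n - f = 2*(k+1) by omega, ← h, Nat.doubleFactorial_two_mul, Nat.factorial_succ f]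
      calc _ = 2 * (2^k * (k+1)! * f !) := by ring
        _ ≤ (f+1) * (2^k * (k+1)! * f !) := Nat.mul_le_mul (by omega) le_rfl
        _ = _ := by ring
  · rw [show n/4 = k by omega, show (n+3)/4 = k+1 by omega, show (n+1)/2 = 2*k+1+1 by omega]
    obtain h | h : f = 2*k+1 ∨ f = 2*k := by omega
    · rw [show n - f = 2*(k+1) by omega, ← h, Nat.doubleFactorial_two_mul, Nat.factorial_succ f]
      calc _ = 2 * (2^k * (k+1)! * f !) := by ring
        _ ≤ (f+1) * (2^k * (k+1)! * f !) := Nat.mul_le_mul (by omega) le_rfl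
        _ = _ := by ring
    · rw [show n - f = 2*(k+1)+1 by omega, ← h, Nat.factorial_succ (f+1), Nat.factorial_succ f]
      refine (Nat.mul_le_mul (aux_odd (k+1)) le_rfl).trans ?_
      rw [Nat.factorial_succ (k+1)]
      calc _ = (2*(k+2)) * (2^k * (k+1)! * f !) := by ring
        _ ≤ ((f+2) * (f+1)) * (2^k * (k+1)! * f !) := Nat.mul_le_mul (by nlinarith) le_rfl
        _ = _ := by ring

open Nat in
theorem aux_card_s19 (n : ℕ) (x : Equiv.Perm (Fin n)) (hx : (orderOf x).Prime) :
    ∃ r h : ℕ, 2 ≤ r ∧ h * r + Nat.card {a : Fin n // x a = a} = n ∧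
      Nat.card {y : Equiv.Perm (Fin n) // IsConj x y} *
        (r^h * h ! * (Nat.card {a : Fin n // x a = a})!) = n ! := by
  obtain ⟨h, hh⟩ := Equiv.Perm.cycleType_prime_order hx
  have hs : x.cycleType.sum = x.support.card := Equiv.Perm.sum_cycleType x
  have hle : x.support.card ≤ n := by simpa using Finset.card_le_univ x.support
  have hfix : Nat.card {a : Fin n // x a = a} = n - x.support.card := by
    have h3 : (Finset.univ.filter (fun a => x a = a)) = x.supportᶜ := by
      ext a; simp
    rw [Nat.card_eq_fintype_card, Fintype.card_subtype, h3, Finset.card_compl, Fintype.card_fin]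
  have hs2 : (h+1) * orderOf x = x.support.card := by rw [← hs, hh, Multiset.sum_replicate, smul_eq_mul]
  have hc := Equiv.Perm.card_isConj_mul_eq x
  refine ⟨orderOf x, h+1, hx.two_le, by omega, ?_⟩
  rw [hs, hh] at hc
  simp only [Fintype.card_fin, Multiset.prod_replicate] at hc
  rw [← hfix, Multiset.toFinset_replicate] at hc
  simp only [Nat.succ_ne_zero, if_false, Finset.prod_singleton, Multiset.count_replicate_self] at hc
  have : Nat.card {y : Equiv.Perm (Fin n) // IsConj x y} = Nat.card ({y | IsConj x y} : Set _) := rfl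
  rw [← hc, this]
  ring

/-- (From Case 1 of the proof of Proposition 3.2 of the paper.) Let
`n ≥ 13` and let `x ∈ Sym(n)` have prime order with at most `n/2` fixed points. Then the
conjugacy class of `x` in `Sym(n)` has size at least
`n! / (2^{n/4} · ⌈n/4⌉! · ⌈n/2⌉!)` (as real numbers, with a real power `2^{n/4}`). -/
theorem stmt_19 (n : ℕ) (hn : 13 ≤ n) (x : Equiv.Perm (Fin n))
    (hx : (orderOf x).Prime)
    (hf : 2 * Nat.card {a : Fin n // x a = a} ≤ n) :
    (Nat.factorial n : ℝ) /
        ((2 : ℝ) ^ ((n : ℝ) / 4) * (Nat.factorial ⌈(n : ℚ) / 4⌉₊ : ℝ) *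
          (Nat.factorial ⌈(n : ℚ) / 2⌉₊ : ℝ)) ≤
      (Nat.card {y : Equiv.Perm (Fin n) // IsConj x y} : ℝ) := by
  obtain ⟨r, h, hr, hsum, hcard⟩ := aux_card_s19 n x hx
  generalize Nat.card {a : Fin n // x a = a} = f at *
  generalize Nat.card {y : Equiv.Perm (Fin n) // IsConj x y} = C at *
  have hm := aux_main_s19 n f hn hf
  have hrh := aux_rh r h hr
  rw [show h * r = n - f by omega] at hrh
  have hB := (Nat.mul_le_mul hrh (le_refl f.factorial)).trans hm
  have c4 : (n+3)/4 ≤ ⌈(n : ℚ) / 4⌉₊ := by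
    have h1 := Nat.le_ceil ((n : ℚ) / 4)
    have h2 : (n:ℚ) ≤ 4 * (⌈(n : ℚ) / 4⌉₊ : ℚ) := by linarith
    have h3 : n ≤ 4 * ⌈(n : ℚ) / 4⌉₊ := by exact_mod_cast h2
    omega
  have c2 : (n+1)/2 ≤ ⌈(n : ℚ) / 2⌉₊ := by
    have h1 := Nat.le_ceil ((n : ℚ) / 2)
    have h2 : (n:ℚ) ≤ 2 * (⌈(n : ℚ) / 2⌉₊ : ℚ) := by linarith
    have h3 : n ≤ 2 * ⌈(n : ℚ) / 2⌉₊ := by exact_mod_cast h2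
    omega
  have p : ((2:ℝ)^(n/4)) ≤ (2 : ℝ) ^ ((n : ℝ) / 4) := by
    rw [← Real.rpow_natCast]
    apply Real.rpow_le_rpow_of_exponent_le (by norm_num)
    exact_mod_cast (Nat.cast_div_le (α := ℝ) (m := n) (n := 4))
  have hpos : (0:ℝ) < (2 : ℝ) ^ ((n : ℝ) / 4) := by positivity
  rw [div_le_iff₀ (by positivity), ← hcard]
  push_cast
  have hB' : ((r:ℝ)^h * h.factorial * f.factorial) ≤
      2^(n/4) * ((n+3)/4).factorial * ((n+1)/2).factorial := by exact_mod_cast hB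
  have f4 : ((((n+3)/4).factorial : ℕ) : ℝ) ≤ (Nat.factorial ⌈(n : ℚ) / 4⌉₊ : ℝ) := by
    exact_mod_cast Nat.factorial_le c4
  have f2 : ((((n+1)/2).factorial : ℕ) : ℝ) ≤ (Nat.factorial ⌈(n : ℚ) / 2⌉₊ : ℝ) := by
    exact_mod_cast Nat.factorial_le c2
  refine mul_le_mul_of_nonneg_left (hB'.trans ?_) (by positivity)
  gcongr
end
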